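/- arXiv:math/0702897 — 3 statements merged into one kernel-verified Lean document; each statement's English description precedes it below -/
import Mathlib

section
/- (Principal kinematic formula in the Euclidean plane, convex case.) Let K and L be compact convex sets in ℝ² with nonempty interiors. Then ∫_{ℝ²} ∫_{[0,2π)} 1[K ∩ (x + R_θ L) ≠ ∅] dθ/(2π) dx = A_K + A_L + (1/(2π))·P_K·P_L, where R_θ denotes rotation of ℝ² by angle θ about the origin, the inner integral is with respect to the uniform probability measure on angles, and the outer integral is with respect to Lebesgue measure on ℝ². -/
open MeasureTheory Metric Real

/-- The area (Lebesgue measure) of a subset of the Euclidean plane. -/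
noncomputable def euclArea (K : Set (EuclideanSpace ℝ (Fin 2))) : ℝ :=
  (volume K).toReal

/-- The perimeter: one-dimensional Hausdorff measure of the topological boundary. -/
noncomputable def euclPerim (K : Set (EuclideanSpace ℝ (Fin 2))) : ℝ :=
  (μH[1] (frontier K)).toReal

/-- Rotation of the Euclidean plane by angle `θ` about the origin. -/
noncomputable def rot (θ : ℝ) (x : EuclideanSpace ℝ (Fin 2)) : EuclideanSpace ℝ (Fin 2) :=
  (WithLp.equiv 2 (Fin 2 → ℝ)).symm
    ![Real.cos θ * x 0 - Real.sin θ * x 1, Real.sin θ * x 0 + Real.cos θ * x 1]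

section
/-- component in direction `φ` -/
noncomputable def pp (x : ℝ × ℝ) (φ : ℝ) : ℝ := x.1 * cos φ + x.2 * sin φ
/-- component in direction `φ + π/2` -/
noncomputable def qq (x : ℝ × ℝ) (φ : ℝ) : ℝ := -x.1 * sin φ + x.2 * cos φ
/-- support function -/
noncomputable def hh (K : Set (ℝ × ℝ)) (φ : ℝ) : ℝ := sSup ((fun x => pp x φ) '' K)

lemma pp_sq_add_qq_sq (x : ℝ × ℝ) (φ : ℝ) : pp x φ ^ 2 + qq x φ ^ 2 = x.1 ^ 2 + x.2 ^ 2 := by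
  unfold pp qq
  linear_combination (x.1 ^ 2 + x.2 ^ 2) * (sin_sq_add_cos_sq φ)

lemma pp_cont (φ : ℝ) : Continuous (fun x => pp x φ) := by unfold pp; fun_prop

lemma pp_hasDeriv (x : ℝ × ℝ) (φ : ℝ) : HasDerivAt (pp x) (qq x φ) φ := by
  have := ((hasDerivAt_cos φ).const_mul x.1).add ((hasDerivAt_sin φ).const_mul x.2)
  have e : qq x φ = x.1 * -sin φ + x.2 * cos φ := by unfold qq; ring
  rw [e]; exact this

lemma pp_periodic (x : ℝ × ℝ) : Function.Periodic (pp x) (2 * π) := by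
  intro φ; simp [pp]

lemma qq_periodic (x : ℝ × ℝ) : Function.Periodic (qq x) (2 * π) := by
  intro φ; simp [qq]

lemma pp_add_pi (x : ℝ × ℝ) (φ : ℝ) : pp x (φ + π) = - pp x φ := by
  simp [pp]; ring

lemma pp_add (x y : ℝ × ℝ) (φ : ℝ) : pp (x + y) φ = pp x φ + pp y φ := by
  simp [pp]; ring

lemma pp_sub_le (x : ℝ × ℝ) (a b : ℝ) : pp x a - pp x b ≤ (|x.1| + |x.2|) * |a - b| := by
  have h1 : |cos a - cos b| ≤ |a - b| := abs_cos_sub_cos_le a b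
  have h2 : |sin a - sin b| ≤ |a - b| := abs_sin_sub_sin_le a b
  calc pp x a - pp x b = x.1 * (cos a - cos b) + x.2 * (sin a - sin b) := by unfold pp; ring
    _ ≤ |x.1| * |cos a - cos b| + |x.2| * |sin a - sin b| := by
        rw [← abs_mul, ← abs_mul]; exact add_le_add (le_abs_self _) (le_abs_self _)
    _ ≤ |x.1| * |a - b| + |x.2| * |a - b| := by gcongr
    _ = _ := by ring

lemma pp_sin3 (x : ℝ × ℝ) (a b c : ℝ) :
    pp x b * sin (c - a) = sin (c - b) * pp x a + sin (b - a) * pp x c := by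
  simp only [pp, sin_sub]
  ring

variable {K : Set (ℝ × ℝ)}

lemma hh_bdd (hK : IsCompact K) (φ : ℝ) : BddAbove ((fun x => pp x φ) '' K) :=
  (hK.image (pp_cont φ)).bddAbove

lemma le_hh (hK : IsCompact K) {x : ℝ × ℝ} (hx : x ∈ K) (φ : ℝ) : pp x φ ≤ hh K φ :=
  le_csSup (hh_bdd hK φ) ⟨x, hx, rfl⟩

lemma hh_le (hne : K.Nonempty) {φ c : ℝ} (h : ∀ x ∈ K, pp x φ ≤ c) : hh K φ ≤ c := by
  apply csSup_le (hne.image _)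
  rintro _ ⟨x, hx, rfl⟩; exact h x hx

lemma hh_ex (hK : IsCompact K) (hne : K.Nonempty) (φ : ℝ) : ∃ x ∈ K, pp x φ = hh K φ := by
  have := (hK.image (pp_cont φ)).sSup_mem (hne.image _)
  obtain ⟨x, hx, h⟩ := this
  exact ⟨x, hx, h⟩

lemma hh_periodic (K : Set (ℝ × ℝ)) : Function.Periodic (hh K) (2 * π) := by
  intro φ; unfold hh; simp only [pp_periodic _ φ]

lemma hh_lip (hK : IsCompact K) (hne : K.Nonempty) : ∃ C, LipschitzWith C (hh K) := by
  have hb : BddAbove ((fun x : ℝ × ℝ => |x.1| + |x.2|) '' K) :=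
    (hK.image (by fun_prop)).bddAbove
  obtain ⟨C, hC⟩ := hb
  refine ⟨C.toNNReal, LipschitzWith.of_le_add_mul _ ?_⟩
  intro a b
  apply hh_le hne
  intro x hx
  have h1 := pp_sub_le x a b
  have h2 := le_hh hK hx b
  have h3 : |x.1| + |x.2| ≤ C := hC ⟨x, hx, rfl⟩
  have h4 : 0 ≤ C := by have := abs_nonneg x.1; have := abs_nonneg x.2; linarith
  rw [Real.coe_toNNReal _ h4, Real.dist_eq]
  have := mul_le_mul_of_nonneg_right h3 (abs_nonneg (a - b))
  linarith

lemma hh_cont (hK : IsCompact K) (hne : K.Nonempty) : Continuous (hh K) :=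
  (hh_lip hK hne).choose_spec.continuous

lemma hh_sin3 (hK : IsCompact K) (hne : K.Nonempty) {a b c : ℝ} (hab : a ≤ b) (hbc : b ≤ c)
    (hac : c ≤ a + π) :
    hh K b * sin (c - a) ≤ sin (c - b) * hh K a + sin (b - a) * hh K c := by
  obtain ⟨x, hx, h⟩ := hh_ex hK hne b
  rw [← h, pp_sin3]
  have h1 : 0 ≤ sin (c - b) := sin_nonneg_of_nonneg_of_le_pi (by linarith) (by linarith)
  have h2 : 0 ≤ sin (b - a) := sin_nonneg_of_nonneg_of_le_pi (by linarith) (by linarith)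
  gcongr
  · exact le_hh hK hx a
  · exact le_hh hK hx c

lemma hh_add_pi (hK : IsCompact K) (hne : K.Nonempty) (φ : ℝ) : 0 ≤ hh K φ + hh K (φ + π) := by
  obtain ⟨x, hx⟩ := hne
  have h1 := le_hh hK hx φ
  have h2 := le_hh hK hx (φ + π)
  rw [pp_add_pi] at h2
  linarith

lemma hh_sep (hK : IsCompact K) (hc : Convex ℝ K) (hne : K.Nonempty) {y : ℝ × ℝ} (hy : y ∉ K) :
    ∃ φ, hh K φ < pp y φ := by
  obtain ⟨f, u, h1, h2⟩ := geometric_hahn_banach_closed_point hc hK.isClosed hy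
  have hf : ∀ x : ℝ × ℝ, f x = x.1 * f (1, 0) + x.2 * f (0, 1) := by
    intro x
    have : x = x.1 • ((1 : ℝ), (0 : ℝ)) + x.2 • ((0 : ℝ), (1 : ℝ)) := by ext <;> simp
    conv_lhs => rw [this]
    rw [map_add, map_smul, map_smul]; simp
  set z : ℂ := ⟨f (1, 0), f (0, 1)⟩ with hz
  have e1 : f (1, 0) = ‖z‖ * cos z.arg := (Complex.norm_mul_cos_arg z).symm
  have e2 : f (0, 1) = ‖z‖ * sin z.arg := (Complex.norm_mul_sin_arg z).symm
  have hf' : ∀ x : ℝ × ℝ, f x = ‖z‖ * pp x z.arg := by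
    intro x; rw [hf, e1, e2, pp]; ring
  refine ⟨z.arg, ?_⟩
  obtain ⟨x, hx, h⟩ := hh_ex hK hne z.arg
  rw [← h]
  have h3 := (h1 x hx).trans h2
  rw [hf', hf'] at h3
  exact lt_of_mul_lt_mul_left h3 (norm_nonneg _)

lemma hh_deriv (hK : IsCompact K) {φ : ℝ} (hd : DifferentiableAt ℝ (hh K) φ) {x : ℝ × ℝ}
    (hx : x ∈ K) (h : pp x φ = hh K φ) : deriv (hh K) φ = qq x φ := by
  have h1 : HasDerivAt (fun t => hh K t - pp x t) (deriv (hh K) φ - qq x φ) φ :=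
    hd.hasDerivAt.sub (pp_hasDeriv x φ)
  have h2 : IsLocalMin (fun t => hh K t - pp x t) φ := by
    apply Filter.Eventually.of_forall
    intro t
    have := le_hh hK hx t
    simp only [h, sub_self]; linarith
  have := h2.hasDerivAt_eq_zero h1
  linarith

/-- the tangent line map -/
noncomputable def ff (h : ℝ → ℝ) (z : ℝ × ℝ) : ℝ × ℝ :=
  (h z.1 * cos z.1 - z.2 * sin z.1, h z.1 * sin z.1 + z.2 * cos z.1)

lemma pp_ff (h : ℝ → ℝ) (z : ℝ × ℝ) : pp (ff h z) z.1 = h z.1 := by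
  simp only [pp, ff]; linear_combination (h z.1) * sin_sq_add_cos_sq z.1
lemma qq_ff (h : ℝ → ℝ) (z : ℝ × ℝ) : qq (ff h z) z.1 = z.2 := by
  simp only [qq, ff]; linear_combination (z.2) * sin_sq_add_cos_sq z.1
lemma ff_eq (h : ℝ → ℝ) (φ : ℝ) (y : ℝ × ℝ) (hy : pp y φ = h φ) : ff h (φ, qq y φ) = y := by
  simp only [ff, ← hy, pp, qq]
  ext
  · simp only; linear_combination (y.1) * sin_sq_add_cos_sq φ
  · simp only; linear_combination (y.2) * sin_sq_add_cos_sq φ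

/-- the derivative of the tangent line map -/
noncomputable def ff' (h : ℝ → ℝ) (z : ℝ × ℝ) : ℝ × ℝ →L[ℝ] ℝ × ℝ :=
  ((Matrix.toLin (Module.Basis.finTwoProd ℝ) (Module.Basis.finTwoProd ℝ)
    !![deriv h z.1 * cos z.1 - h z.1 * sin z.1 - z.2 * cos z.1, - sin z.1;
      deriv h z.1 * sin z.1 + h z.1 * cos z.1 - z.2 * sin z.1, cos z.1])).toContinuousLinearMap

lemma ff'_det (h : ℝ → ℝ) (z : ℝ × ℝ) : (ff' h z).det = deriv h z.1 - z.2 := by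
  simp only [ff', LinearMap.det_toContinuousLinearMap, LinearMap.det_toLin, Matrix.det_fin_two_of]
  linear_combination (deriv h z.1 - z.2) * sin_sq_add_cos_sq z.1

lemma ff_hasFDerivAt (h : ℝ → ℝ) (z : ℝ × ℝ) (hd : DifferentiableAt ℝ h z.1) :
    HasFDerivAt (ff h) (ff' h z) z := by
  have hh1 : HasFDerivAt (fun z : ℝ × ℝ => h z.1) (deriv h z.1 • ContinuousLinearMap.fst ℝ ℝ ℝ) z :=
    hd.hasDerivAt.comp_hasFDerivAt z hasFDerivAt_fst
  have hc : HasFDerivAt (fun z : ℝ × ℝ => cos z.1) ((-sin z.1) • ContinuousLinearMap.fst ℝ ℝ ℝ) z :=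
    (hasDerivAt_cos z.1).comp_hasFDerivAt z hasFDerivAt_fst
  have hs : HasFDerivAt (fun z : ℝ × ℝ => sin z.1) ((cos z.1) • ContinuousLinearMap.fst ℝ ℝ ℝ) z :=
    (hasDerivAt_sin z.1).comp_hasFDerivAt z hasFDerivAt_fst
  have h2 : HasFDerivAt (fun z : ℝ × ℝ => z.2) (ContinuousLinearMap.snd ℝ ℝ ℝ) z := hasFDerivAt_snd
  have := ((hh1.mul hc).sub (h2.mul hs)).prodMk ((hh1.mul hs).add (h2.mul hc))
  unfold ff'
  rw [Matrix.toLin_finTwoProd_toContinuousLinearMap]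
  refine this.congr_fderiv ?_
  ext <;> simp <;> ring
end

section
variable {K : Set (ℝ × ℝ)}

def DD (R : ℝ) : Set (ℝ × ℝ) := {x | x.1 ^ 2 + x.2 ^ 2 < R ^ 2}

def EE (h : ℝ → ℝ) (R : ℝ) : Set (ℝ × ℝ) :=
  {z | z.1 ∈ Set.Ioc 0 (2 * π) ∧ DifferentiableAt ℝ h z.1 ∧ deriv h z.1 < z.2 ∧
    h z.1 ^ 2 + z.2 ^ 2 < R ^ 2}

def EE' (h : ℝ → ℝ) (R : ℝ) : Set (ℝ × ℝ) :=
  {z | z.1 ∈ Set.Ioc 0 (2 * π) ∧ DifferentiableAt ℝ h z.1 ∧ deriv h z.1 ≤ z.2 ∧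
    h z.1 ^ 2 + z.2 ^ 2 < R ^ 2}

lemma EE_meas {h : ℝ → ℝ} (hc : Continuous h) (R : ℝ) : MeasurableSet (EE h R) := by
  refine (measurable_fst measurableSet_Ioc).inter
    ((measurable_fst (measurableSet_of_differentiableAt ℝ h)).inter (MeasurableSet.inter ?_ ?_))
  · exact measurableSet_lt ((measurable_deriv h).comp measurable_fst) measurable_snd
  · exact measurableSet_lt (f := fun z : ℝ × ℝ => h z.1 ^ 2 + z.2 ^ 2) (by fun_prop) measurable_const

lemma EE'_meas {h : ℝ → ℝ} (hc : Continuous h) (R : ℝ) : MeasurableSet (EE' h R) := by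
  refine (measurable_fst measurableSet_Ioc).inter
    ((measurable_fst (measurableSet_of_differentiableAt ℝ h)).inter (MeasurableSet.inter ?_ ?_))
  · exact measurableSet_le ((measurable_deriv h).comp measurable_fst) measurable_snd
  · exact measurableSet_lt (f := fun z : ℝ × ℝ => h z.1 ^ 2 + z.2 ^ 2) (by fun_prop) measurable_const

lemma EE_int (h : ℝ → ℝ) (hc : Continuous h) (R : ℝ) :
    ∫⁻ z in EE' h R, ENNReal.ofReal |(ff' h z).det| = ∫⁻ z in EE h R, ENNReal.ofReal |(ff' h z).det| := by
  rw [← lintegral_indicator (EE_meas hc R), ← lintegral_indicator (EE'_meas hc R)]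
  congr 1
  ext z
  by_cases h1 : z ∈ EE h R
  · have h2 : z ∈ EE' h R := ⟨h1.1, h1.2.1, h1.2.2.1.le, h1.2.2.2⟩
    simp [h1, h2]
  · by_cases h2 : z ∈ EE' h R
    · have : deriv h z.1 = z.2 := by
        by_contra hne
        exact h1 ⟨h2.1, h2.2.1, lt_of_le_of_ne h2.2.2.1 hne, h2.2.2.2⟩
      simp [h1, ff'_det, this]
    · simp [h1, h2]

lemma slice_int (a b : ℝ) (hab : a ≤ b) :
    ∫⁻ s in Set.Ico a b, ENNReal.ofReal |a - s| = ENNReal.ofReal (1 / 2 * (b - a) ^ 2) := by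
  rw [setLIntegral_congr Ico_ae_eq_Ioc]
  rw [← ofReal_integral_eq_lintegral_ofReal]
  · congr 1
    rw [← intervalIntegral.integral_of_le hab]
    have : ∫ s in a..b, |a - s| = ∫ s in a..b, (s - a) := by
      apply intervalIntegral.integral_congr
      intro s hs
      rw [Set.uIcc_of_le hab] at hs
      simp only
      rw [abs_sub_comm, abs_of_nonneg]; linarith [hs.1]
    rw [this, intervalIntegral.integral_sub (Continuous.intervalIntegrable (by fun_prop) _ _) (Continuous.intervalIntegrable (by fun_prop) _ _)]
    simp only [integral_id, intervalIntegral.integral_const, smul_eq_mul]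
    ring
  · exact (Continuous.integrableOn_Ioc (by fun_prop))
  · exact Filter.Eventually.of_forall (fun _ => abs_nonneg _)

lemma EE_slice {h : ℝ → ℝ} {C : NNReal} (hL : LipschitzWith C h) (R : ℝ)
    (hR : ∀ φ, DifferentiableAt ℝ h φ → h φ ^ 2 + deriv h φ ^ 2 < R ^ 2) :
    ∫⁻ z in EE' h R, ENNReal.ofReal |(ff' h z).det| =
    ∫⁻ φ in Set.Ioc 0 (2 * π), ENNReal.ofReal (1 / 2 * (√(R ^ 2 - h φ ^ 2) - deriv h φ) ^ 2) := by
  rw [← lintegral_indicator (EE'_meas hL.continuous R), Measure.volume_eq_prod, lintegral_prod,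
    ← lintegral_indicator measurableSet_Ioc]
  · apply lintegral_congr_ae
    filter_upwards [hL.ae_differentiableAt_real] with φ hφ
    by_cases hI : φ ∈ Set.Ioc 0 (2 * π)
    · rw [Set.indicator_of_mem hI]
      have hR' := hR φ hφ
      have hle : |deriv h φ| ≤ √(R ^ 2 - h φ ^ 2) := by
        apply Real.abs_le_sqrt; linarith
      rw [← slice_int _ _ ((le_abs_self _).trans hle), ← lintegral_indicator measurableSet_Ico]
      congr 1
      ext s
      have : (φ, s) ∈ EE' h R ↔ s ∈ Set.Ico (deriv h φ) (√(R ^ 2 - h φ ^ 2)) := by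
        simp only [EE', Set.mem_ofPred_eq, hI, hφ, true_and, Set.mem_Ico]
        apply and_congr_right
        intro h1
        have h3 := (abs_le.1 hle).1
        constructor
        · intro h2
          exact Real.lt_sqrt_of_sq_lt (by linarith)
        · intro h2
          have : |s| < √(R ^ 2 - h φ ^ 2) := by
            rcases abs_cases s with h' | h'
            · linarith
            · rcases h1.eq_or_lt with h5 | h5
              · have : deriv h φ ≠ - √(R ^ 2 - h φ ^ 2) := by
                  intro h6
                  rw [h6, neg_sq, Real.sq_sqrt (by nlinarith [sq_nonneg (deriv h φ)])] at hR'
                  linarith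
                have := lt_of_le_of_ne h3 this.symm
                linarith
              · linarith
          rw [Real.lt_sqrt (abs_nonneg _), sq_abs] at this
          linarith
      by_cases hs : s ∈ Set.Ico (deriv h φ) (√(R ^ 2 - h φ ^ 2))
      · rw [Set.indicator_of_mem hs, Set.indicator_of_mem (this.2 hs), ff'_det]
      · rw [Set.indicator_of_notMem hs, Set.indicator_of_notMem (fun h => hs (this.1 h))]
    · rw [Set.indicator_of_notMem hI]
      rw [lintegral_eq_zero_iff']
      · apply Filter.Eventually.of_forall
        intro s
        apply Set.indicator_of_notMem
        exact fun h => hI h.1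
      · have : (fun y => (EE' h R).indicator (fun z => ENNReal.ofReal |(ff' h z).det|) (φ, y)) = fun _ => 0 := by
          ext s
          apply Set.indicator_of_notMem
          exact fun h => hI h.1
        rw [this]; exact aemeasurable_const
  · apply AEMeasurable.indicator _ (EE'_meas hL.continuous R)
    simp only [ff'_det]
    have := measurable_deriv h
    fun_prop

lemma ff_null {h : ℝ → ℝ} {C : NNReal} (hL : LipschitzWith C h) (R : ℝ) :
    volume (ff h '' ({φ | φ ∈ Set.Icc 0 (2 * π) ∧ ¬ DifferentiableAt ℝ h φ} ×ˢ Set.Icc (-R) R)) = 0 := by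
  let G : ℝ × ℝ → ℝ × (ℝ × ℝ) := fun z => (h z.1, z)
  let F : ℝ × (ℝ × ℝ) → ℝ × ℝ := fun w => (w.1 * cos w.2.1 - w.2.2 * sin w.2.1, w.1 * sin w.2.1 + w.2.2 * cos w.2.1)
  have hG : LipschitzWith (max (C * 1) 1) G := (hL.comp LipschitzWith.prod_fst).prodMk LipschitzWith.id
  have hF : ContDiff ℝ 1 F := by fun_prop
  have hcomp : IsCompact (G '' (Set.Icc 0 (2 * π) ×ˢ Set.Icc (-R) R)) :=
    (isCompact_Icc.prod isCompact_Icc).image hG.continuous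
  obtain ⟨C', hC'⟩ := (hF.locallyLipschitz.locallyLipschitzOn (s := G '' (Set.Icc 0 (2 * π) ×ˢ Set.Icc (-R) R))).exists_lipschitzOnWith_of_compact hcomp
  have h1 : LipschitzOnWith (C' * max (C * 1) 1) (ff h) (Set.Icc 0 (2 * π) ×ˢ Set.Icc (-R) R) := by
    exact hC'.comp hG.lipschitzOnWith (Set.mapsTo_image _ _)
  have h2 := h1.mono (s := {φ | φ ∈ Set.Icc 0 (2 * π) ∧ ¬ DifferentiableAt ℝ h φ} ×ˢ Set.Icc (-R) R) (by
    rintro z ⟨a, b⟩; exact ⟨a.1, b⟩)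
  have h3 := h2.hausdorffMeasure_image_le (d := 2) (by norm_num)
  rw [hausdorffMeasure_prod_real] at h3
  have h4 : volume ({φ | φ ∈ Set.Icc 0 (2 * π) ∧ ¬ DifferentiableAt ℝ h φ} ×ˢ Set.Icc (-R) R) = 0 := by
    rw [Measure.volume_eq_prod, Measure.prod_prod]
    have : volume {φ | φ ∈ Set.Icc 0 (2 * π) ∧ ¬ DifferentiableAt ℝ h φ} = 0 := by
      apply measure_mono_null _ (ae_iff.1 hL.ae_differentiableAt_real)
      intro x hx; exact hx.2
    rw [this, zero_mul]
  rw [h4, mul_zero] at h3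
  exact le_antisymm h3 (zero_le)

lemma neg_deriv_right {g : ℝ → ℝ} {g' φ : ℝ} (h : HasDerivAt g g' φ) (hg : g φ = 0) (hg' : g' < 0) :
    ∀ ε > 0, ∃ t, φ < t ∧ t < φ + ε ∧ g t < 0 := by
  intro ε hε
  have h1 : ∀ᶠ t in nhdsWithin φ (Set.Ioi φ), slope g φ t < 0 :=
    ((hasDerivWithinAt_iff_tendsto_slope' (by simp)).1 h.hasDerivWithinAt).eventually (gt_mem_nhds hg')
  have h2 : ∀ᶠ t in nhdsWithin φ (Set.Ioi φ), t ∈ Set.Ioo φ (φ + ε) := Ioo_mem_nhdsGT (by linarith)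
  obtain ⟨t, ht1, ht2⟩ := (h1.and h2).exists
  refine ⟨t, ht2.1, ht2.2, ?_⟩
  rw [slope_def_field, hg, sub_zero, div_neg_iff] at ht1
  rcases ht1 with h | h
  · linarith [ht2.1]
  · exact h.1

lemma neg_deriv_left {g : ℝ → ℝ} {g' φ : ℝ} (h : HasDerivAt g g' φ) (hg : g φ = 0) (hg' : g' < 0) :
    ∀ ε > 0, ∃ t, φ - ε < t ∧ t < φ ∧ 0 < g t := by
  intro ε hε
  have h1 : ∀ᶠ t in nhdsWithin φ (Set.Iio φ), slope g φ t < 0 :=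
    ((hasDerivWithinAt_iff_tendsto_slope' (by simp)).1 h.hasDerivWithinAt).eventually (gt_mem_nhds hg')
  have h2 : ∀ᶠ t in nhdsWithin φ (Set.Iio φ), t ∈ Set.Ioo (φ - ε) φ := Ioo_mem_nhdsLT (by linarith)
  obtain ⟨t, ht1, ht2⟩ := (h1.and h2).exists
  refine ⟨t, ht2.1, ht2.2, ?_⟩
  rw [slope_def_field, hg, sub_zero, div_neg_iff] at ht1
  rcases ht1 with h | h
  · exact h.1
  · linarith [ht2.2]

/-- uniqueness of the tangent, short arc -/
lemma uniq_short (hK : IsCompact K) (hne : K.Nonempty) (y : ℝ × ℝ) {a b : ℝ} (hab : a < b)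
    (hba : b ≤ a + π)
    (ha : hh K a = pp y a) (hb : hh K b = pp y b) (da : DifferentiableAt ℝ (hh K) a)
    (db : DifferentiableAt ℝ (hh K) b) (ha' : deriv (hh K) a < qq y a)
    (hb' : deriv (hh K) b < qq y b) : False := by
  have Da : HasDerivAt (fun t => hh K t - pp y t) (deriv (hh K) a - qq y a) a :=
    da.hasDerivAt.sub (pp_hasDeriv y a)
  have Db : HasDerivAt (fun t => hh K t - pp y t) (deriv (hh K) b - qq y b) b :=
    db.hasDerivAt.sub (pp_hasDeriv y b)
  rcases hba.eq_or_lt with h | h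
  · -- antipodal
    have Db2 : HasDerivAt (fun t => hh K (t + π) - pp y (t + π)) (deriv (hh K) b - qq y b) a := by
      rw [h] at Db ⊢
      exact Db.comp_add_const a π
    have Ds := Da.add Db2
    obtain ⟨t, _, _, ht⟩ := neg_deriv_right Ds (by
      simp only [Pi.add_apply]; rw [← h, ha, hb]; ring) (by linarith) 1 one_pos
    simp only [Pi.add_apply, pp_add_pi] at ht
    have := hh_add_pi hK hne t
    linarith
  · obtain ⟨t, h1, h2, ht⟩ := neg_deriv_left Db (by simp [hb]) (by linarith) (b - a) (by linarith)
    have h3 := hh_sin3 hK hne (a := a) (b := t) (c := b) (by linarith) h2.le hba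
    rw [ha, hb, ← pp_sin3] at h3
    have h4 : 0 < sin (b - a) := sin_pos_of_pos_of_lt_pi (by linarith) (by linarith)
    have := le_of_mul_le_mul_right h3 h4
    linarith

lemma deriv_periodic {h : ℝ → ℝ} {c : ℝ} (hp : Function.Periodic h c) : Function.Periodic (deriv h) c := by
  intro x
  have : (fun t => h (t + c)) = h := funext hp
  rw [← deriv_comp_add_const, this]

lemma diff_periodic {h : ℝ → ℝ} {c : ℝ} (hp : Function.Periodic h c) (x : ℝ) (hd : DifferentiableAt ℝ h x) :
    DifferentiableAt ℝ h (x + c) := by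
  have : h = (fun t => h (t - c)) := by
    ext t; rw [hp.sub_eq]
  rw [this]
  have h2 : DifferentiableAt ℝ h (x + c - c) := by simpa using hd
  exact h2.comp (x + c) (by fun_prop)

lemma uniq_lt (hK : IsCompact K) (hne : K.Nonempty) (y : ℝ × ℝ) {a b : ℝ} (hab : a < b)
    (hba : b < a + 2 * π)
    (ha : hh K a = pp y a) (hb : hh K b = pp y b) (da : DifferentiableAt ℝ (hh K) a)
    (db : DifferentiableAt ℝ (hh K) b) (ha' : deriv (hh K) a < qq y a)
    (hb' : deriv (hh K) b < qq y b) : False := by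
  rcases le_total b (a + π) with h | h
  · exact uniq_short hK hne y hab h ha hb da db ha' hb'
  · refine uniq_short hK hne y hba (by linarith) hb ?_ db (diff_periodic (hh_periodic K) a da) hb' ?_
    · rw [hh_periodic, pp_periodic, ha]
    · rw [deriv_periodic (hh_periodic K), qq_periodic]; exact ha'

lemma ff_inj (hK : IsCompact K) (hne : K.Nonempty) (R : ℝ) : Set.InjOn (ff (hh K)) (EE (hh K) R) := by
  intro z hz w hw hzw
  have z1 := pp_ff (hh K) z
  have z2 := qq_ff (hh K) z
  have w1 := pp_ff (hh K) w
  have w2 := qq_ff (hh K) w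
  rw [← hzw] at w1 w2
  have hz3 := hz.2.2.1
  have hw3 := hw.2.2.1
  rw [← z2] at hz3
  rw [← w2] at hw3
  rcases lt_trichotomy z.1 w.1 with h | h | h
  · exact (uniq_lt hK hne (ff (hh K) z) h (by linarith [hz.1.1, hw.1.2]) z1.symm w1.symm hz.2.1 hw.2.1 hz3 hw3).elim
  · ext
    · exact h
    · rw [← z2, ← w2, h]
  · exact (uniq_lt hK hne (ff (hh K) z) h (by linarith [hw.1.1, hz.1.2]) w1.symm z1.symm hw.2.1 hz.2.1 hw3 hz3).elim

lemma ff_sub (hK : IsCompact K) (R : ℝ) : ff (hh K) '' (EE (hh K) R) ⊆ DD R \ K := by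
  rintro _ ⟨z, hz, rfl⟩
  have z1 := pp_ff (hh K) z
  have z2 := qq_ff (hh K) z
  refine ⟨?_, ?_⟩
  · simp only [DD, Set.mem_ofPred_eq]
    rw [← pp_sq_add_qq_sq _ z.1, z1, z2]; exact hz.2.2.2
  · intro hm
    have Da : HasDerivAt (fun t => hh K t - pp (ff (hh K) z) t) (deriv (hh K) z.1 - qq (ff (hh K) z) z.1) z.1 :=
      hz.2.1.hasDerivAt.sub (pp_hasDeriv _ _)
    obtain ⟨t, _, _, h⟩ := neg_deriv_right Da (by simp [z1]) (by rw [z2]; linarith [hz.2.2.1]) 1 one_pos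
    linarith [le_hh hK hm t]

lemma ff_cover (hK : IsCompact K) (hc : Convex ℝ K) (hne : K.Nonempty) (R : ℝ) (hR : 0 < R) :
    DD R \ K ⊆ ff (hh K) '' (EE' (hh K) R) ∪
      ff (hh K) '' ({φ | φ ∈ Set.Icc 0 (2 * π) ∧ ¬ DifferentiableAt ℝ (hh K) φ} ×ˢ Set.Icc (-R) R) := by
  rintro y ⟨hyR, hyK⟩
  obtain ⟨φ₀, h0⟩ := hh_sep hK hc hne hyK
  have hgc : Continuous (fun t => hh K t - pp y t) := by
    have := hh_cont hK hne
    unfold pp; fun_prop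
  let S : Set ℝ := Set.Icc (φ₀ - π) φ₀ ∩ {t | 0 ≤ hh K t - pp y t}
  have hSc : IsCompact S := isCompact_Icc.inter_right (isClosed_le continuous_const hgc)
  have hSne : S.Nonempty := by
    refine ⟨φ₀ - π, ⟨le_rfl, by linarith [pi_pos]⟩, ?_⟩
    have h1 := hh_add_pi hK hne (φ₀ - π)
    have h2 := pp_add_pi y (φ₀ - π)
    rw [sub_add_cancel] at h1 h2
    simp only [Set.mem_ofPred_eq]; linarith
  have hmem := hSc.sSup_mem hSne
  set φ₁ := sSup S with hφ₁
  have hlt : φ₁ < φ₀ := by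
    rcases hmem.1.2.eq_or_lt with h | h
    · have := hmem.2; rw [h] at this; simp only [Set.mem_ofPred_eq] at this; linarith
    · exact h
  have hneg : ∀ t, φ₁ < t → t ≤ φ₀ → hh K t - pp y t < 0 := by
    intro t h1 h2
    by_contra h3
    push Not at h3
    have : t ∈ S := ⟨⟨by linarith [hmem.1.1], h2⟩, h3⟩
    linarith [le_csSup hSc.bddAbove this]
  have hz : hh K φ₁ - pp y φ₁ = 0 := by
    apply le_antisymm _ hmem.2
    have h1 : Filter.Tendsto (fun t => hh K t - pp y t) (nhdsWithin φ₁ (Set.Ioi φ₁)) (nhds (hh K φ₁ - pp y φ₁)) :=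
      hgc.continuousAt.tendsto.mono_left nhdsWithin_le_nhds
    refine le_of_tendsto h1 ?_
    filter_upwards [Ioo_mem_nhdsGT hlt] with t ht
    exact (hneg t ht.1 ht.2.le).le
  have hder : DifferentiableAt ℝ (hh K) φ₁ → deriv (hh K) φ₁ ≤ qq y φ₁ := by
    intro hd
    have D : HasDerivAt (fun t => hh K t - pp y t) (deriv (hh K) φ₁ - qq y φ₁) φ₁ :=
      hd.hasDerivAt.sub (pp_hasDeriv _ _)
    by_contra hcon
    obtain ⟨t, h1, h2, h3⟩ := neg_deriv_right D.neg (by simp [hz]) (by linarith) (φ₀ - φ₁) (by linarith)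
    have := hneg t h1 (by linarith)
    simp only [Pi.neg_apply] at h3
    linarith
  -- normalise the angle
  obtain ⟨n, hn⟩ : ∃ n : ℤ, φ₁ - n * (2 * π) ∈ Set.Ioc 0 (2 * π) := by
    have := existsUnique_sub_zsmul_mem_Ioc (two_pi_pos) φ₁ 0
    obtain ⟨n, hn, _⟩ := this
    exact ⟨n, by simpa using hn⟩
  set ψ := φ₁ - n * (2 * π) with hψ
  have e1 : hh K ψ = hh K φ₁ := (hh_periodic K).sub_int_mul_eq n
  have e2 : pp y ψ = pp y φ₁ := (pp_periodic y).sub_int_mul_eq n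
  have e3 : qq y ψ = qq y φ₁ := (qq_periodic y).sub_int_mul_eq n
  have e4 : deriv (hh K) ψ = deriv (hh K) φ₁ := (deriv_periodic (hh_periodic K)).sub_int_mul_eq n
  have e5 : DifferentiableAt ℝ (hh K) ψ → DifferentiableAt ℝ (hh K) φ₁ := by
    intro h
    have := diff_periodic ((hh_periodic K).int_mul n) ψ h
    simpa [hψ] using this
  have hf : ff (hh K) (ψ, qq y ψ) = y := ff_eq _ _ _ (by rw [e1, e2]; linarith)
  have hn2 : hh K ψ ^ 2 + qq y ψ ^ 2 < R ^ 2 := by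
    have : hh K ψ = pp y ψ := by rw [e1, e2]; linarith
    rw [this, pp_sq_add_qq_sq]; exact hyR
  have hd4 : DifferentiableAt ℝ (hh K) ψ → deriv (hh K) ψ ≤ qq y ψ := by
    intro hd; rw [e4, e3]; exact hder (e5 hd)
  clear_value ψ
  by_cases hd : DifferentiableAt ℝ (hh K) ψ
  · left
    have : (ψ, qq y ψ) ∈ EE' (hh K) R := ⟨hn, hd, hd4 hd, hn2⟩
    exact ⟨_, this, hf⟩
  · right
    have h1 : qq y ψ ∈ Set.Icc (-R) R := by
      rw [Set.mem_Icc, ← abs_le]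
      apply abs_le_of_sq_le_sq _ hR.le
      nlinarith [sq_nonneg (hh K ψ)]
    have h2 : ψ ∈ {φ | φ ∈ Set.Icc 0 (2 * π) ∧ ¬ DifferentiableAt ℝ (hh K) φ} := ⟨⟨hn.1.le, hn.2⟩, hd⟩
    exact ⟨(ψ, qq y ψ), ⟨h2, h1⟩, hf⟩

lemma norm_bound (hK : IsCompact K) (hne : K.Nonempty) {R : ℝ} (hR : K ⊆ DD R) (φ : ℝ)
    (hd : DifferentiableAt ℝ (hh K) φ) : hh K φ ^ 2 + deriv (hh K) φ ^ 2 < R ^ 2 := by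
  obtain ⟨x, hx, h⟩ := hh_ex hK hne φ
  rw [hh_deriv hK hd hx h, ← h, pp_sq_add_qq_sq]
  exact hR hx

theorem area_compl (hK : IsCompact K) (hc : Convex ℝ K) (hne : K.Nonempty) {R : ℝ} (hR0 : 0 < R)
    (hR : K ⊆ DD R) :
    volume (DD R \ K) = ∫⁻ φ in Set.Ioc 0 (2 * π),
      ENNReal.ofReal (1 / 2 * (√(R ^ 2 - hh K φ ^ 2) - deriv (hh K) φ) ^ 2) := by
  obtain ⟨C, hL⟩ := hh_lip hK hne
  rw [← EE_slice hL R (norm_bound hK hne hR)]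
  apply le_antisymm
  · calc volume (DD R \ K) ≤ volume (ff (hh K) '' (EE' (hh K) R)) + 0 := by
          rw [← ff_null hL R]
          exact (measure_mono (ff_cover hK hc hne R hR0)).trans (measure_union_le _ _)
      _ ≤ _ := by
          rw [add_zero]
          exact addHaar_image_le_lintegral_abs_det_fderiv volume (EE'_meas hL.continuous R)
            (fun z hz => (ff_hasFDerivAt _ z hz.2.1).hasFDerivWithinAt)
  · rw [EE_int _ hL.continuous, lintegral_abs_det_fderiv_eq_addHaar_image volume (EE_meas hL.continuous R)
      (fun z hz => (ff_hasFDerivAt _ z hz.2.1).hasFDerivWithinAt) (ff_inj hK hne R)]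
    exact measure_mono (ff_sub hK R)
end

section
variable {K : Set (ℝ × ℝ)}

/-- one period -/
noncomputable def μp : Measure ℝ := volume.restrict (Set.Ioc 0 (2 * π))

instance : IsFiniteMeasure μp := by unfold μp; infer_instance

lemma int_bdd {α : Type*} [MeasurableSpace α] {μ : Measure α} [IsFiniteMeasure μ] {a : α → ℝ}
    (ha : Measurable a) {A : ℝ} (hA : ∀ x, |a x| ≤ A) : Integrable a μ :=
  Integrable.of_bound ha.aestronglyMeasurable A (Filter.Eventually.of_forall hA)

lemma μp_int (f : ℝ → ℝ) : ∫ x, f x ∂μp = ∫ x in (0 : ℝ)..(2 * π), f x := by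
  rw [intervalIntegral.integral_of_le two_pi_pos.le, μp]

lemma per_shift {b : ℝ → ℝ} (hb : Function.Periodic b (2 * π)) (c : ℝ) :
    ∫ x, b (c - x) ∂μp = ∫ x, b x ∂μp := by
  rw [μp_int, μp_int, intervalIntegral.integral_comp_sub_left (fun x => b x) c]
  have := hb.intervalIntegral_add_eq (c - 2 * π) 0
  simpa using this

lemma per_shift' {b : ℝ → ℝ} (hb : Function.Periodic b (2 * π)) (c : ℝ) :
    ∫ x, b (x + c) ∂μp = ∫ x, b x ∂μp := by
  rw [μp_int, μp_int, intervalIntegral.integral_comp_add_right (fun x => b x) c]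
  have := hb.intervalIntegral_add_eq c 0
  simpa [add_comm] using this

lemma conv_int {a b : ℝ → ℝ} (ha : Measurable a) (hb : Measurable b) {A B : ℝ}
    (hA : ∀ x, |a x| ≤ A) (hB : ∀ x, |b x| ≤ B) (hp : Function.Periodic b (2 * π)) :
    Integrable (fun θ => ∫ φ, a φ * b (φ - θ + π) ∂μp) μp ∧
    ∫ θ, ∫ φ, a φ * b (φ - θ + π) ∂μp ∂μp = (∫ φ, a φ ∂μp) * ∫ φ, b φ ∂μp := by
  have hA0 : 0 ≤ A := (abs_nonneg _).trans (hA 0)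
  have hi : Integrable (fun z : ℝ × ℝ => a z.2 * b (z.2 - z.1 + π)) (μp.prod μp) := by
    apply int_bdd (A := A * B) (by fun_prop)
    intro z; rw [abs_mul]
    exact mul_le_mul (hA _) (hB _) (abs_nonneg _) hA0
  refine ⟨hi.integral_prod_left, ?_⟩
  rw [integral_integral_swap hi]
  simp only [integral_const_mul]
  have : ∀ φ, ∫ θ, b (φ - θ + π) ∂μp = ∫ φ, b φ ∂μp := by
    intro φ
    rw [← per_shift hp (φ + π)]
    congr 1; ext θ; congr 1; ring
  simp only [this, integral_mul_const]

lemma deriv_int {h : ℝ → ℝ} {C : NNReal} (hL : LipschitzWith C h) (hp : Function.Periodic h (2 * π)) :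
    ∫ φ, deriv h φ ∂μp = 0 := by
  rw [μp_int, hL.lipschitzOnWith.absolutelyContinuousOnInterval.integral_deriv_eq_sub]
  have := hp 0
  simp only [zero_add] at this
  linarith

lemma deriv_bdd {h : ℝ → ℝ} {C : NNReal} (hL : LipschitzWith C h) (x : ℝ) : |deriv h x| ≤ C :=
  norm_deriv_le_of_lipschitz hL

lemma deriv_sqrt_int {h : ℝ → ℝ} {C : NNReal} (hL : LipschitzWith C h) (hp : Function.Periodic h (2 * π))
    (R : ℝ) : ∫ φ, deriv h φ * √(R ^ 2 - h φ ^ 2) ∂μp = 0 := by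
  let G : ℝ → ℝ := fun t => ∫ s in (0 : ℝ)..t, √(R ^ 2 - s ^ 2)
  have hcont : Continuous (fun s : ℝ => √(R ^ 2 - s ^ 2)) := by fun_prop
  have hG : ∀ t, HasDerivAt G (√(R ^ 2 - t ^ 2)) t := fun t =>
    intervalIntegral.integral_hasDerivAt_right (hcont.intervalIntegrable _ _)
      (hcont.stronglyMeasurableAtFilter _ _) hcont.continuousAt
  have hGL : LipschitzWith (Real.toNNReal |R|) G := by
    apply lipschitzWith_of_nnnorm_deriv_le (fun t => (hG t).differentiableAt)
    intro t
    rw [(hG t).deriv]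
    rw [← NNReal.coe_le_coe, coe_nnnorm, Real.coe_toNNReal _ (abs_nonneg _), Real.norm_eq_abs,
      abs_of_nonneg (Real.sqrt_nonneg _)]
    apply Real.sqrt_le_iff.2 ⟨abs_nonneg _, ?_⟩
    rw [sq_abs]; nlinarith [sq_nonneg t]
  have h1 := deriv_int (hGL.comp hL) (hp.comp G)
  rw [← h1]
  apply integral_congr_ae
  apply ae_restrict_of_ae
  filter_upwards [hL.ae_differentiableAt_real] with φ hφ
  have := (hG (h φ)).comp φ hφ.hasDerivAt
  rw [this.deriv]; ring

lemma hh_bound (hK : IsCompact K) (hne : K.Nonempty) {R : ℝ} (hR0 : 0 < R) (hR : K ⊆ DD R) (φ : ℝ) :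
    |hh K φ| ≤ R := by
  obtain ⟨x, hx, h⟩ := hh_ex hK hne φ
  rw [← h]
  apply abs_le_of_sq_le_sq _ hR0.le
  have := pp_sq_add_qq_sq x φ
  have h2 : x.1 ^ 2 + x.2 ^ 2 < R ^ 2 := hR hx
  nlinarith [sq_nonneg (qq x φ)]

lemma exists_R (hK : IsCompact K) : ∃ R, 0 < R ∧ K ⊆ DD R := by
  have hb : BddAbove ((fun x : ℝ × ℝ => x.1 ^ 2 + x.2 ^ 2) '' K) :=
    (hK.image (by fun_prop)).bddAbove
  obtain ⟨C, hC⟩ := hb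
  refine ⟨|C| + 1, by positivity, ?_⟩
  intro x hx
  have h3 : x.1 ^ 2 + x.2 ^ 2 ≤ C := hC ⟨x, hx, rfl⟩
  simp only [DD, Set.mem_ofPred_eq]
  nlinarith [abs_nonneg C, le_abs_self C]

lemma exists_bd (hK : IsCompact K) (hne : K.Nonempty) : ∃ A, ∀ φ, |hh K φ| ≤ A := by
  obtain ⟨R, h0, h1⟩ := exists_R hK
  exact ⟨R, hh_bound hK hne h0 h1⟩

lemma area_compl_real (hK : IsCompact K) (hc : Convex ℝ K) (hne : K.Nonempty) {R : ℝ} (hR0 : 0 < R)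
    (hR : K ⊆ DD R) :
    volume (DD R \ K) = ENNReal.ofReal (π * R ^ 2 - 1 / 2 * ∫ φ, (hh K φ ^ 2 - deriv (hh K) φ ^ 2) ∂μp) := by
  obtain ⟨C, hL⟩ := hh_lip hK hne
  have hcont := hL.continuous
  have hm := measurable_deriv (hh K)
  have hb := hh_bound hK hne hR0 hR
  have hb' := deriv_bdd hL
  have hs : ∀ φ, |√(R ^ 2 - hh K φ ^ 2)| ≤ R := by
    intro φ
    rw [abs_of_nonneg (Real.sqrt_nonneg _)]
    apply Real.sqrt_le_iff.2 ⟨hR0.le, ?_⟩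
    nlinarith [sq_nonneg (hh K φ)]
  rw [area_compl hK hc hne hR0 hR, ← ofReal_integral_eq_lintegral_ofReal]
  rotate_left
  · apply int_bdd (A := 1 / 2 * (R + C) ^ 2) (by fun_prop)
    intro φ
    rw [abs_mul, abs_of_nonneg (by norm_num : (0 : ℝ) ≤ 1 / 2), abs_pow]
    gcongr
    exact (abs_sub _ _).trans (add_le_add (hs φ) (hb' φ))
  · exact Filter.Eventually.of_forall (fun φ => by positivity)
  congr 1
  have i1 : Integrable (fun φ => hh K φ ^ 2 - deriv (hh K) φ ^ 2) μp := by
    apply int_bdd (A := R ^ 2 + C ^ 2) (by fun_prop)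
    intro φ
    refine (abs_sub _ _).trans ?_
    rw [abs_pow, abs_pow]
    have := hb φ
    have := hb' φ
    gcongr
  have i2 : Integrable (fun φ => deriv (hh K) φ * √(R ^ 2 - hh K φ ^ 2)) μp := by
    apply int_bdd (A := C * R) (by fun_prop)
    intro φ
    rw [abs_mul]
    exact mul_le_mul (hb' φ) (hs φ) (abs_nonneg _) C.2
  have e : ∀ φ, 1 / 2 * (√(R ^ 2 - hh K φ ^ 2) - deriv (hh K) φ) ^ 2 =
      (R ^ 2 / 2 - 1 / 2 * (hh K φ ^ 2 - deriv (hh K) φ ^ 2)) - deriv (hh K) φ * √(R ^ 2 - hh K φ ^ 2) := by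
    intro φ
    have : √(R ^ 2 - hh K φ ^ 2) ^ 2 = R ^ 2 - hh K φ ^ 2 := by
      apply Real.sq_sqrt
      have := sq_le_sq' (abs_le.1 (hb φ)).1 (abs_le.1 (hb φ)).2
      linarith
    linear_combination (1 / 2) * this
  change ∫ φ, 1 / 2 * (√(R ^ 2 - hh K φ ^ 2) - deriv (hh K) φ) ^ 2 ∂μp = _
  simp only [e]
  have i3 : Integrable (fun _ : ℝ => R ^ 2 / 2) μp := integrable_const _
  have i4 : Integrable (fun φ => 1 / 2 * (hh K φ ^ 2 - deriv (hh K) φ ^ 2)) μp := i1.const_mul _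
  rw [integral_sub (by exact i3.sub i4) i2, integral_sub i3 i4, deriv_sqrt_int hL (hh_periodic K),
    integral_const_mul]
  have : ∫ _ : ℝ, R ^ 2 / 2 ∂μp = π * R ^ 2 := by
    rw [μp_int]; simp; ring
  rw [this]; ring

lemma disc_area {R : ℝ} (hR0 : 0 < R) : volume (DD R) = ENNReal.ofReal (π * R ^ 2) := by
  have h := area_compl_real (K := {0}) isCompact_singleton (convex_singleton 0) (Set.singleton_nonempty 0) hR0
    (by simp [DD]; positivity)
  rw [measure_sdiff_null (by simp)] at h
  rw [h]
  have : hh {(0 : ℝ × ℝ)} = fun _ => 0 := by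
    ext φ; simp [hh, pp]
  rw [this]; simp

theorem area_formula (hK : IsCompact K) (hc : Convex ℝ K) (hne : K.Nonempty) :
    (volume K).toReal = 1 / 2 * ∫ φ, (hh K φ ^ 2 - deriv (hh K) φ ^ 2) ∂μp := by
  obtain ⟨R, hR0, hR⟩ := exists_R hK
  have h1 := area_compl_real hK hc hne hR0 hR
  have h2 := disc_area hR0
  have h3 : volume (DD R \ K) ≠ ⊤ := by rw [h1]; exact ENNReal.ofReal_ne_top
  have h4 : volume (DD R \ K) + volume K = volume (DD R) := by
    rw [← measure_inter_add_sdiff (DD R) hK.measurableSet, Set.inter_eq_self_of_subset_right hR, add_comm]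
  have h5 := congrArg ENNReal.toReal h4
  rw [ENNReal.toReal_add h3 hK.measure_lt_top.ne, h2, ENNReal.toReal_ofReal (by positivity)] at h5
  rw [h1] at h5
  -- nonnegativity of the integral
  have hnn : 0 ≤ π * R ^ 2 - 1 / 2 * ∫ φ, (hh K φ ^ 2 - deriv (hh K) φ ^ 2) ∂μp := by
    by_contra hcon
    push Not at hcon
    obtain ⟨C, hL⟩ := hh_lip hK hne
    have : ∫ φ, (hh K φ ^ 2 - deriv (hh K) φ ^ 2) ∂μp ≤ ∫ φ, R ^ 2 ∂μp := by
      apply integral_mono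
      · have := hL.continuous
        have := measurable_deriv (hh K)
        apply int_bdd (A := R ^ 2 + C ^ 2) (by fun_prop)
        intro φ
        refine (abs_sub _ _).trans ?_
        rw [abs_pow, abs_pow]
        have := hh_bound hK hne hR0 hR φ
        have := deriv_bdd hL φ
        gcongr
      · exact integrable_const _
      · intro φ
        have := sq_le_sq' (abs_le.1 (hh_bound hK hne hR0 hR φ)).1 (abs_le.1 (hh_bound hK hne hR0 hR φ)).2
        simp only
        nlinarith [sq_nonneg (deriv (hh K) φ)]
    have h6 : ∫ _ : ℝ, R ^ 2 ∂μp = 2 * π * R ^ 2 := by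
      rw [μp_int]; simp
    rw [h6] at this
    linarith
  rw [ENNReal.toReal_ofReal hnn] at h5
  linarith

/-- the averaged Brunn-Minkowski area -/
theorem avg_area {L : Set (ℝ × ℝ)} (hK : IsCompact K) (hKc : Convex ℝ K) (hKn : K.Nonempty)
    (hL : IsCompact L) (hLc : Convex ℝ L) (hLn : L.Nonempty)
    (M : ℝ → Set (ℝ × ℝ)) (hM : ∀ θ, IsCompact (M θ)) (hMc : ∀ θ, Convex ℝ (M θ))
    (hMh : ∀ θ φ, hh (M θ) φ = hh K φ + hh L (φ - θ + π)) (hMn : ∀ θ, (M θ).Nonempty) :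
    Integrable (fun θ => (volume (M θ)).toReal) μp ∧
    ∫ θ, (volume (M θ)).toReal ∂μp = 2 * π * (volume K).toReal + 2 * π * (volume L).toReal +
      (∫ φ, hh K φ ∂μp) * ∫ φ, hh L φ ∂μp := by
  obtain ⟨A, hA⟩ := exists_bd hK hKn
  obtain ⟨B, hB⟩ := exists_bd hL hLn
  obtain ⟨C, lK⟩ := hh_lip hK hKn
  obtain ⟨D, lL⟩ := hh_lip hL hLn
  have mK := lK.continuous.measurable
  have mL := lL.continuous.measurable
  have dK := measurable_deriv (hh K)
  have dL := measurable_deriv (hh L)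
  have bK := deriv_bdd lK
  have bL := deriv_bdd lL
  have pL := deriv_periodic (hh_periodic L)
  obtain ⟨I1, J1⟩ := conv_int mK mL hA hB (hh_periodic L)
  obtain ⟨I2, J2⟩ := conv_int dK dL bK bL pL
  rw [deriv_int lK (hh_periodic K), zero_mul] at J2
  have hA0 : 0 ≤ A := (abs_nonneg _).trans (hA 0)
  have key : ∀ θ, (volume (M θ)).toReal = (volume K).toReal + (volume L).toReal +
      (∫ φ, hh K φ * hh L (φ - θ + π) ∂μp - ∫ φ, deriv (hh K) φ * deriv (hh L) (φ - θ + π) ∂μp) := by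
    intro θ
    rw [area_formula (hM θ) (hMc θ) (hMn θ), area_formula hK hKc hKn, area_formula hL hLc hLn]
    have eL : ∫ φ, (hh L φ ^ 2 - deriv (hh L) φ ^ 2) ∂μp =
        ∫ φ, (hh L (φ - θ + π) ^ 2 - deriv (hh L) (φ - θ + π) ^ 2) ∂μp := by
      rw [← per_shift' (b := fun φ => hh L φ ^ 2 - deriv (hh L) φ ^ 2) _ (- θ + π)]
      · congr 1; ext φ; simp only [sub_eq_add_neg, add_assoc]
      · intro φ; simp only [hh_periodic L φ, pL φ]
    have eM : ∫ φ, (hh (M θ) φ ^ 2 - deriv (hh (M θ)) φ ^ 2) ∂μp =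
        ∫ φ, ((hh K φ ^ 2 - deriv (hh K) φ ^ 2) +
          (hh L (φ - θ + π) ^ 2 - deriv (hh L) (φ - θ + π) ^ 2) +
          2 * (hh K φ * hh L (φ - θ + π) - deriv (hh K) φ * deriv (hh L) (φ - θ + π))) ∂μp := by
      apply integral_congr_ae
      apply ae_restrict_of_ae
      have l2 : LipschitzWith D (fun φ => hh L (φ - θ + π)) := by
        have : LipschitzWith 1 (fun φ : ℝ => φ - θ + π) := by
          apply LipschitzWith.of_dist_le_mul
          intro x y; simp [Real.dist_eq]
        have := lL.comp this
        rw [mul_one] at this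
        exact this
      filter_upwards [lK.ae_differentiableAt_real, l2.ae_differentiableAt_real] with φ h1 h2
      have e1 : hh (M θ) = fun φ => hh K φ + hh L (φ - θ + π) := funext (hMh θ)
      have e2 : deriv (fun φ => hh L (φ - θ + π)) φ = deriv (hh L) (φ - θ + π) := by
        have : (fun φ => hh L (φ - θ + π)) = fun φ => hh L (φ + (- θ + π)) := by
          ext φ; congr 1; ring
        rw [this, deriv_comp_add_const]
        congr 1; ring
      rw [e1, deriv_fun_add h1 h2, e2]
      ring
    have i1 : Integrable (fun φ => hh K φ ^ 2 - deriv (hh K) φ ^ 2) μp := by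
      apply int_bdd (A := A ^ 2 + C ^ 2) (by fun_prop)
      intro φ
      refine (abs_sub _ _).trans ?_
      rw [abs_pow, abs_pow]
      have := hA φ
      have := bK φ
      gcongr
    have i2 : Integrable (fun φ => hh L (φ - θ + π) ^ 2 - deriv (hh L) (φ - θ + π) ^ 2) μp := by
      apply int_bdd (A := B ^ 2 + D ^ 2) (by fun_prop)
      intro φ
      refine (abs_sub _ _).trans ?_
      rw [abs_pow, abs_pow]
      have := hB (φ - θ + π)
      have := bL (φ - θ + π)
      gcongr
    have i3 : Integrable (fun φ => hh K φ * hh L (φ - θ + π)) μp := by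
      apply int_bdd (A := A * B) (by fun_prop)
      intro φ; rw [abs_mul]
      exact mul_le_mul (hA _) (hB _) (abs_nonneg _) hA0
    have i4 : Integrable (fun φ => deriv (hh K) φ * deriv (hh L) (φ - θ + π)) μp := by
      apply int_bdd (A := C * D) (by fun_prop)
      intro φ; rw [abs_mul]
      exact mul_le_mul (bK _) (bL _) (abs_nonneg _) C.2
    have i34 : Integrable (fun φ => hh K φ * hh L (φ - θ + π) - deriv (hh K) φ * deriv (hh L) (φ - θ + π)) μp :=
      i3.sub i4
    rw [eM, eL, integral_add (by exact i1.add i2) (i34.const_mul 2), integral_add i1 i2, integral_const_mul,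
      integral_sub i3 i4]
    ring
  simp only [key]
  have i0 : Integrable (fun _ : ℝ => (volume K).toReal + (volume L).toReal) μp := integrable_const _
  refine ⟨i0.add (I1.sub I2), ?_⟩
  rw [integral_add i0 (by exact I1.sub I2), integral_sub I1 I2, J1, J2]
  rw [μp_int]
  simp
  try ring
end

section
lemma evar_neg (f : ℝ → ℝ) (s : Set ℝ) : eVariationOn (fun x => - f x) s = eVariationOn f s := by
  unfold eVariationOn; simp only [edist_neg_neg]

lemma evar_mono {f : ℝ → ℝ} {a b : ℝ} (hab : a ≤ b) (hf : MonotoneOn f (Set.Icc a b)) :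
    eVariationOn f (Set.Icc a b) = ENNReal.ofReal (f b - f a) := by
  have := hf.eVariationOn_eq (a := a) (b := b) ⟨le_rfl, hab⟩ ⟨hab, le_rfl⟩
  rwa [Set.inter_self] at this

lemma evar_anti {f : ℝ → ℝ} {a b : ℝ} (hab : a ≤ b) (hf : AntitoneOn f (Set.Icc a b)) :
    eVariationOn f (Set.Icc a b) = ENNReal.ofReal (f a - f b) := by
  rw [← evar_neg, evar_mono hab hf.neg]
  congr 1; ring

lemma evar_add (f : ℝ → ℝ) {a b c : ℝ} (hab : a ≤ b) (hbc : b ≤ c) :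
    eVariationOn f (Set.Icc a c) = eVariationOn f (Set.Icc a b) + eVariationOn f (Set.Icc b c) := by
  have := eVariationOn.Icc_add_Icc f (s := Set.univ) hab hbc (Set.mem_univ _)
  simpa using this.symm

lemma evar_shift {f : ℝ → ℝ} {T : ℝ} (hp : Function.Periodic f T) (a b : ℝ) :
    eVariationOn f (Set.Icc (a + T) (b + T)) = eVariationOn f (Set.Icc a b) := by
  have h1 := eVariationOn.comp_eq_of_monotoneOn f (t := Set.Icc a b) (fun x => x + T)
    (fun x _ y _ h => by simpa using h)
  have h2 : f ∘ (fun x => x + T) = f := funext hp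
  rw [h2, Set.image_add_const_Icc] at h1
  exact h1.symm

lemma evar_period {f : ℝ → ℝ} {T : ℝ} (hp : Function.Periodic f T) {a c : ℝ} (hac : a ≤ c) (hca : c ≤ a + T) :
    eVariationOn f (Set.Icc a (a + T)) = eVariationOn f (Set.Icc c (c + T)) := by
  rw [evar_add f hac hca, evar_add f hca (show a + T ≤ c + T by linarith), evar_shift hp a c, add_comm]

/-- abstract polar description of a convex curve -/
structure Polar (g H : ℝ → ℝ) : Prop where
  pos : ∀ θ, 0 < g θ
  cont : Continuous g
  per : Function.Periodic g (2 * π)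
  perH : Function.Periodic H (2 * π)
  contH : Continuous H
  sin3 : ∀ a b c, a ≤ b → b ≤ c → c ≤ a + π →
    g b * sin (c - a) ≤ sin (c - b) * g a + sin (b - a) * g c
  le : ∀ φ θ, cos (θ - φ) / g θ ≤ H φ
  ex : ∀ φ, ∃ θ, H φ = cos (θ - φ) / g θ

variable {g H : ℝ → ℝ}

lemma sin_cos3 (a b c φ : ℝ) :
    cos (b - φ) * sin (c - a) = sin (c - b) * cos (a - φ) + sin (b - a) * cos (c - φ) := by
  simp only [sin_sub, cos_sub]; ring

lemma quasi (P : Polar g H) {φ a b c m : ℝ} (hm : 0 ≤ m) (hab : a ≤ b) (hbc : b ≤ c)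
    (ha : φ - π / 2 ≤ a) (hc : c ≤ φ + π / 2) (h1 : m ≤ cos (a - φ) / g a)
    (h2 : m ≤ cos (c - φ) / g c) : m ≤ cos (b - φ) / g b := by
  rw [le_div_iff₀ (P.pos _)] at h1 h2 ⊢
  have hb0 : 0 ≤ cos (b - φ) := cos_nonneg_of_mem_Icc ⟨by linarith, by linarith⟩
  rcases eq_or_lt_of_le (hab.trans hbc) with hac | hac
  · have : b = a := by linarith
    rw [this]; exact h1
  rcases eq_or_lt_of_le (show c ≤ a + π by linarith) with hp | hp
  · have ha' : a - φ = -(π / 2) := by linarith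
    rw [ha', cos_neg, cos_pi_div_two] at h1
    have : m = 0 := by
      rcases hm.eq_or_lt with h | h
      · exact h.symm
      · nlinarith [mul_pos h (P.pos a)]
    rw [this, zero_mul]; exact hb0
  · have hs : 0 < sin (c - a) := sin_pos_of_pos_of_lt_pi (by linarith) (by linarith)
    have s1 : 0 ≤ sin (c - b) := sin_nonneg_of_nonneg_of_le_pi (by linarith) (by linarith)
    have s2 : 0 ≤ sin (b - a) := sin_nonneg_of_nonneg_of_le_pi (by linarith) (by linarith)
    have h3 := P.sin3 a b c hab hbc (by linarith)
    have h4 := sin_cos3 a b c φ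
    apply le_of_mul_le_mul_right _ hs
    rw [h4]
    have h5 := mul_le_mul_of_nonneg_left h3 hm
    have h6 := mul_le_mul_of_nonneg_left h1 s1
    have h7 := mul_le_mul_of_nonneg_left h2 s2
    nlinarith

lemma F_cont (P : Polar g H) (φ : ℝ) : Continuous (fun θ => cos (θ - φ) / g θ) := by
  have := P.cont
  exact Continuous.div (by fun_prop) this (fun θ => (P.pos θ).ne')

lemma F_per (P : Polar g H) (φ : ℝ) : Function.Periodic (fun θ => cos (θ - φ) / g θ) (2 * π) := by
  intro θ
  simp only [P.per θ]
  rw [show θ + 2 * π - φ = θ - φ + 2 * π by ring, cos_add_two_pi]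

lemma evar_half (P : Polar g H) (φ : ℝ) :
    eVariationOn (fun θ => cos (θ - φ) / g θ) (Set.Icc (φ - π / 2) (φ + π / 2)) ≤ ENNReal.ofReal (2 * H φ) := by
  have hpi := pi_pos
  obtain ⟨t, ht, hmax⟩ := isCompact_Icc.exists_isMaxOn (s := Set.Icc (φ - π / 2) (φ + π / 2))
    ⟨φ, by constructor <;> linarith⟩ (F_cont P φ).continuousOn
  have hmax' : ∀ x ∈ Set.Icc (φ - π / 2) (φ + π / 2), cos (x - φ) / g x ≤ cos (t - φ) / g t := hmax
  have hnn : ∀ x ∈ Set.Icc (φ - π / 2) (φ + π / 2), 0 ≤ cos (x - φ) / g x := fun x hx =>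
    div_nonneg (cos_nonneg_of_mem_Icc ⟨by linarith [hx.1], by linarith [hx.2]⟩) (P.pos x).le
  have m1 : MonotoneOn (fun θ => cos (θ - φ) / g θ) (Set.Icc (φ - π / 2) t) := by
    intro x hx y hy hxy
    have hxI : x ∈ Set.Icc (φ - π / 2) (φ + π / 2) := ⟨hx.1, hx.2.trans ht.2⟩
    exact quasi P (hnn x hxI) hxy hy.2 hx.1 ht.2 le_rfl (hmax' x hxI)
  have m2 : AntitoneOn (fun θ => cos (θ - φ) / g θ) (Set.Icc t (φ + π / 2)) := by
    intro x hx y hy hxy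
    have hyI : y ∈ Set.Icc (φ - π / 2) (φ + π / 2) := ⟨ht.1.trans hy.1, hy.2⟩
    exact quasi P (hnn y hyI) hx.1 hxy ht.1 hy.2 (hmax' y hyI) le_rfl
  rw [evar_add _ ht.1 ht.2, evar_mono ht.1 m1, evar_anti ht.2 m2]
  have e1 : φ - π / 2 - φ = -(π / 2) := by ring
  have e2 : φ + π / 2 - φ = (π / 2) := by ring
  have := hnn t ht
  simp only [e1, e2, cos_neg, cos_pi_div_two, zero_div, sub_zero]
  rw [← ENNReal.ofReal_add this this]
  apply ENNReal.ofReal_le_ofReal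
  linarith [P.le φ t]

lemma H_pos (P : Polar g H) (φ : ℝ) : 0 < H φ := by
  refine lt_of_lt_of_le ?_ (P.le φ φ)
  simpa using P.pos φ

lemma evar_full' (P : Polar g H) (φ : ℝ) :
    eVariationOn (fun θ => cos (θ - φ) / g θ) (Set.Icc (φ - π / 2) (φ - π / 2 + 2 * π)) ≤
      ENNReal.ofReal (2 * (H φ + H (φ + π))) := by
  have hpi := pi_pos
  rw [evar_add _ (b := φ + π / 2) (by linarith) (by linarith)]
  have h1 := evar_half P φ
  have h2 := evar_half P (φ + π)
  rw [← evar_neg, show φ + π - π / 2 = φ + π / 2 by ring, show φ + π + π / 2 = φ - π / 2 + 2 * π by ring] at h2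
  have : (fun x => - (cos (x - (φ + π)) / g x)) = fun x => cos (x - φ) / g x := by
    ext x
    rw [show x - (φ + π) = x - φ - π by ring, cos_sub_pi]; ring
  rw [this] at h2
  rw [mul_add, ENNReal.ofReal_add (by linarith [H_pos P φ]) (by linarith [H_pos P (φ + π)])]
  exact add_le_add h1 h2

lemma evar_full (P : Polar g H) (φ : ℝ) :
    eVariationOn (fun θ => cos (θ - φ) / g θ) (Set.Icc 0 (2 * π)) ≤
      ENNReal.ofReal (2 * (H φ + H (φ + π))) := by
  obtain ⟨n, hn⟩ : ∃ n : ℤ, (φ - π / 2) - n * (2 * π) ∈ Set.Ioc 0 (2 * π) := by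
    obtain ⟨n, hn, _⟩ := existsUnique_sub_zsmul_mem_Ioc (two_pi_pos) (φ - π / 2) 0
    exact ⟨n, by simpa using hn⟩
  have h := evar_full' P (φ - n * (2 * π))
  have e1 : (fun θ => cos (θ - (φ - n * (2 * π))) / g θ) = fun θ => cos (θ - φ) / g θ := by
    ext θ
    rw [show θ - (φ - n * (2 * π)) = θ - φ + n * (2 * π) by ring, cos_add_int_mul_two_pi]
  have e2 : H (φ - n * (2 * π)) = H φ := P.perH.sub_int_mul_eq n
  have e3 : H (φ - n * (2 * π) + π) = H (φ + π) := by
    rw [show φ - n * (2 * π) + π = φ + π - n * (2 * π) by ring, P.perH.sub_int_mul_eq n]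
  rw [e1, e2, e3] at h
  rw [show φ - n * (2 * π) - π / 2 = φ - π / 2 - n * (2 * π) by ring] at h
  have := evar_period (F_per P φ) (a := 0) hn.1.le (by simpa using hn.2)
  rw [zero_add] at this
  rw [this]; exact h

/-- integral of the absolute projection -/
lemma abs_cos_int : ∫ φ, |cos φ| ∂μp = 4 := by
  have hp : Function.Periodic (fun φ => |cos φ|) (2 * π) := by
    intro φ; simp
  have h1 := hp.intervalIntegral_add_eq 0 (-(π / 2))
  rw [μp_int]
  rw [zero_add] at h1
  rw [h1]
  have hi : ∀ a b : ℝ, IntervalIntegrable (fun φ => |cos φ|) volume a b := fun a b =>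
    Continuous.intervalIntegrable (by fun_prop) _ _
  have hpi := pi_pos
  rw [← intervalIntegral.integral_add_adjacent_intervals (b := π / 2) (hi _ _) (hi _ _)]
  have e1 : ∫ x in (-(π / 2))..(π / 2), |cos x| = ∫ x in (-(π / 2))..(π / 2), cos x := by
    apply intervalIntegral.integral_congr
    intro x hx
    rw [Set.uIcc_of_le (by linarith)] at hx
    exact abs_of_nonneg (cos_nonneg_of_mem_Icc hx)
  have e2 : ∫ x in (π / 2)..(-(π / 2) + 2 * π), |cos x| = ∫ x in (π / 2)..(-(π / 2) + 2 * π), - cos x := by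
    apply intervalIntegral.integral_congr
    intro x hx
    rw [Set.uIcc_of_le (by linarith)] at hx
    exact abs_of_nonpos (cos_nonpos_of_pi_div_two_le_of_le hx.1 (by linarith [hx.2]))
  rw [e1, e2, intervalIntegral.integral_neg, integral_cos, integral_cos, sin_add_two_pi, sin_neg, sin_pi_div_two]
  norm_num

lemma abs_pp_int (v : ℝ × ℝ) : ∫ φ, |pp v φ| ∂μp = 4 * √(v.1 ^ 2 + v.2 ^ 2) := by
  set z : ℂ := ⟨v.1, v.2⟩ with hz
  have e1 : v.1 = ‖z‖ * cos z.arg := (Complex.norm_mul_cos_arg z).symm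
  have e2 : v.2 = ‖z‖ * sin z.arg := (Complex.norm_mul_sin_arg z).symm
  have e3 : √(v.1 ^ 2 + v.2 ^ 2) = ‖z‖ := by
    rw [Complex.norm_eq_sqrt_sq_add_sq]
  have e4 : ∀ φ, |pp v φ| = ‖z‖ * |cos (φ + (-z.arg))| := by
    intro φ
    rw [pp, e1, e2, cos_add, cos_neg, sin_neg, ← abs_of_nonneg (norm_nonneg z), ← abs_mul]
    rw [abs_of_nonneg (norm_nonneg z)]
    congr 1; ring
  simp only [e4, integral_const_mul]
  rw [per_shift' (b := fun φ => |cos φ|), abs_cos_int, e3, mul_comm]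
  intro φ; simp
end

section
/-- coordinates -/
def ee (x : EuclideanSpace ℝ (Fin 2)) : ℝ × ℝ := (x 0, x 1)

noncomputable def uu (θ : ℝ) : EuclideanSpace ℝ (Fin 2) := !₂[cos θ, sin θ]

lemma pp_ee_uu (θ φ r : ℝ) : pp (ee (r • uu θ)) φ = r * cos (θ - φ) := by
  simp [pp, ee, uu, cos_sub]; ring

lemma uu_sin3 (a b c : ℝ) : sin (c - a) • uu b = sin (c - b) • uu a + sin (b - a) • uu c := by
  ext i; fin_cases i <;> simp [uu, sin_sub] <;> ring

lemma uu_cont : Continuous uu := by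
  unfold uu
  fun_prop

lemma uu_per : Function.Periodic uu (2 * π) := by intro θ; simp [uu]

lemma polar_ex (x : EuclideanSpace ℝ (Fin 2)) : ∃ (r θ : ℝ), 0 ≤ r ∧ x = r • uu θ := by
  set z : ℂ := ⟨x 0, x 1⟩ with hz
  have e1 : x 0 = ‖z‖ * cos z.arg := (Complex.norm_mul_cos_arg z).symm
  have e2 : x 1 = ‖z‖ * sin z.arg := (Complex.norm_mul_sin_arg z).symm
  refine ⟨‖z‖, z.arg, norm_nonneg _, ?_⟩
  ext i; fin_cases i
  · simpa [uu] using e1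
  · simpa [uu] using e2

lemma uu_ne (θ : ℝ) : uu θ ≠ 0 := by
  intro h
  have h0 : cos θ = 0 := by simpa [uu] using congrArg (fun x => x 0) h
  have h1 : sin θ = 0 := by simpa [uu] using congrArg (fun x => x 1) h
  have := sin_sq_add_cos_sq θ
  rw [h0, h1] at this; norm_num at this

lemma uu_norm (θ : ℝ) : ‖uu θ‖ = 1 := by
  rw [EuclideanSpace.norm_eq]; simp [uu]

lemma uu_inj : Set.InjOn uu (Set.Ico 0 (2 * π)) := by
  intro a ha b hb h
  have h0 : cos a = cos b := by simpa [uu] using congrArg (fun x => x 0) h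
  have h1 : sin a = sin b := by simpa [uu] using congrArg (fun x => x 1) h
  obtain ⟨n, hn⟩ := Real.Angle.angle_eq_iff_two_pi_dvd_sub.1 (Real.Angle.cos_sin_inj h0 h1)
  have hpi := two_pi_pos
  have h2 : (n : ℝ) < 1 := by nlinarith [ha.1, ha.2, hb.1, hb.2]
  have h3 : (-1 : ℝ) < n := by nlinarith [ha.1, ha.2, hb.1, hb.2]
  have h4 : n < 1 := by exact_mod_cast h2
  have h5 : -1 < n := by exact_mod_cast h3
  have : n = 0 := by omega
  rw [this] at hn; simp at hn; linarith

lemma ee_cont : Continuous ee := by unfold ee; fun_prop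

lemma ee_sub (x y : EuclideanSpace ℝ (Fin 2)) : ee (x - y) = ee x - ee y := by simp [ee]
lemma ee_add (x y : EuclideanSpace ℝ (Fin 2)) : ee (x + y) = ee x + ee y := by simp [ee]

lemma dist_eq_int (x y : EuclideanSpace ℝ (Fin 2)) :
    dist x y = 1 / 4 * ∫ φ, |pp (ee x) φ - pp (ee y) φ| ∂μp := by
  have h := abs_pp_int (ee (x - y))
  have e : ∀ φ, pp (ee (x - y)) φ = pp (ee x) φ - pp (ee y) φ := by
    intro φ; simp [pp, ee]; ring
  simp only [e] at h
  rw [h, dist_eq_norm, EuclideanSpace.norm_eq]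
  simp [ee]

variable {K : Set (EuclideanSpace ℝ (Fin 2))}

noncomputable def gg (K : Set (EuclideanSpace ℝ (Fin 2))) (θ : ℝ) : ℝ := gauge K (uu θ)
noncomputable def γγ (K : Set (EuclideanSpace ℝ (Fin 2))) (θ : ℝ) : EuclideanSpace ℝ (Fin 2) :=
  (gg K θ)⁻¹ • uu θ

lemma pp_γ (θ φ : ℝ) : pp (ee (γγ K θ)) φ = cos (θ - φ) / gg K θ := by
  rw [γγ, pp_ee_uu]; ring

lemma gg_pos (hK : IsCompact K) (h0 : K ∈ nhds 0) (θ : ℝ) : 0 < gg K θ :=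
  (gauge_pos (absorbent_nhds_zero h0) (NormedSpace.isVonNBounded_of_isBounded ℝ hK.isBounded)).2 (uu_ne θ)

lemma γ_frontier (hK : IsCompact K) (hc : Convex ℝ K) (h0 : K ∈ nhds 0) (θ : ℝ) : γγ K θ ∈ frontier K := by
  rw [← gauge_eq_one_iff_mem_frontier hc h0, γγ, gauge_smul_of_nonneg (inv_nonneg.2 (gg_pos hK h0 θ).le)]
  exact inv_mul_cancel₀ (gg_pos hK h0 θ).ne'

lemma γ_mem (hK : IsCompact K) (hc : Convex ℝ K) (h0 : K ∈ nhds 0) (θ : ℝ) : γγ K θ ∈ K :=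
  hK.isClosed.frontier_subset (γ_frontier hK hc h0 θ)

lemma polarK (hK : IsCompact K) (hc : Convex ℝ K) (h0 : K ∈ nhds 0) : Polar (gg K) (hh (ee '' K)) := by
  have hK' : IsCompact (ee '' K) := hK.image ee_cont
  have hne' : (ee '' K).Nonempty := ⟨_, 0, mem_of_mem_nhds h0, rfl⟩
  have hle : ∀ φ θ, cos (θ - φ) / gg K θ ≤ hh (ee '' K) φ := by
    intro φ θ
    rw [← pp_γ]
    exact le_hh hK' ⟨_, γ_mem hK hc h0 θ, rfl⟩ φ
  refine ⟨gg_pos hK h0, (continuous_gauge hc h0).comp uu_cont, ?_, hh_periodic _, hh_cont hK' hne', ?_, hle, ?_⟩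
  · intro θ; simp only [gg, uu_per θ]
  · intro a b c hab hbc hac
    have h1 : 0 ≤ sin (c - b) := sin_nonneg_of_nonneg_of_le_pi (by linarith) (by linarith)
    have h2 : 0 ≤ sin (b - a) := sin_nonneg_of_nonneg_of_le_pi (by linarith) (by linarith)
    have h3 : 0 ≤ sin (c - a) := sin_nonneg_of_nonneg_of_le_pi (by linarith) (by linarith)
    have h := gauge_add_le hc (absorbent_nhds_zero h0) (sin (c - b) • uu a) (sin (b - a) • uu c)
    rw [← uu_sin3, gauge_smul_of_nonneg h1, gauge_smul_of_nonneg h2, gauge_smul_of_nonneg h3] at h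
    simp only [smul_eq_mul] at h
    rw [mul_comm]; exact h
  · intro φ
    obtain ⟨_, ⟨x, hx, rfl⟩, h⟩ := hh_ex hK' hne' φ
    obtain ⟨r, θ, hr, rfl⟩ := polar_ex x
    refine ⟨θ, le_antisymm ?_ (hle φ θ)⟩
    rw [← h, pp_ee_uu]
    have hHpos : 0 < hh (ee '' K) φ := by
      refine lt_of_lt_of_le ?_ (hle φ φ)
      simpa using gg_pos hK h0 φ
    rw [← h, pp_ee_uu] at hHpos
    have hcos : 0 < cos (θ - φ) := pos_of_mul_pos_right hHpos hr
    have h1 : gauge K (r • uu θ) ≤ 1 := gauge_le_one_of_mem hx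
    rw [gauge_smul_of_nonneg hr, smul_eq_mul] at h1
    rw [le_div_iff₀ (gg_pos hK h0 θ)]
    calc r * cos (θ - φ) * gg K θ = cos (θ - φ) * (r * gauge K (uu θ)) := by rw [gg]; ring
      _ ≤ cos (θ - φ) * 1 := by gcongr
      _ = _ := mul_one _

lemma γ_cont (hK : IsCompact K) (hc : Convex ℝ K) (h0 : K ∈ nhds 0) : Continuous (γγ K) :=
  ((polarK hK hc h0).cont.inv₀ (fun θ => (gg_pos hK h0 θ).ne')).smul uu_cont

lemma γ_per : Function.Periodic (γγ K) (2 * π) := by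
  intro θ; simp only [γγ, gg, uu_per θ]

lemma γ_inj (hK : IsCompact K) (h0 : K ∈ nhds 0) : Set.InjOn (γγ K) (Set.Ico 0 (2 * π)) := by
  intro a ha b hb h
  have h1 := congrArg norm h
  have pa := inv_pos.2 (gg_pos hK h0 a)
  have pb := inv_pos.2 (gg_pos hK h0 b)
  rw [γγ, γγ, norm_smul, norm_smul, uu_norm, uu_norm, mul_one, mul_one, Real.norm_of_nonneg pa.le,
    Real.norm_of_nonneg pb.le] at h1
  rw [γγ, γγ, h1] at h
  exact uu_inj ha hb (smul_right_injective _ pb.ne' h)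

lemma frontier_sub (hc : Convex ℝ K) (h0 : K ∈ nhds 0) :
    frontier K ⊆ γγ K '' Set.Icc 0 (2 * π) := by
  intro x hx
  rw [← gauge_eq_one_iff_mem_frontier hc h0] at hx
  obtain ⟨r, θ, hr, rfl⟩ := polar_ex x
  rw [gauge_smul_of_nonneg hr, smul_eq_mul] at hx
  obtain ⟨n, hn⟩ : ∃ n : ℤ, θ - n * (2 * π) ∈ Set.Ioc 0 (2 * π) := by
    obtain ⟨n, hn, _⟩ := existsUnique_sub_zsmul_mem_Ioc (two_pi_pos) θ 0
    exact ⟨n, by simpa using hn⟩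
  refine ⟨θ - n * (2 * π), ⟨hn.1.le, hn.2⟩, ?_⟩
  rw [γ_per.sub_int_mul_eq n, γγ]
  congr 1
  exact (eq_inv_of_mul_eq_one_left hx).symm

/-- partition points -/
noncomputable def tt (n i : ℕ) : ℝ := i * (2 * π / (n + 1))

lemma tt_mono (n : ℕ) : Monotone (tt n) := by
  intro i j h
  unfold tt
  have := two_pi_pos
  gcongr

lemma tt_zero (n : ℕ) : tt n 0 = 0 := by simp [tt]
lemma tt_last (n : ℕ) : tt n (n + 1) = 2 * π := by
  simp only [tt]; push_cast; field_simp

lemma tt_mem (n i : ℕ) (hi : i ≤ n + 1) : tt n i ∈ Set.Icc 0 (2 * π) :=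
  ⟨by rw [← tt_zero n]; exact tt_mono n (Nat.zero_le _), by rw [← tt_last n]; exact tt_mono n hi⟩

lemma tt_cover (n : ℕ) {x : ℝ} (hx : x ∈ Set.Icc 0 (2 * π)) :
    ∃ i : Fin (n + 1), x ∈ Set.Icc (tt n i) (tt n (i + 1)) := by
  have hpi := two_pi_pos
  have hd : 0 < 2 * π / ((n : ℝ) + 1) := by positivity
  rcases hx.2.eq_or_lt with h | h
  · refine ⟨⟨n, by omega⟩, ?_⟩
    constructor
    · rw [h]; exact (tt_mem n n (by omega)).2
    · simp only; rw [tt_last]; exact h.le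
  · have h1 : x / (2 * π / ((n : ℝ) + 1)) < n + 1 := by
      rw [div_lt_iff₀ hd]; field_simp; exact h
    have h0 : 0 ≤ x / (2 * π / ((n : ℝ) + 1)) := div_nonneg hx.1 hd.le
    refine ⟨⟨⌊x / (2 * π / ((n : ℝ) + 1))⌋₊, ?_⟩, ?_⟩
    · rw [Nat.floor_lt h0]; push_cast; exact h1
    · constructor
      · simp only [tt]
        rw [← le_div_iff₀ hd]; exact Nat.floor_le h0
      · simp only [tt]
        rw [← div_le_iff₀ hd]; push_cast; exact (Nat.lt_floor_add_one _).le

lemma H_int {H g : ℝ → ℝ} (P : Polar g H) :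
    ∫ φ, 2 * (H φ + H (φ + π)) ∂μp = 4 * ∫ φ, H φ ∂μp := by
  have hi : ∀ f : ℝ → ℝ, Continuous f → Integrable f μp := fun f hf => hf.integrableOn_Ioc
  have hc := P.contH
  rw [integral_const_mul, integral_add (hi _ hc) (hi _ (by fun_prop)), per_shift' P.perH]
  ring

lemma cont_int {f : ℝ → ℝ} (hf : Continuous f) : Integrable f μp := hf.integrableOn_Ioc

lemma pp_cont' (x : ℝ × ℝ) : Continuous (pp x) := by unfold pp; fun_prop

lemma sum_dist_le (hK : IsCompact K) (hc : Convex ℝ K) (h0 : K ∈ nhds 0) (n : ℕ) (a b : ℕ → ℝ)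
    (ha : ∀ i, a i ∈ Set.Icc (tt n i) (tt n (i + 1))) (hb : ∀ i, b i ∈ Set.Icc (tt n i) (tt n (i + 1))) :
    ∑ i ∈ Finset.range (n + 1), dist (γγ K (a i)) (γγ K (b i)) ≤ ∫ φ, hh (ee '' K) φ ∂μp := by
  have P := polarK hK hc h0
  simp only [dist_eq_int]
  rw [← Finset.mul_sum, ← integral_finsetSum]
  · have : ∫ φ, ∑ i ∈ Finset.range (n + 1), |pp (ee (γγ K (a i))) φ - pp (ee (γγ K (b i))) φ| ∂μp ≤
        ∫ φ, 2 * (hh (ee '' K) φ + hh (ee '' K) (φ + π)) ∂μp := by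
      have hcH := P.contH
      apply integral_mono
      · apply cont_int
        have := fun x => pp_cont' x
        fun_prop
      · apply cont_int; fun_prop
      · intro φ
        simp only
        have h1 := evar_full P φ
        rw [← tt_last n, ← tt_zero n, ← eVariationOn.sum' _ (tt_mono n)] at h1
        have h2 : ∑ i ∈ Finset.range (n + 1), ENNReal.ofReal |pp (ee (γγ K (a i))) φ - pp (ee (γγ K (b i))) φ|
            ≤ ENNReal.ofReal (2 * (hh (ee '' K) φ + hh (ee '' K) (φ + π))) := by
          refine le_trans (Finset.sum_le_sum fun i _ => ?_) h1
          rw [pp_γ, pp_γ, ← Real.dist_eq, ← edist_dist]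
          exact eVariationOn.edist_le (fun θ => cos (θ - φ) / gg K θ) (ha i) (hb i)
        rw [← ENNReal.ofReal_sum_of_nonneg (fun _ _ => abs_nonneg _)] at h2
        rwa [ENNReal.ofReal_le_ofReal_iff] at h2
        have := H_pos P φ
        have := H_pos P (φ + π)
        positivity
    rw [H_int P] at this
    linarith
  · intro i _
    apply cont_int
    have := fun x => pp_cont' x
    fun_prop

lemma γ_unif (hK : IsCompact K) (hc : Convex ℝ K) (h0 : K ∈ nhds 0) {ε : ℝ} (hε : 0 < ε) :
    ∃ N : ℕ, ∀ n ≥ N, ∀ i ≤ n, ∀ x ∈ Set.Icc (tt n i) (tt n (i + 1)), ∀ y ∈ Set.Icc (tt n i) (tt n (i + 1)),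
      dist (γγ K x) (γγ K y) ≤ ε := by
  have hu := isCompact_Icc.uniformContinuousOn_of_continuous (s := Set.Icc (0 : ℝ) (2 * π)) (γ_cont hK hc h0).continuousOn
  rw [Metric.uniformContinuousOn_iff] at hu
  obtain ⟨δ, hδ, h⟩ := hu ε hε
  obtain ⟨N, hN⟩ := exists_nat_gt (2 * π / δ)
  have hpi := two_pi_pos
  refine ⟨N, fun n hn i hi x hx y hy => (h x ?_ y ?_ ?_).le⟩
  · exact ⟨(tt_mem n i (by omega)).1.trans hx.1, hx.2.trans (tt_mem n (i + 1) (by omega)).2⟩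
  · exact ⟨(tt_mem n i (by omega)).1.trans hy.1, hy.2.trans (tt_mem n (i + 1) (by omega)).2⟩
  · have h1 := Real.dist_le_of_mem_Icc hx hy
    refine h1.trans_lt ?_
    have : tt n (i + 1) - tt n i = 2 * π / (n + 1) := by simp only [tt]; push_cast; ring
    rw [this, div_lt_iff₀ (by positivity)]
    rw [div_lt_iff₀ hδ] at hN
    have : (N : ℝ) ≤ n := by exact_mod_cast hn
    nlinarith

lemma arc_diam (hgc : Continuous (γγ K)) {s t : ℝ} (hst : s ≤ t) :
    ∃ a b, a ∈ Set.Icc s t ∧ b ∈ Set.Icc s t ∧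
      Metric.ediam (γγ K '' Set.Icc s t) ≤ ENNReal.ofReal (dist (γγ K a) (γγ K b)) := by
  have hne : (Set.Icc s t).Nonempty := Set.nonempty_Icc.2 hst
  obtain ⟨z, hz, hmax⟩ := (isCompact_Icc.prod isCompact_Icc).exists_isMaxOn (hne.prod hne)
    (f := fun z : ℝ × ℝ => dist (γγ K z.1) (γγ K z.2)) (by fun_prop)
  have hmax' : ∀ z' ∈ Set.Icc s t ×ˢ Set.Icc s t,
      dist (γγ K z'.1) (γγ K z'.2) ≤ dist (γγ K z.1) (γγ K z.2) := fun z' hz' => hmax hz'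
  refine ⟨z.1, z.2, hz.1, hz.2, ?_⟩
  apply Metric.ediam_le
  rintro _ ⟨x, hx, rfl⟩ _ ⟨y, hy, rfl⟩
  rw [edist_dist]
  exact ENNReal.ofReal_le_ofReal (hmax' (x, y) ⟨hx, hy⟩)

lemma perim_upper (hK : IsCompact K) (hc : Convex ℝ K) (h0 : K ∈ nhds 0) :
    μH[1] (frontier K) ≤ ENNReal.ofReal (∫ φ, hh (ee '' K) φ ∂μp) := by
  let A : ∀ n : ℕ, Fin (n + 1) → Set (EuclideanSpace ℝ (Fin 2)) := fun n i =>
    γγ K '' Set.Icc (tt n i) (tt n (i + 1))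
  have hgc := γ_cont hK hc h0
  have hdiam : ∀ n i : ℕ, ∃ a b, a ∈ Set.Icc (tt n i) (tt n (i + 1)) ∧ b ∈ Set.Icc (tt n i) (tt n (i + 1)) ∧
      Metric.ediam (γγ K '' Set.Icc (tt n i) (tt n (i + 1))) ≤ ENNReal.ofReal (dist (γγ K a) (γγ K b)) :=
    fun n i => arc_diam hgc (tt_mono n (Nat.le_succ i))
  have h := Measure.hausdorffMeasure_le_liminf_sum (l := Filter.atTop) 1 (frontier K) (fun n => ⨆ i, Metric.ediam (A n i)) ?_ A
    (Filter.Eventually.of_forall fun n i => le_iSup (fun i => Metric.ediam (A n i)) i) ?_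
  · refine h.trans ?_
    refine Filter.liminf_le_of_le (by isBoundedDefault) ?_
    intro b hb
    obtain ⟨n, hn⟩ := hb.exists
    refine hn.trans ?_
    choose a b ha hb hab using hdiam n
    have := sum_dist_le hK hc h0 n a b ha hb
    refine le_trans ?_ (ENNReal.ofReal_le_ofReal this)
    rw [ENNReal.ofReal_sum_of_nonneg (fun _ _ => dist_nonneg), ← Fin.sum_univ_eq_sum_range (fun i => ENNReal.ofReal (dist (γγ K (a i)) (γγ K (b i))))]
    apply Finset.sum_le_sum
    intro i _
    rw [ENNReal.rpow_one]
    exact hab i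
  · rw [ENNReal.tendsto_nhds_zero]
    intro ε hε
    obtain ⟨ε', h1, h2⟩ : ∃ ε' : ℝ, 0 < ε' ∧ ENNReal.ofReal ε' ≤ ε := by
      rcases eq_or_ne ε ⊤ with h | h
      · exact ⟨1, one_pos, by simp [h]⟩
      · exact ⟨ε.toReal, ENNReal.toReal_pos hε.ne' h, ENNReal.ofReal_toReal_le⟩
    obtain ⟨N, hN⟩ := γ_unif hK hc h0 h1
    filter_upwards [Filter.eventually_ge_atTop N] with n hn
    refine iSup_le fun i => le_trans ?_ h2
    apply Metric.ediam_le
    rintro _ ⟨x, hx, rfl⟩ _ ⟨y, hy, rfl⟩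
    rw [edist_dist]
    exact ENNReal.ofReal_le_ofReal (hN n hn i (by omega) x hx y hy)
  · refine Filter.Eventually.of_forall fun n x hx => ?_
    obtain ⟨θ, hθ, rfl⟩ := frontier_sub hc h0 hx
    obtain ⟨i, hi⟩ := tt_cover n hθ
    exact Set.mem_iUnion.2 ⟨i, θ, hi, rfl⟩

lemma arc_lower (hK : IsCompact K) (hc : Convex ℝ K) (h0 : K ∈ nhds 0) {a b : ℝ} (hab : a ≤ b) :
    ENNReal.ofReal (dist (γγ K b) (γγ K a)) ≤ μH[1] (γγ K '' Set.Ico a b) := by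
  have hgc := γ_cont hK hc h0
  have hL : LipschitzWith 1 (fun x => dist x (γγ K a)) := LipschitzWith.dist_left _
  have h1 := hL.hausdorffMeasure_image_le (d := 1) (by norm_num) (γγ K '' Set.Ico a b)
  rw [hausdorffMeasure_real] at h1
  simp only [ENNReal.coe_one, ENNReal.one_rpow, one_mul] at h1
  refine le_trans ?_ h1
  rw [Set.image_image]
  have h2 := intermediate_value_Ico hab (f := fun x => dist (γγ K x) (γγ K a)) (by fun_prop)
  refine le_trans ?_ (measure_mono h2)
  simp

lemma chords_le (hK : IsCompact K) (hc : Convex ℝ K) (h0 : K ∈ nhds 0) (n : ℕ) :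
    ENNReal.ofReal (∑ i ∈ Finset.range (n + 1), dist (γγ K (tt n (i + 1))) (γγ K (tt n i))) ≤ μH[1] (frontier K) := by
  have hgc := γ_cont hK hc h0
  have hinj := γ_inj hK h0
  rw [ENNReal.ofReal_sum_of_nonneg (fun _ _ => dist_nonneg)]
  have hsub : ∀ i ∈ Finset.range (n + 1), Set.Ico (tt n i) (tt n (i + 1)) ⊆ Set.Ico 0 (2 * π) := by
    intro i hi
    have hi' := Finset.mem_range.1 hi
    exact Set.Ico_subset_Ico (tt_mem n i (by omega)).1 (tt_mem n (i + 1) (by omega)).2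
  calc _ ≤ ∑ i ∈ Finset.range (n + 1), μH[1] (γγ K '' Set.Ico (tt n i) (tt n (i + 1))) :=
        Finset.sum_le_sum fun i _ => arc_lower hK hc h0 (tt_mono n (Nat.le_succ i))
    _ = μH[1] (⋃ i ∈ Finset.range (n + 1), γγ K '' Set.Ico (tt n i) (tt n (i + 1))) := by
        rw [measure_biUnion_finset]
        · intro i hi j hj hij
          have hd : Disjoint (Set.Ico (tt n i) (tt n (i + 1))) (Set.Ico (tt n j) (tt n (j + 1))) :=
            (tt_mono n).pairwise_disjoint_on_Ico_succ hij
          refine Set.disjoint_left.2 ?_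
          rintro _ ⟨x, hx, rfl⟩ ⟨y, hy, hxy⟩
          have := hinj (hsub j hj hy) (hsub i hi hx) hxy
          exact Set.disjoint_left.1 hd hx (this ▸ hy)
        · intro i hi
          exact measurableSet_Ico.image_of_continuousOn_injOn hgc.continuousOn (hinj.mono (hsub i hi))
    _ ≤ _ := by
        apply measure_mono
        intro x hx
        simp only [Set.mem_iUnion] at hx
        obtain ⟨i, _, θ, _, rfl⟩ := hx
        exact γ_frontier hK hc h0 θ

lemma cycle_sum (f : ℕ → ℝ) (n : ℕ) (hf : f n = f 0) {i j : ℕ} (hi : i ≤ n) (hj : j ≤ n) :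
    2 * (f i - f j) ≤ ∑ k ∈ Finset.range n, |f (k + 1) - f k| := by
  have key : ∀ i j : ℕ, i ≤ j → j ≤ n → 2 * |f i - f j| ≤ ∑ k ∈ Finset.range n, |f (k + 1) - f k| := by
    intro i j hij hj
    have e : ∀ k, |f (k + 1) - f k| = dist (f k) (f (k + 1)) := fun k => by
      rw [Real.dist_eq, abs_sub_comm]
    simp only [e]
    rw [Finset.range_eq_Ico, ← Finset.sum_Ico_consecutive _ (Nat.zero_le i) (hij.trans hj),
      ← Finset.sum_Ico_consecutive _ hij hj]
    have h1 := dist_le_Ico_sum_dist f (Nat.zero_le i)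
    have h2 := dist_le_Ico_sum_dist f hij
    have h3 := dist_le_Ico_sum_dist f hj
    rw [hf] at h3
    have h4 := dist_triangle (f i) (f 0) (f j)
    have h5 := dist_comm (f i) (f 0)
    have h6 := dist_comm (f 0) (f j)
    rw [← Real.dist_eq]
    linarith
  rcases le_total i j with h | h
  · have := key i j h hj
    linarith [le_abs_self (f i - f j)]
  · have := key j i h hi
    rw [abs_sub_comm] at this
    linarith [le_abs_self (f i - f j)]

lemma pp_le_dist (x y : EuclideanSpace ℝ (Fin 2)) (φ : ℝ) : pp (ee x) φ - pp (ee y) φ ≤ dist x y := by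
  have h1 := pp_sq_add_qq_sq (ee (x - y)) φ
  have h2 : dist x y = √((ee (x - y)).1 ^ 2 + (ee (x - y)).2 ^ 2) := by
    rw [dist_eq_norm, EuclideanSpace.norm_eq]; simp [ee]
  rw [h2, ← h1]
  have e : pp (ee (x - y)) φ = pp (ee x) φ - pp (ee y) φ := by
    simp [pp, ee]; ring
  rw [← e]
  apply Real.le_sqrt_of_sq_le
  nlinarith [sq_nonneg (qq (ee (x - y)) φ)]

lemma perim_lower (hK : IsCompact K) (hc : Convex ℝ K) (h0 : K ∈ nhds 0) :
    ENNReal.ofReal (∫ φ, hh (ee '' K) φ ∂μp) ≤ μH[1] (frontier K) := by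
  have P := polarK hK hc h0
  have key : ∀ ε : ℝ, 0 < ε → ENNReal.ofReal (∫ φ, hh (ee '' K) φ ∂μp - 2 * π * ε) ≤ μH[1] (frontier K) := by
    intro ε hε
    obtain ⟨n, hn⟩ := γ_unif hK hc h0 hε
    have hn := hn n le_rfl
    refine le_trans (ENNReal.ofReal_le_ofReal ?_) (chords_le hK hc h0 n)
    simp only [dist_eq_int]
    rw [← Finset.mul_sum, ← integral_finsetSum]
    rotate_left
    · intro i _
      apply cont_int
      have := fun x => pp_cont' x
      fun_prop
    have hcH := P.contH
    have hmax : ∀ φ, ∃ i ≤ n + 1, hh (ee '' K) φ - ε ≤ pp (ee (γγ K (tt n i))) φ := by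
      intro φ
      obtain ⟨θ, hθ⟩ := P.ex φ
      obtain ⟨m, hm⟩ : ∃ m : ℤ, θ - m * (2 * π) ∈ Set.Ioc 0 (2 * π) := by
        obtain ⟨n, hn, _⟩ := existsUnique_sub_zsmul_mem_Ioc (two_pi_pos) θ 0
        exact ⟨n, by simpa using hn⟩
      obtain ⟨i, hi⟩ := tt_cover n ⟨hm.1.le, hm.2⟩
      refine ⟨i, by omega, ?_⟩
      have h1 := hn i (by omega) _ hi (tt n i) ⟨le_rfl, tt_mono n (Nat.le_succ _)⟩
      rw [γ_per.sub_int_mul_eq m] at h1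
      have h2 := pp_le_dist (γγ K θ) (γγ K (tt n i)) φ
      rw [pp_γ θ, ← hθ] at h2
      linarith
    have : ∫ φ, (2 * (hh (ee '' K) φ + hh (ee '' K) (φ + π)) - 4 * ε) ∂μp ≤
        ∫ φ, ∑ i ∈ Finset.range (n + 1), |pp (ee (γγ K (tt n (i + 1)))) φ - pp (ee (γγ K (tt n i))) φ| ∂μp := by
      apply integral_mono
      · apply cont_int; fun_prop
      · apply cont_int
        have := fun x => pp_cont' x
        fun_prop
      · intro φ
        simp only
        obtain ⟨i, hi, hi'⟩ := hmax φ
        obtain ⟨j, hj, hj'⟩ := hmax (φ + π)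
        rw [pp_add_pi] at hj'
        have := cycle_sum (fun i => pp (ee (γγ K (tt n i))) φ) (n + 1) (by
          simp only [tt_last, tt_zero]
          rw [← zero_add (2 * π), γ_per 0]) hi hj
        linarith
    rw [integral_sub (cont_int (by fun_prop)) (cont_int (by fun_prop)), H_int P] at this
    have e : ∫ _ : ℝ, 4 * ε ∂μp = 2 * π * (4 * ε) := by rw [μp_int]; simp; ring
    rw [e] at this
    linarith
  have ht : Filter.Tendsto (fun ε : ℝ => ENNReal.ofReal (∫ φ, hh (ee '' K) φ ∂μp - 2 * π * ε))
      (nhdsWithin 0 (Set.Ioi 0)) (nhds (ENNReal.ofReal (∫ φ, hh (ee '' K) φ ∂μp))) := by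
    have hcont : Continuous (fun ε : ℝ => ENNReal.ofReal (∫ φ, hh (ee '' K) φ ∂μp - 2 * π * ε)) :=
      ENNReal.continuous_ofReal.comp (by fun_prop)
    have := hcont.tendsto 0
    simp only [mul_zero, sub_zero] at this
    exact this.mono_left nhdsWithin_le_nhds
  refine le_of_tendsto ht ?_
  filter_upwards [self_mem_nhdsWithin] with ε hε using key ε hε
end

section
variable {K L : Set (EuclideanSpace ℝ (Fin 2))}

lemma perim_zero (hK : IsCompact K) (hc : Convex ℝ K) (h0 : K ∈ nhds 0) :
    μH[1] (frontier K) = ENNReal.ofReal (∫ φ, hh (ee '' K) φ ∂μp) :=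
  le_antisymm (perim_upper hK hc h0) (perim_lower hK hc h0)

lemma hh_trans (hK : IsCompact K) (hne : K.Nonempty) (v : EuclideanSpace ℝ (Fin 2)) (φ : ℝ) :
    hh (ee '' ((fun x => x + v) '' K)) φ = hh (ee '' K) φ + pp (ee v) φ := by
  have hK' : IsCompact (ee '' K) := hK.image ee_cont
  have hK2 : IsCompact (ee '' ((fun x => x + v) '' K)) := (hK.image (by fun_prop)).image ee_cont
  have hp : ∀ x, pp (ee (x + v)) φ = pp (ee x) φ + pp (ee v) φ := by
    intro x; simp [pp, ee]; ring
  apply le_antisymm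
  · obtain ⟨_, ⟨_, ⟨x, hx, rfl⟩, rfl⟩, h⟩ := hh_ex hK2 ((hne.image _).image _) φ
    rw [← h]
    simp only [hp]
    have := le_hh hK' ⟨x, hx, rfl⟩ φ
    linarith
  · obtain ⟨_, ⟨x, hx, rfl⟩, h⟩ := hh_ex hK' (hne.image _) φ
    rw [← h, ← hp]
    exact le_hh hK2 ⟨_, ⟨x, hx, rfl⟩, rfl⟩ φ

lemma pp_int_zero (x : ℝ × ℝ) : ∫ φ, pp x φ ∂μp = 0 := by
  rw [μp_int]
  unfold pp
  rw [intervalIntegral.integral_add, intervalIntegral.integral_const_mul, intervalIntegral.integral_const_mul]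
  · simp
  · exact (by fun_prop : Continuous fun φ => x.1 * cos φ).intervalIntegrable _ _
  · exact (by fun_prop : Continuous fun φ => x.2 * sin φ).intervalIntegrable _ _

lemma perim_gen (hK : IsCompact K) (hc : Convex ℝ K) (hi : (interior K).Nonempty) :
    μH[1] (frontier K) = ENNReal.ofReal (∫ φ, hh (ee '' K) φ ∂μp) ∧ 0 ≤ ∫ φ, hh (ee '' K) φ ∂μp := by
  obtain ⟨v, hv⟩ := hi
  have hne : K.Nonempty := ⟨v, interior_subset hv⟩
  have e1 : (fun x => x + -v) '' K = (Homeomorph.addRight (-v)) '' K := rfl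
  have hK2 : IsCompact ((fun x => x + -v) '' K) := hK.image (by fun_prop)
  have hc2 : Convex ℝ ((fun x => x + -v) '' K) := by
    have e : (fun x => x + -v) = fun x => -v + x := funext fun x => add_comm _ _
    rw [e]; exact hc.translate (-v)
  have h0 : (fun x => x + -v) '' K ∈ nhds 0 := by
    rw [← mem_interior_iff_mem_nhds, e1, ← Homeomorph.image_interior]
    exact ⟨v, hv, by simp⟩
  have h1 := perim_zero hK2 hc2 h0
  have hIeq : ∫ φ, hh (ee '' ((fun x => x + -v) '' K)) φ ∂μp = ∫ φ, hh (ee '' K) φ ∂μp := by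
    simp only [hh_trans hK hne]
    rw [integral_add (cont_int (hh_cont (hK.image ee_cont) (hne.image _))) (cont_int (pp_cont' _)), pp_int_zero, add_zero]
  have hfr : μH[1] (frontier ((fun x => x + -v) '' K)) = μH[1] (frontier K) := by
    rw [e1, ← Homeomorph.image_frontier]
    exact (IsometryEquiv.addRight (-v)).hausdorffMeasure_image 1 (frontier K)
  rw [hIeq, hfr] at h1
  refine ⟨h1, ?_⟩
  rw [← hIeq]
  exact integral_nonneg fun φ => (H_pos (polarK hK2 hc2 h0) φ).le

lemma perim_eq (hK : IsCompact K) (hc : Convex ℝ K) (hi : (interior K).Nonempty) :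
    euclPerim K = ∫ φ, hh (ee '' K) φ ∂μp := by
  obtain ⟨h1, h2⟩ := perim_gen hK hc hi
  rw [euclPerim, h1, ENNReal.toReal_ofReal h2]

/-- coordinates as a measurable equivalence -/
noncomputable def eeE : EuclideanSpace ℝ (Fin 2) ≃ᵐ ℝ × ℝ :=
  (MeasurableEquiv.toLp 2 (Fin 2 → ℝ)).symm.trans (MeasurableEquiv.finTwoArrow)

lemma vol_ee (K : Set (EuclideanSpace ℝ (Fin 2))) : volume (ee '' K) = volume K := by
  have h : MeasurePreserving eeE :=
    (volume_preserving_finTwoArrow ℝ).comp (PiLp.volume_preserving_ofLp (Fin 2))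
  have e : ee = eeE := rfl
  rw [e, eeE.image_eq_preimage_symm]
  exact h.symm.measure_preimage_equiv K

lemma ee_convex (hc : Convex ℝ K) : Convex ℝ (ee '' K) := by
  have : IsLinearMap ℝ ee := ⟨ee_add, fun c x => by simp [ee]⟩
  exact hc.is_linear_image this

lemma rot_cont : Continuous fun p : ℝ × EuclideanSpace ℝ (Fin 2) => rot p.1 p.2 := by
  unfold rot
  simp only [WithLp.equiv_symm_apply]
  refine (PiLp.continuous_toLp 2 _).comp ?_
  refine continuous_pi fun i => ?_
  fin_cases i <;> simp <;> fun_prop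

lemma rot_lin (θ : ℝ) : IsLinearMap ℝ (rot θ) := by
  constructor
  · intro x y; ext i; fin_cases i <;> simp [rot] <;> ring
  · intro c x; ext i; fin_cases i <;> simp [rot] <;> ring

lemma pp_rot (θ φ : ℝ) (x : EuclideanSpace ℝ (Fin 2)) : pp (ee (rot θ x)) φ = pp (ee x) (φ - θ) := by
  simp [pp, ee, rot, cos_sub, sin_sub]; ring

/-- the set of translations hitting -/
def MM (K L : Set (EuclideanSpace ℝ (Fin 2))) (θ : ℝ) : Set (EuclideanSpace ℝ (Fin 2)) :=
  (fun p : EuclideanSpace ℝ (Fin 2) × EuclideanSpace ℝ (Fin 2) => p.1 - rot θ p.2) '' (K ×ˢ L)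

lemma mem_MM (x : EuclideanSpace ℝ (Fin 2)) (θ : ℝ) :
    (K ∩ (fun y => x + rot θ y) '' L).Nonempty ↔ x ∈ MM K L θ := by
  constructor
  · rintro ⟨_, hk, l, hl, rfl⟩
    exact ⟨(_, l), ⟨hk, hl⟩, by simp⟩
  · rintro ⟨⟨k, l⟩, ⟨hk, hl⟩, rfl⟩
    exact ⟨k, hk, l, hl, by simp⟩

lemma rot_cont' (θ : ℝ) : Continuous (rot θ) := by
  unfold rot
  simp only [WithLp.equiv_symm_apply]
  refine (PiLp.continuous_toLp 2 _).comp ?_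
  refine continuous_pi fun i => ?_
  fin_cases i <;> simp <;> fun_prop

lemma MM_compact (hK : IsCompact K) (hL : IsCompact L) (θ : ℝ) : IsCompact (MM K L θ) := by
  have := rot_cont' θ
  exact (hK.prod hL).image (by fun_prop)

lemma MM_convex (hK : Convex ℝ K) (hL : Convex ℝ L) (θ : ℝ) : Convex ℝ (MM K L θ) := by
  refine (hK.prod hL).is_linear_image ⟨?_, ?_⟩
  · intro x y; simp only [Prod.fst_add, Prod.snd_add, (rot_lin θ).map_add]; abel
  · intro c x; simp only [Prod.smul_fst, Prod.smul_snd, (rot_lin θ).map_smul, smul_sub]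

lemma MM_hh (hK : IsCompact K) (hL : IsCompact L) (hKn : K.Nonempty) (hLn : L.Nonempty) (θ φ : ℝ) :
    hh (ee '' MM K L θ) φ = hh (ee '' K) φ + hh (ee '' L) (φ - θ + π) := by
  have hK' : IsCompact (ee '' K) := hK.image ee_cont
  have hL' : IsCompact (ee '' L) := hL.image ee_cont
  have hM' : IsCompact (ee '' MM K L θ) := (MM_compact hK hL θ).image ee_cont
  have hp : ∀ x y, pp (ee (x - rot θ y)) φ = pp (ee x) φ + pp (ee y) (φ - θ + π) := by
    intro x y
    rw [pp_add_pi, ← pp_rot]; simp [pp, ee]; ring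
  apply le_antisymm
  · obtain ⟨_, ⟨_, ⟨⟨x, y⟩, ⟨hx, hy⟩, rfl⟩, rfl⟩, h⟩ := hh_ex hM' (((hKn.prod hLn).image _).image _) φ
    rw [← h]
    simp only [hp]
    exact add_le_add (le_hh hK' ⟨x, hx, rfl⟩ φ) (le_hh hL' ⟨y, hy, rfl⟩ _)
  · obtain ⟨_, ⟨x, hx, rfl⟩, h⟩ := hh_ex hK' (hKn.image _) φ
    obtain ⟨_, ⟨y, hy, rfl⟩, h'⟩ := hh_ex hL' (hLn.image _) (φ - θ + π)
    rw [← h, ← h', ← hp]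
    exact le_hh hM' ⟨_, ⟨(x, y), ⟨hx, hy⟩, rfl⟩, rfl⟩ φ

lemma MM_closed (hK : IsCompact K) (hL : IsCompact L) :
    IsClosed {p : EuclideanSpace ℝ (Fin 2) × ℝ | p.1 ∈ MM K L p.2} := by
  have e : {p : EuclideanSpace ℝ (Fin 2) × ℝ | p.1 ∈ MM K L p.2} =
      Prod.snd '' {q : L × (EuclideanSpace ℝ (Fin 2) × ℝ) | q.2.1 + rot q.2.2 q.1 ∈ K} := by
    ext ⟨x, θ⟩
    constructor
    · rintro ⟨⟨k, l⟩, ⟨hk, hl⟩, h⟩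
      refine ⟨(⟨l, hl⟩, (x, θ)), ?_, rfl⟩
      simp only at h
      simpa [← h] using hk
    · rintro ⟨⟨l, p⟩, h, rfl⟩
      exact ⟨(_, l.1), ⟨h, l.2⟩, by simp⟩
  rw [e]
  have : CompactSpace L := isCompact_iff_compactSpace.1 hL
  refine isClosedMap_snd_of_compactSpace _ (hK.isClosed.preimage ?_)
  have h2 : Continuous fun q : L × (EuclideanSpace ℝ (Fin 2) × ℝ) => rot q.2.2 q.1 :=
    rot_cont.comp (f := fun q : L × (EuclideanSpace ℝ (Fin 2) × ℝ) => (q.2.2, (q.1 : EuclideanSpace ℝ (Fin 2)))) (by fun_prop)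
  exact (by fun_prop : Continuous fun q : L × (EuclideanSpace ℝ (Fin 2) × ℝ) => q.2.1).add h2
end

/-- Principal kinematic formula in the Euclidean plane, convex case:
`∫_{ℝ²} ∫_{[0,2π)} 1[K ∩ (x + R_θ L) ≠ ∅] dθ/(2π) dx = A_K + A_L + P_K·P_L/(2π)`. -/
theorem principal_kinematic_formula_euclidean (K L : Set (EuclideanSpace ℝ (Fin 2)))
    (hKcomp : IsCompact K) (hKconv : Convex ℝ K) (hKint : (interior K).Nonempty)
    (hLcomp : IsCompact L) (hLconv : Convex ℝ L) (hLint : (interior L).Nonempty) :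
    ∫⁻ x : EuclideanSpace ℝ (Fin 2),
        (∫⁻ θ in Set.Ico (0 : ℝ) (2 * π),
            Set.indicator {θ' : ℝ | (K ∩ (fun y => x + rot θ' y) '' L).Nonempty}
              (fun _ => (1 : ENNReal)) θ) / ENNReal.ofReal (2 * π)
      = ENNReal.ofReal (euclArea K + euclArea L + (1 / (2 * π)) * euclPerim K * euclPerim L) := by
  have hKn : K.Nonempty := hKint.mono interior_subset
  have hLn : L.Nonempty := hLint.mono interior_subset
  have hpi := two_pi_pos
  obtain ⟨hi, hA⟩ := avg_area (hKcomp.image ee_cont) (ee_convex hKconv) (hKn.image _)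
    (hLcomp.image ee_cont) (ee_convex hLconv) (hLn.image _) (fun θ => ee '' MM K L θ)
    (fun θ => (MM_compact hKcomp hLcomp θ).image ee_cont) (fun θ => ee_convex (MM_convex hKconv hLconv θ))
    (MM_hh hKcomp hLcomp hKn hLn) (fun θ => ((hKn.prod hLn).image _).image _)
  simp only [vol_ee] at hi hA
  rw [← perim_eq hKcomp hKconv hKint, ← perim_eq hLcomp hLconv hLint] at hA
  have hm := (MM_closed hKcomp hLcomp).measurableSet
  have hF : Measurable (fun p : EuclideanSpace ℝ (Fin 2) × ℝ =>
      Set.indicator {p : EuclideanSpace ℝ (Fin 2) × ℝ | p.1 ∈ MM K L p.2} (fun _ => (1 : ENNReal)) p) :=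
    measurable_const.indicator hm
  have e1 : ∀ x θ, Set.indicator {θ' : ℝ | (K ∩ (fun y => x + rot θ' y) '' L).Nonempty}
      (fun _ => (1 : ENNReal)) θ =
      Set.indicator {p : EuclideanSpace ℝ (Fin 2) × ℝ | p.1 ∈ MM K L p.2} (fun _ => (1 : ENNReal)) (x, θ) := by
    intro x θ
    simp only [mem_MM]
    rfl
  simp only [e1, div_eq_mul_inv]
  have e2 : (volume.restrict (Set.Ico (0 : ℝ) (2 * π))) = μp := Measure.restrict_congr_set Ico_ae_eq_Ioc
  rw [e2, lintegral_mul_const _ hF.lintegral_prod_right',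
    lintegral_lintegral_swap (f := fun x θ => Set.indicator {p : EuclideanSpace ℝ (Fin 2) × ℝ | p.1 ∈ MM K L p.2} (fun _ => (1 : ENNReal)) (x, θ)) hF.aemeasurable]
  have e3 : ∀ θ, ∫⁻ x, Set.indicator {p : EuclideanSpace ℝ (Fin 2) × ℝ | p.1 ∈ MM K L p.2} (fun _ => (1 : ENNReal)) (x, θ)
      = ENNReal.ofReal (volume (MM K L θ)).toReal := by
    intro θ
    have hc := MM_compact hKcomp hLcomp θ
    rw [ENNReal.ofReal_toReal hc.measure_lt_top.ne, ← lintegral_indicator_one hc.isClosed.measurableSet]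
    rfl
  simp only [e3]
  rw [← ofReal_integral_eq_lintegral_ofReal hi (Filter.Eventually.of_forall fun _ => ENNReal.toReal_nonneg), hA,
    ← ENNReal.ofReal_inv_of_pos hpi, ← ENNReal.ofReal_mul' (inv_nonneg.2 hpi.le)]
  congr 1
  unfold euclArea
  field_simp
end

section
/- (Hadwiger's containment theorem, Euclidean case.) Let K and L be compact convex sets in ℝ² with nonempty interiors. If P_K·P_L ≤ 2π·(A_K + A_L), then there exists a rigid motion g of ℝ² (a composition of a rotation and a translation) such that either gK ⊆ L or gL ⊆ K. -/
open MeasureTheory Metric Real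

lemma hw_wirt (δ : ℝ) (l : ℕ) (hδ : 0 < δ) (hl : l * δ ≤ π) (g : ℕ → ℝ)
    (g0 : g 0 = 0) (gl : g l = 0) :
    ∑ j ∈ Finset.range l, (g j * g (j+1) - cos δ * g j ^ 2) ≤ 0 := by
  have key : ∀ k : ℕ, 1 ≤ k → k < l →
      ∑ j ∈ Finset.range k, (g j * g (j+1) - cos δ * g j ^ 2)
        ≤ 1/2 * g k ^ 2 * (sin (k * δ - δ) / sin (k * δ)) := by
    intro k hk
    induction k, hk using Nat.le_induction with
    | base => intro _; simp [g0]
    | succ k hk ih =>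
      intro hkl
      have ih := ih (by omega)
      rw [Finset.sum_range_succ]
      have hk' : (1:ℝ) ≤ k := by exact_mod_cast hk
      have hkl' : (k:ℝ) + 1 + 1 ≤ l := by exact_mod_cast hkl
      have hs1 : 0 < sin (k * δ) := sin_pos_of_pos_of_lt_pi (by positivity) (by nlinarith)
      have hs2 : 0 < sin (k * δ + δ) := sin_pos_of_pos_of_lt_pi (by positivity) (by nlinarith)
      have hs : sin (k * δ - δ) = 2 * cos δ * sin (k * δ) - sin (k * δ + δ) := by
        rw [sin_sub, sin_add]; ring
      have e1 : ((k+1 : ℕ) : ℝ) * δ - δ = k * δ := by push_cast; ring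
      have e2 : ((k+1 : ℕ) : ℝ) * δ = k * δ + δ := by push_cast; ring
      rw [e1, e2]
      rw [hs] at ih
      set a := sin (k * δ)
      set b := sin (k * δ + δ)
      have h1 : (2 * cos δ * a - b) / a = 2 * cos δ - b / a := by field_simp
      rw [h1] at ih
      have h2 : g k * g (k+1) ≤ 1/2 * g k ^2 * (b/a) + 1/2 * g (k+1)^2 * (a/b) := by
        have : 1/2 * g k ^2 * (b/a) + 1/2 * g (k+1)^2 * (a/b) - g k * g (k+1)
          = (b * g k - a * g (k+1))^2 / (2 * a * b) := by field_simp; ring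
        have : 0 ≤ (b * g k - a * g (k+1))^2 / (2 * a * b) := by positivity
        linarith
      nlinarith
  rcases Nat.lt_or_ge l 2 with h | h
  · interval_cases l <;> simp [g0]
  · obtain ⟨k, rfl⟩ : ∃ k, l = k + 1 := ⟨l-1, by omega⟩
    have ih := key k (by omega) (by omega)
    rw [Finset.sum_range_succ, gl]
    have hk' : (1:ℝ) ≤ k := by exact_mod_cast (by omega : 1 ≤ k)
    push_cast at hl
    have hs1 : 0 < sin (k * δ) := sin_pos_of_pos_of_lt_pi (by positivity) (by nlinarith)
    have hs2 : 0 ≤ sin (k * δ + δ) := sin_nonneg_of_nonneg_of_le_pi (by positivity) (by nlinarith)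
    have hs : sin (k * δ - δ) = 2 * cos δ * sin (k * δ) - sin (k * δ + δ) := by
      rw [sin_sub, sin_add]; ring
    rw [hs] at ih
    have h1 : (2 * cos δ * sin (k * δ) - sin (k * δ + δ)) / sin (k * δ) = 2 * cos δ - sin (k * δ + δ) / sin (k * δ) := by field_simp
    rw [h1] at ih
    have : 0 ≤ g k ^ 2 * (sin (k * δ + δ) / sin (k * δ)) := by positivity
    nlinarith

/-- hopping from zero to zero -/
lemma hw_hop (δ : ℝ) (m : ℕ) (hδ : 0 < δ) (hm : m * δ = π) (f : ℤ → ℝ)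
    (hz : ∀ i : ℤ, ∃ j : ℤ, i ≤ j ∧ j < i + m ∧ f j = 0) (N : ℕ) :
    ∀ a : ℤ, f a = 0 → f (a + N) = 0 →
    ∑ j ∈ Finset.range N, (f (a + j) * f (a + j + 1) - cos δ * f (a + j) ^ 2) ≤ 0 := by
  induction N using Nat.strong_induction_on with
  | _ N ih =>
    intro a ha hb
    rcases Nat.lt_or_ge m N with h | h
    · obtain ⟨j, h1, h2, h3⟩ := hz (a+1)
      obtain ⟨d, rfl⟩ : ∃ d : ℕ, j = a + d := ⟨(j - a).toNat, by omega⟩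
      obtain ⟨e, rfl⟩ : ∃ e : ℕ, N = d + e := ⟨N - d, by omega⟩
      rw [Finset.sum_range_add]
      have i1 := ih d (by omega) a ha h3
      have i2 := ih e (by omega) (a + d) h3 (by rw [← hb]; congr 1; push_cast; ring)
      have : ∀ x : ℕ, a + ((d + x : ℕ) : ℤ) = a + d + x := by intro x; push_cast; ring
      simp only [this]
      linarith
    · have := hw_wirt δ N hδ (by rw [← hm]; gcongr) (fun j => f (a + j)) (by simpa using ha) hb
      refine le_trans (le_of_eq ?_) this
      refine Finset.sum_congr rfl fun j _ => ?_
      simp only [Nat.cast_add, Nat.cast_one, add_assoc]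

lemma hw_shift (n : ℕ) (F : ℤ → ℝ) (hF : ∀ j, F (j + n) = F j) (c : ℤ) :
    ∑ j ∈ Finset.range n, F (c + j) = ∑ j ∈ Finset.range n, F j := by
  have step : ∀ c : ℤ, ∑ j ∈ Finset.range n, F (c + 1 + j) = ∑ j ∈ Finset.range n, F (c + j) := by
    intro c
    have h1 := Finset.sum_range_succ (fun j : ℕ => F (c + j)) n
    have h2 := Finset.sum_range_succ' (fun j : ℕ => F (c + j)) n
    rw [h1] at h2
    simp only [hF, Nat.cast_zero, add_zero, Nat.cast_add, Nat.cast_one] at h2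
    have h3 : ∑ j ∈ Finset.range n, F (c + 1 + j) = ∑ j ∈ Finset.range n, F (c + (j + 1)) :=
      Finset.sum_congr rfl fun j _ => by congr 1; ring
    linarith
  induction c using Int.induction_on with
  | zero => simp
  | succ i ih => rw [step, ih]
  | pred i ih => rw [← ih, ← step]; simp

/-- bilinear form -/
noncomputable def hwB (n : ℕ) (c : ℝ) (f g : ℤ → ℝ) : ℝ :=
  ∑ j ∈ Finset.range n, (f j * g (j+1) + f (j+1) * g j - 2 * c * (f j * g j))

lemma hwB_le (δ : ℝ) (m : ℕ) (hδ : 0 < δ) (hm : m * δ = π) (f : ℤ → ℝ)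
    (hf : ∀ j, f (j + (2 * m : ℕ)) = f j)
    (hz : ∀ i : ℤ, ∃ j : ℤ, i ≤ j ∧ j < i + m ∧ f j = 0) :
    hwB (2*m) (cos δ) f f ≤ 0 := by
  obtain ⟨a, -, -, ha⟩ := hz 0
  have h1 := hw_hop δ m hδ hm f hz (2*m) a ha (by rw [hf, ha])
  have h2 := hw_shift (2*m) (fun j => f j * f (j+1) + f (j+1) * f j - 2 * cos δ * (f j * f j))
    (by intro j; simp only [hf, add_right_comm j _ 1]) a
  unfold hwB
  rw [← h2]
  have : ∀ j : ℕ, f (a+j) * f (a+j+1) + f (a+j+1) * f (a+j) - 2 * cos δ * (f (a+j) * f (a+j))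
     = 2 * (f (a + j) * f (a + j + 1) - cos δ * f (a + j) ^ 2) := by intro j; ring
  simp only [this, ← Finset.mul_sum]
  linarith

lemma hwB_symm (n : ℕ) (c : ℝ) (f g : ℤ → ℝ) : hwB n c f g = hwB n c g f :=
  Finset.sum_congr rfl fun j _ => by ring

lemma hwB_sub (n : ℕ) (c r : ℝ) (f g : ℤ → ℝ) :
    hwB n c (fun j => f j - r * g j) (fun j => f j - r * g j)
      = hwB n c f f - 2 * r * hwB n c f g + r^2 * hwB n c g g := by
  unfold hwB
  rw [Finset.mul_sum, Finset.mul_sum, ← Finset.sum_sub_distrib, ← Finset.sum_add_distrib]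
  exact Finset.sum_congr rfl fun j _ => by ring

lemma hwB_add (n : ℕ) (c : ℝ) (f g h : ℤ → ℝ) :
    hwB n c (fun j => f j + g j) h = hwB n c f h + hwB n c g h := by
  unfold hwB
  rw [← Finset.sum_add_distrib]
  exact Finset.sum_congr rfl fun j _ => by ring

lemma hw_per (m : ℕ) (δ : ℝ) (hm : m * δ = π) (j : ℤ) :
    ((j + (2 * m : ℕ) : ℤ) : ℝ) * δ = j * δ + 2 * π := by
  push_cast; linear_combination 2 * hm

lemma hwB_lin (δ : ℝ) (m : ℕ) (hm : m * δ = π) (a b : ℝ) (f : ℤ → ℝ)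
    (hf : ∀ j, f (j + (2 * m : ℕ)) = f j) :
    hwB (2*m) (cos δ) (fun j => a * cos (j * δ) + b * sin (j * δ)) f = 0 := by
  set ℓ : ℤ → ℝ := fun j => a * cos (j * δ) + b * sin (j * δ) with hℓ
  have hℓp : ∀ j, ℓ (j + (2 * m : ℕ)) = ℓ j := by
    intro j; simp only [hℓ, hw_per m δ hm, cos_add_two_pi, sin_add_two_pi]
  have hrec : ∀ j, ℓ (j + 1) + ℓ (j - 1) = 2 * cos δ * ℓ j := by
    intro j; simp only [hℓ]; push_cast
    rw [add_mul, sub_mul, one_mul, cos_add, cos_sub, sin_add, sin_sub]; ring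
  have hs := hw_shift (2*m) (fun j => ℓ (j-1) * f j) (by
    intro j; rw [hf, show j + ((2*m : ℕ):ℤ) - 1 = (j - 1) + (2*m : ℕ) by ring, hℓp]) 1
  have : ∀ j : ℕ, ℓ (1 + (j:ℤ) - 1) * f (1 + j) = ℓ j * f (j + 1) := by
    intro j; congr 2 <;> ring
  simp only [this] at hs
  unfold hwB
  have e : ∑ j ∈ Finset.range (2*m), (ℓ j * f (j+1) + ℓ (j+1) * f j - 2 * cos δ * (ℓ j * f j))
    = ∑ j ∈ Finset.range (2*m), ℓ j * f (j+1) - ∑ j ∈ Finset.range (2*m), ℓ (j-1) * f j := by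
    rw [← Finset.sum_sub_distrib]
    refine Finset.sum_congr rfl fun j _ => ?_
    linear_combination (f j) * hrec j
  rw [e, hs, sub_self]

lemma hwB_trans (δ : ℝ) (m : ℕ) (hm : m * δ = π) (a b r : ℝ) (h k : ℤ → ℝ)
    (hh : ∀ j, h (j + (2 * m : ℕ)) = h j) (hk : ∀ j, k (j + (2 * m : ℕ)) = k j) :
    hwB (2*m) (cos δ) (fun j => h j + (a * cos (j * δ) + b * sin (j * δ)) - r * k j)
      (fun j => h j + (a * cos (j * δ) + b * sin (j * δ)) - r * k j)
      = hwB (2*m) (cos δ) h h - 2 * r * hwB (2*m) (cos δ) h k + r^2 * hwB (2*m) (cos δ) k k := by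
  have hℓp : ∀ j : ℤ, (a * cos (((j + (2 * m : ℕ) : ℤ):ℝ) * δ) + b * sin (((j + (2 * m : ℕ) : ℤ):ℝ) * δ))
      = a * cos (j * δ) + b * sin (j * δ) := by
    intro j; simp only [hw_per m δ hm, cos_add_two_pi, sin_add_two_pi]
  rw [hwB_sub (2*m) (cos δ) r (fun j => h j + (a * cos (j * δ) + b * sin (j * δ))) k]
  have e1 := hwB_add (2*m) (cos δ) h (fun j : ℤ => a * cos (j * δ) + b * sin (j * δ))
  rw [e1, e1, hwB_symm _ _ h (fun j => h j + (a * cos (j * δ) + b * sin (j * δ))), e1,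
    hwB_lin δ m hm a b k hk, hwB_lin δ m hm a b h hh,
    hwB_lin δ m hm a b _ (by intro j; simp only [hh, hℓp])]
  ring

lemma hw_rep (n : ℕ) (hn : 0 < n) (F : ℤ → Prop) (hF : ∀ j, F (j + n) ↔ F j) (i : ℤ)
    (h : ∀ t : ℕ, t < n → F (i + t)) (j : ℤ) : F j := by
  have hF' : ∀ (q : ℤ) (j : ℤ), F (j + q * n) ↔ F j := by
    intro q
    induction q using Int.induction_on with
    | zero => intro j; simp
    | succ q ih => intro j; rw [← ih j, ← hF (j + q * n)]; ring_nf
    | pred q ih => intro j; rw [← ih j, ← hF (j + (-q - 1) * n)]; ring_nf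
  have h1 := Int.emod_add_mul_ediv (j - i) n
  have h2 := Int.emod_nonneg (j - i) (show (n:ℤ) ≠ 0 by omega)
  have h3 := Int.emod_lt_of_pos (j - i) (show (0:ℤ) < n by omega)
  have := h ((j - i) % n).toNat (by omega)
  rw [← hF' ((j-i)/n)] at this
  convert this using 1
  rw [Int.toNat_of_nonneg h2]
  linarith

lemma hw_ext (δ : ℝ) (p : ℕ) (hp : 0 < p) (hδ : 0 < δ) (hm : (2 * p : ℕ) * δ = π) (h k : ℤ → ℝ)
    (hh : ∀ j, h (j + (2 * (2 * p) : ℕ)) = h j) (hk : ∀ j, k (j + (2 * (2 * p) : ℕ)) = k j)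
    (h0 : ∀ j, 0 ≤ h j) (k0 : ∀ j, 0 ≤ k j)
    (hno : ¬ ∃ a b : ℝ, ∀ j : ℤ, k j ≤ h j + (a * cos (j * δ) + b * sin (j * δ))) :
    ∃ r : ℝ, 0 ≤ r ∧ r < 1 ∧ hwB (2*(2*p)) (cos δ) h h - 2 * r * hwB (2*(2*p)) (cos δ) h k
      + r^2 * hwB (2*(2*p)) (cos δ) k k ≤ 0 := by
  set S : Set (ℝ × ℝ × ℝ) := {x | (0 ≤ x.1 ∧ x.1 ≤ 1) ∧
    ∀ j : ℤ, x.1 * k j ≤ h j + (x.2.1 * cos (j * δ) + x.2.2 * sin (j * δ))} with hS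
  have hclosed : IsClosed S := by
    rw [hS, Set.ofPred_and, Set.ofPred_and, Set.ofPred_forall]
    refine ((isClosed_le (by fun_prop) (by fun_prop)).inter
      (isClosed_le (by fun_prop) (by fun_prop))).inter (isClosed_iInter fun j => ?_)
    exact isClosed_le (by fun_prop) (by fun_prop)
  have hpd : (p : ℝ) * δ = π / 2 := by push_cast at hm; linarith
  have hsub : S ⊆ Set.Icc (0:ℝ) 1 ×ˢ (Set.Icc (-h 0) (h (2*p)) ×ˢ Set.Icc (-h p) (h (-p))) := by
    rintro ⟨r, a, b⟩ ⟨⟨h1, h2⟩, h3⟩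
    simp only at h1 h2 h3
    have q : ∀ j, 0 ≤ r * k j := fun j => mul_nonneg h1 (k0 j)
    have t1 := (q _).trans (h3 0)
    have t2 := (q _).trans (h3 (2*p))
    have t3 := (q _).trans (h3 p)
    have t4 := (q _).trans (h3 (-p))
    have e2 : ((2 * p : ℤ) : ℝ) * δ = π := by push_cast; linarith
    have e4 : ((- p : ℤ) : ℝ) * δ = -(π/2) := by push_cast; linarith
    rw [e2] at t2
    rw [e4] at t4
    rw [Int.cast_natCast, hpd] at t3
    simp at t1 t2 t3 t4
    refine ⟨⟨h1, h2⟩, ⟨by simp only; linarith, by simp only; linarith⟩, by simp only; linarith, by simp only; linarith⟩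
  have hcomp : IsCompact S :=
    (isCompact_Icc.prod (isCompact_Icc.prod isCompact_Icc)).of_isClosed_subset hclosed hsub
  obtain ⟨⟨r, a, b⟩, hmem, hmax⟩ := hcomp.exists_isMaxOn ⟨(0,0,0), by simp [hS, h0]⟩
    (f := fun x => x.1) (by fun_prop)
  obtain ⟨⟨hr0, hr1⟩, hc⟩ := hmem
  simp only at hr0 hr1 hc
  have hr : r < 1 := by
    refine lt_of_le_of_ne hr1 fun e => hno ⟨a, b, fun j => ?_⟩
    have := hc j
    rwa [e, one_mul] at this
  refine ⟨r, hr0, hr, ?_⟩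
  set f : ℤ → ℝ := fun j => h j + (a * cos (j * δ) + b * sin (j * δ)) - r * k j with hf
  have hℓp : ∀ (a b : ℝ) (j : ℤ), (a * cos (((j + (2 * (2*p) : ℕ) : ℤ):ℝ) * δ) + b * sin (((j + (2 * (2*p) : ℕ) : ℤ):ℝ) * δ))
      = a * cos (j * δ) + b * sin (j * δ) := by
    intro a b j; simp only [hw_per (2*p) δ hm, cos_add_two_pi, sin_add_two_pi]
  have hfp : ∀ j, f (j + (2 * (2 * p) : ℕ)) = f j := by
    intro j; simp only [hf, hℓp, hh, hk]
  rw [← hwB_trans δ (2*p) hm a b r h k hh hk]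
  refine hwB_le δ (2*p) hδ hm f hfp ?_
  by_contra hcon
  push Not at hcon
  obtain ⟨i, hi⟩ := hcon
  -- improving direction
  set ψ : ℝ := (i + ((2 * p : ℕ) - 1) / 2) * δ with hψ
  have hdir : ∀ t : ℕ, t < 2 * (2 * p) →
      ∀ᶠ ε in nhdsWithin (0:ℝ) (Set.Ioi 0),
        ε * ε * k (i+t) ≤ f (i+t) + ε * (-cos ψ * cos ((i+t : ℤ) * δ) + -sin ψ * sin ((i+t : ℤ) * δ)) := by
    intro t ht
    rcases Nat.lt_or_ge t (2*p) with h1 | h1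
    · have hpos : 0 < f (i+t) := by
        refine lt_of_le_of_ne ?_ (hi (i+t) (by omega) (by omega)).symm
        have := hc (i+t); simp only [hf]; linarith
      have : Filter.Tendsto (fun ε : ℝ => f (i+t) + ε * (-cos ψ * cos ((i+t : ℤ) * δ) + -sin ψ * sin ((i+t : ℤ) * δ)) - ε * ε * k (i+t)) (nhdsWithin (0:ℝ) (Set.Ioi 0)) (nhds (f (i+t))) := by
        refine Filter.Tendsto.mono_left ?_ nhdsWithin_le_nhds
        refine Continuous.tendsto' (by fun_prop) _ _ (by simp)
      filter_upwards [this.eventually (lt_mem_nhds hpos)] with ε hε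
      linarith
    · have hnn : 0 ≤ f (i+t) := by
        have := hc (i+t); simp only [hf]; linarith
      set w := (-cos ψ * cos ((i+t : ℤ) * δ) + -sin ψ * sin ((i+t : ℤ) * δ)) with hw
      have hwpos : 0 < w := by
        have : w = cos (((i+t : ℤ):ℝ) * δ - ψ - π) := by
          rw [cos_sub_pi, cos_sub, hw]; ring
        rw [this]
        have e : ((i+t : ℤ):ℝ) * δ - ψ - π = (t - ((2*p : ℕ):ℝ) * (3/2) + 1/2) * δ := by
          rw [hψ, ← hm]; push_cast; ring
        rw [e]
        have ht1 : ((2*p : ℕ):ℝ) ≤ t := by exact_mod_cast h1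
        have ht2 : (t:ℝ) + 1 ≤ 2 * ((2*p : ℕ):ℝ) := by exact_mod_cast ht
        apply cos_pos_of_mem_Ioo
        constructor <;> nlinarith
      have : Filter.Tendsto (fun ε : ℝ => w - ε * k (i+t)) (nhdsWithin (0:ℝ) (Set.Ioi 0)) (nhds w) := by
        refine Filter.Tendsto.mono_left ?_ nhdsWithin_le_nhds
        refine Continuous.tendsto' (by fun_prop) _ _ (by simp)
      filter_upwards [this.eventually (lt_mem_nhds hwpos), self_mem_nhdsWithin] with ε hε hε0
      have := mul_pos (Set.mem_Ioi.1 hε0) hε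
      linarith
  have hall : ∀ᶠ ε in nhdsWithin (0:ℝ) (Set.Ioi 0), ∀ t ∈ Finset.range (2*(2*p)),
        ε * ε * k (i+t) ≤ f (i+t) + ε * (-cos ψ * cos ((i+t : ℤ) * δ) + -sin ψ * sin ((i+t : ℤ) * δ)) :=
    (Filter.eventually_all_finset _).2 fun t ht => hdir t (Finset.mem_range.1 ht)
  have hsmall : ∀ᶠ ε in nhdsWithin (0:ℝ) (Set.Ioi 0), r + ε * ε < 1 := by
    have : Filter.Tendsto (fun ε : ℝ => r + ε * ε) (nhdsWithin (0:ℝ) (Set.Ioi 0)) (nhds r) := by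
      refine Filter.Tendsto.mono_left ?_ nhdsWithin_le_nhds
      refine Continuous.tendsto' (by fun_prop) _ _ (by simp)
    exact this.eventually (gt_mem_nhds hr)
  obtain ⟨ε, hε1, hε2, hε0⟩ := (hall.and (hsmall.and self_mem_nhdsWithin)).exists
  have hε0 : 0 < ε := hε0
  have hmem' : (r + ε * ε, a + ε * -cos ψ, b + ε * -sin ψ) ∈ S := by
    refine ⟨⟨by simp only; positivity, hε2.le⟩, ?_⟩
    simp only
    refine hw_rep (2*(2*p)) (by omega) _ ?_ i ?_
    · intro j; rw [hℓp, hh, hk]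
    · intro t ht
      have := hε1 t (Finset.mem_range.2 ht)
      simp only [hf] at this
      linarith
  have := hmax hmem'
  simp at this
  nlinarith

lemma hw_bonn (δ : ℝ) (p : ℕ) (hp : 0 < p) (hδ : 0 < δ) (hm : (2 * p : ℕ) * δ = π) (h k : ℤ → ℝ)
    (hh : ∀ j, h (j + (2 * (2 * p) : ℕ)) = h j) (hk : ∀ j, k (j + (2 * (2 * p) : ℕ)) = k j)
    (h0 : ∀ j, 0 ≤ h j) (k0 : ∀ j, 0 ≤ k j)
    (hB : 0 < hwB (2*(2*p)) (cos δ) h h) (kB : 0 < hwB (2*(2*p)) (cos δ) k k)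
    (hno : ¬ ∃ a b : ℝ, ∀ j : ℤ, k j ≤ h j + (a * cos (j * δ) + b * sin (j * δ)))
    (hno' : ¬ ∃ a b : ℝ, ∀ j : ℤ, h j ≤ k j + (a * cos (j * δ) + b * sin (j * δ))) :
    hwB (2*(2*p)) (cos δ) h h + hwB (2*(2*p)) (cos δ) k k ≤ 2 * hwB (2*(2*p)) (cos δ) h k := by
  obtain ⟨r, hr0, hr1, hr⟩ := hw_ext δ p hp hδ hm h k hh hk h0 k0 hno
  obtain ⟨s, hs0, hs1, hs⟩ := hw_ext δ p hp hδ hm k h hk hh k0 h0 hno'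
  rw [hwB_symm _ _ k h] at hs
  set A := hwB (2*(2*p)) (cos δ) h h
  set B := hwB (2*(2*p)) (cos δ) k k
  set V := hwB (2*(2*p)) (cos δ) h k
  have hrpos : 0 < r := by
    rcases hr0.eq_or_lt with h | h
    · subst h; simp at hr; linarith
    · exact h
  have hspos : 0 < s := by
    rcases hs0.eq_or_lt with h | h
    · subst h; simp at hs; linarith
    · exact h
  -- V ≥ (A/r + r B)/2 and V ≥ (B/s + s A)/2
  by_contra hcon
  push Not at hcon
  have h1 : A * (1 - r) < r * B * (1 - r) := by nlinarith
  have h2 : B * (1 - s) < s * A * (1 - s) := by nlinarith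
  have h3 : A < r * B := lt_of_mul_lt_mul_right h1 (by linarith)
  have h4 : B < s * A := lt_of_mul_lt_mul_right h2 (by linarith)
  nlinarith

lemma hw_avg (δ : ℝ) (m : ℕ) (h k : ℤ → ℝ)
    (hh : ∀ j, h (j + (2 * m : ℕ)) = h j) (hk : ∀ j, k (j + (2 * m : ℕ)) = k j) :
    ∑ i ∈ Finset.range (2*m), hwB (2*m) (cos δ) h (fun j => k (j - i))
      = 2 * (1 - cos δ) * ((∑ j ∈ Finset.range (2*m), h j) * (∑ j ∈ Finset.range (2*m), k j)) := by
  unfold hwB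
  rw [Finset.sum_comm]
  have hsum : ∀ c : ℤ, ∑ i ∈ Finset.range (2*m), k (c - i) = ∑ j ∈ Finset.range (2*m), k j := by
    intro c
    rw [← Finset.sum_range_reflect, ← hw_shift (2*m) k hk (c - (2*m : ℕ) + 1)]
    refine Finset.sum_congr rfl fun j hj => ?_
    have := Finset.mem_range.1 hj
    congr 1
    omega
  have hs1 : ∑ j ∈ Finset.range (2*m), h (j+1) = ∑ j ∈ Finset.range (2*m), h j := by
    rw [← hw_shift (2*m) h hh 1]
    exact Finset.sum_congr rfl fun j _ => by rw [add_comm]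
  have : ∀ j : ℕ, ∑ i ∈ Finset.range (2*m), (h j * k (j + 1 - i) + h (j+1) * k (j - i) - 2 * cos δ * (h j * k (j - i)))
      = (h j + h (j+1) - 2 * cos δ * h j) * ∑ j ∈ Finset.range (2*m), k j := by
    intro j
    rw [Finset.sum_sub_distrib, Finset.sum_add_distrib, ← Finset.mul_sum, ← Finset.mul_sum,
      ← Finset.mul_sum, ← Finset.mul_sum, hsum, hsum]
    ring
  simp only [this]
  rw [← Finset.sum_mul, Finset.sum_sub_distrib, Finset.sum_add_distrib, hs1, ← Finset.mul_sum]
  ring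

/-- linear functional in direction `t` -/
noncomputable def hwd (t : ℝ) (x : EuclideanSpace ℝ (Fin 2)) : ℝ := x 0 * cos t + x 1 * sin t

/-- support function -/
noncomputable def hwH (K : Set (EuclideanSpace ℝ (Fin 2))) (t : ℝ) : ℝ := sSup (hwd t '' K)

lemma hwd_cont (t : ℝ) : Continuous (hwd t) := by unfold hwd; fun_prop

lemma hwd_le {K : Set (EuclideanSpace ℝ (Fin 2))} (hK : IsCompact K) (t : ℝ)
    {x : EuclideanSpace ℝ (Fin 2)} (hx : x ∈ K) : hwd t x ≤ hwH K t :=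
  le_csSup (hK.image (hwd_cont t)).bddAbove ⟨x, hx, rfl⟩

lemma hwH_attain {K : Set (EuclideanSpace ℝ (Fin 2))} (hK : IsCompact K) (hn : K.Nonempty) (t : ℝ) :
    ∃ x ∈ K, hwd t x = hwH K t :=
  (hK.image (hwd_cont t)).sSup_mem (hn.image _)

lemma hwH_per (K : Set (EuclideanSpace ℝ (Fin 2))) (t : ℝ) : hwH K (t + 2 * π) = hwH K t := by
  unfold hwH hwd; simp

lemma hwd_zero (t : ℝ) : hwd t 0 = 0 := by simp [hwd]

lemma hw_normsq (x : EuclideanSpace ℝ (Fin 2)) : ‖x‖ ^ 2 = x 0 ^ 2 + x 1 ^ 2 := by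
  rw [EuclideanSpace.real_norm_sq_eq]; simp [Fin.sum_univ_two]

lemma hwd_abs_le (t : ℝ) (x : EuclideanSpace ℝ (Fin 2)) : |hwd t x| ≤ ‖x‖ := by
  apply abs_le_of_sq_le_sq _ (norm_nonneg _)
  rw [hw_normsq]; unfold hwd
  have := sin_sq_add_cos_sq t
  nlinarith [sq_nonneg (x 0 * sin t - x 1 * cos t)]

lemma hwd_sub_le (s t : ℝ) (x : EuclideanSpace ℝ (Fin 2)) :
    |hwd s x - hwd t x| ≤ 2 * ‖x‖ * |s - t| := by
  have h0 : |x 0| ≤ ‖x‖ := by simpa using PiLp.norm_apply_le x 0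
  have h1 : |x 1| ≤ ‖x‖ := by simpa using PiLp.norm_apply_le x 1
  have e : hwd s x - hwd t x = x 0 * (cos s - cos t) + x 1 * (sin s - sin t) := by
    unfold hwd; ring
  have hc : |cos s - cos t| ≤ |s - t| := abs_cos_sub_cos_le s t
  have hs : |sin s - sin t| ≤ |s - t| := abs_sin_sub_sin_le s t
  rw [e]
  calc _ ≤ |x 0 * (cos s - cos t)| + |x 1 * (sin s - sin t)| := abs_add_le _ _
    _ = |x 0| * |cos s - cos t| + |x 1| * |sin s - sin t| := by rw [abs_mul, abs_mul]
    _ ≤ ‖x‖ * |s - t| + ‖x‖ * |s - t| := by gcongr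
    _ = _ := by ring

lemma hwH_pos {K : Set (EuclideanSpace ℝ (Fin 2))} (hK : IsCompact K)
    (h0 : (0 : EuclideanSpace ℝ (Fin 2)) ∈ interior K) (t : ℝ) : 0 < hwH K t := by
  obtain ⟨ε, hε, hb⟩ := Metric.mem_nhds_iff.1 (mem_interior_iff_mem_nhds.1 h0)
  set u : EuclideanSpace ℝ (Fin 2) := !₂[ε / 2 * cos t, ε / 2 * sin t] with hu
  have hn : ‖u‖ ^ 2 = (ε/2)^2 := by
    rw [hw_normsq]; simp [hu]; nlinarith [sin_sq_add_cos_sq t]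
  have hn' : ‖u‖ = ε / 2 := by
    have := (sq_eq_sq₀ (norm_nonneg u) (by positivity)).1 hn
    exact this
  have hm : u ∈ K := hb (by simp [hn']; linarith)
  have h1 := hwd_le hK t hm
  have h2 : hwd t u = ε / 2 := by
    simp [hwd, hu]; nlinarith [sin_sq_add_cos_sq t]
  linarith

lemma hwd_add (t d : ℝ) (x : EuclideanSpace ℝ (Fin 2)) :
    hwd (t + d) x = hwd t x * cos d + hwd (t + π/2) x * sin d := by
  unfold hwd; rw [cos_add_pi_div_two, sin_add_pi_div_two, cos_add, sin_add]; ring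

lemma hwd_sub (t d : ℝ) (x : EuclideanSpace ℝ (Fin 2)) :
    hwd (t - d) x = hwd t x * cos d - hwd (t + π/2) x * sin d := by
  unfold hwd; rw [cos_add_pi_div_two, sin_add_pi_div_two, cos_sub, sin_sub]; ring

/-- convexity of support numbers -/
lemma hwH_conv {K : Set (EuclideanSpace ℝ (Fin 2))} (hK : IsCompact K) (hn : K.Nonempty) (t d : ℝ) :
    2 * hwH K t * cos d ≤ hwH K (t + d) + hwH K (t - d) := by
  obtain ⟨x, hx, e⟩ := hwH_attain hK hn t
  have h1 := hwd_le hK (t+d) hx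
  have h2 := hwd_le hK (t-d) hx
  rw [hwd_add] at h1
  rw [hwd_sub] at h2
  rw [← e]; linarith

lemma hw_measpres (t : ℝ) : MeasurePreserving (fun x : EuclideanSpace ℝ (Fin 2) =>
    (hwd t x, hwd (t + π/2) x)) volume volume := by
  have h1 := EuclideanSpace.volume_preserving_symm_measurableEquiv_toLp (Fin 2)
  have h2 := volume_preserving_finTwoArrow ℝ
  set M : Matrix (Fin 2) (Fin 2) ℝ := !![cos t, sin t; -sin t, cos t] with hM
  have hdet : M.det = 1 := by rw [hM, Matrix.det_fin_two_of]; nlinarith [sin_sq_add_cos_sq t]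
  have h3 : MeasurePreserving (Matrix.toLin' M) volume volume := by
    refine ⟨(LinearMap.continuous_of_finiteDimensional _).measurable, ?_⟩
    rw [Real.map_matrix_volume_pi_eq_smul_volume_pi (by rw [hdet]; norm_num), hdet]
    simp
  have key := h2.comp (h3.comp h1)
  have e1 : cos (t + π/2) = - sin t := cos_add_pi_div_two t
  have e2 : sin (t + π/2) = cos t := sin_add_pi_div_two t
  refine (congrArg (fun F => MeasurePreserving F volume volume) ?_).mpr key
  funext x
  simp [hwd, hM, e1, e2, Matrix.mulVec, dotProduct, Fin.sum_univ_two, Prod.ext_iff]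
  constructor <;> ring

lemma hw_tri (t d h p q : ℝ) (hh : 0 < h) (hd : 0 < sin d) (hpq : 2 * h * cos d ≤ p + q) :
    volume {x : EuclideanSpace ℝ (Fin 2) | (0 ≤ hwd t x ∧ hwd t x ≤ h) ∧
      h * hwd (t + d) x ≤ p * hwd t x ∧ h * hwd (t - d) x ≤ q * hwd t x}
      ≤ ENNReal.ofReal (h * (p + q - 2 * h * cos d) / (2 * sin d)) := by
  set β := (p / h - cos d) / sin d with hβ
  set α := -(q / h - cos d) / sin d with hα
  set S : Set (ℝ × ℝ) := {y | (0 ≤ y.1 ∧ y.1 ≤ h) ∧ α * y.1 ≤ y.2 ∧ y.2 ≤ β * y.1} with hS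
  have hSm : MeasurableSet S := by
    refine IsClosed.measurableSet ?_
    rw [hS, Set.ofPred_and, Set.ofPred_and, Set.ofPred_and]
    exact ((isClosed_le (by fun_prop) (by fun_prop)).inter
      (isClosed_le (by fun_prop) (by fun_prop))).inter
       ((isClosed_le (by fun_prop) (by fun_prop)).inter
      (isClosed_le (by fun_prop) (by fun_prop)))
  have hsub : {x : EuclideanSpace ℝ (Fin 2) | (0 ≤ hwd t x ∧ hwd t x ≤ h) ∧
      h * hwd (t + d) x ≤ p * hwd t x ∧ h * hwd (t - d) x ≤ q * hwd t x} ⊆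
      (fun x => (hwd t x, hwd (t + π/2) x)) ⁻¹' S := by
    rintro x ⟨⟨h1, h2⟩, h3, h4⟩
    rw [hwd_add] at h3
    rw [hwd_sub] at h4
    refine ⟨⟨h1, h2⟩, ?_, ?_⟩
    · simp only [hα]
      rw [div_mul_eq_mul_div, div_le_iff₀ hd]
      have : -(q / h - cos d) * hwd t x = (- q * hwd t x + h * cos d * hwd t x) / h := by
        field_simp; ring
      rw [this, div_le_iff₀ hh]; linarith
    · simp only [hβ]
      rw [div_mul_eq_mul_div, le_div_iff₀ hd]
      have : (p / h - cos d) * hwd t x = (p * hwd t x - h * cos d * hwd t x) / h := by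
        field_simp
      rw [this, le_div_iff₀ hh]; linarith
  refine (measure_mono hsub).trans ?_
  rw [(hw_measpres t).measure_preimage hSm.nullMeasurableSet]
  rw [Measure.volume_eq_prod, Measure.prod_apply hSm]
  have hfib : ∀ s : ℝ, volume (Prod.mk s ⁻¹' S) ≤
      (Set.Icc 0 h).indicator (fun s => ENNReal.ofReal ((β - α) * s)) s := by
    intro s
    by_cases hs : s ∈ Set.Icc 0 h
    · rw [Set.indicator_of_mem hs]
      refine (measure_mono (t := Set.Icc (α * s) (β * s)) ?_).trans ?_
      · rintro y ⟨-, h3, h4⟩; exact ⟨h3, h4⟩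
      · rw [Real.volume_Icc]; apply le_of_eq; congr 1; ring
    · rw [Set.indicator_of_notMem hs]
      have : Prod.mk s ⁻¹' S = ∅ := by
        ext y; simp only [Set.mem_preimage, hS, Set.mem_empty_iff_false, iff_false]
        rintro ⟨h1, -⟩; exact hs h1
      simp [this]
  refine (lintegral_mono hfib).trans ?_
  rw [lintegral_indicator measurableSet_Icc]
  have hαβ : β - α = (p + q - 2 * h * cos d) / (h * sin d) := by
    rw [hα, hβ]; field_simp; ring
  have hαβ0 : 0 ≤ β - α := by
    rw [hαβ]; apply div_nonneg (by linarith); positivity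
  rw [← ofReal_integral_eq_lintegral_ofReal]
  · apply ENNReal.ofReal_le_ofReal
    rw [integral_Icc_eq_integral_Ioc, ← intervalIntegral.integral_of_le hh.le,
      intervalIntegral.integral_const_mul, integral_id, hαβ]
    apply le_of_eq
    field_simp
    ring
  · exact (Continuous.continuousOn (by fun_prop)).integrableOn_Icc
  · refine (ae_restrict_mem measurableSet_Icc).mono fun s hs => ?_
    exact mul_nonneg hαβ0 hs.1

lemma hw_area {K : Set (EuclideanSpace ℝ (Fin 2))} (hK : IsCompact K)
    (h0 : (0 : EuclideanSpace ℝ (Fin 2)) ∈ interior K) (m : ℕ) (δ : ℝ) (hm2 : 2 ≤ m)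
    (hm : m * δ = π) :
    (volume K).toReal ≤ hwB (2*m) (cos δ) (fun j => hwH K (j * δ)) (fun j => hwH K (j * δ))
      / (2 * sin δ) := by
  have hm2' : (2:ℝ) ≤ m := by exact_mod_cast hm2
  have hδ : 0 < δ := by
    by_contra h; push Not at h
    have := pi_pos
    nlinarith
  have hδ2 : δ < π := by nlinarith
  have hs : 0 < sin δ := sin_pos_of_pos_of_lt_pi hδ hδ2
  have hne : K.Nonempty := ⟨0, interior_subset h0⟩
  set h : ℤ → ℝ := fun j => hwH K (j * δ) with hh
  have hpos : ∀ j, 0 < h j := fun j => hwH_pos hK h0 _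
  have hper : ∀ j, h (j + (2*m : ℕ)) = h j := by
    intro j; simp only [hh]; rw [hw_per m δ hm, hwH_per]
  set T : ℕ → Set (EuclideanSpace ℝ (Fin 2)) := fun j => {x | (0 ≤ hwd (j * δ) x ∧ hwd (j * δ) x ≤ h j) ∧
      h j * hwd (j * δ + δ) x ≤ h (j+1) * hwd (j * δ) x ∧ h j * hwd (j * δ - δ) x ≤ h (j-1) * hwd (j * δ) x} with hT
  have hT1 : ∀ j, volume (T j) ≤ ENNReal.ofReal (h j * (h (j+1) + h (j-1) - 2 * h j * cos δ) / (2 * sin δ)) := by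
    intro j
    refine hw_tri (j * δ) δ (h j) (h (j+1)) (h (j-1)) (hpos _) hs ?_
    have := hwH_conv hK hne (j * δ) δ
    simp only [hh]
    push_cast
    rwa [add_mul, sub_mul, one_mul]
  have hterm : ∀ j : ℤ, 0 ≤ h j * (h (j+1) + h (j-1) - 2 * h j * cos δ) / (2 * sin δ) := by
    intro j
    have := hwH_conv hK hne (j * δ) δ
    have h2 : 2 * h j * cos δ ≤ h (j+1) + h (j-1) := by
      simp only [hh]
      push_cast
      rwa [add_mul, sub_mul, one_mul]
    have := hpos j
    apply div_nonneg _ (by positivity)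
    apply mul_nonneg this.le; linarith
  have hcov : K ⊆ ⋃ j ∈ Finset.range (2*m), T j := by
    intro x hx
    obtain ⟨j, hj, hmax⟩ := Finset.exists_max_image (Finset.range (2*m))
      (fun j => hwd (j * δ) x / h j) ⟨0, by simp; omega⟩
    have hmaxZ : ∀ i : ℤ, hwd (i * δ) x / h i ≤ hwd (j * δ) x / h j := by
      refine hw_rep (2*m) (by omega) _ ?_ 0 ?_
      · intro i
        rw [hper, hw_per m δ hm]
        unfold hwd; simp
      · intro t ht
        simpa using hmax t (Finset.mem_range.2 ht)
    have hnn : 0 ≤ hwd (j * δ) x := by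
      by_contra hneg
      push Not at hneg
      have h1 : hwd (j * δ) x / h j < 0 := div_neg_of_neg_of_pos hneg (hpos _)
      have h2 := hmaxZ (j + m)
      have e : hwd (((j + m : ℤ) : ℝ) * δ) x = - hwd (j * δ) x := by
        push_cast
        rw [add_mul, hm]
        unfold hwd; rw [cos_add_pi, sin_add_pi]; ring
      rw [e] at h2
      have : 0 < - hwd (j * δ) x / h (j + m) := div_pos (by linarith) (hpos _)
      linarith
    simp only [Set.mem_iUnion]
    refine ⟨j, hj, ⟨hnn, ?_⟩, ?_, ?_⟩
    · have := hwd_le hK (j * δ) hx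
      simpa [hh] using this
    · have := hmaxZ (j + 1)
      rw [div_le_div_iff₀ (hpos _) (hpos _)] at this
      push_cast at this
      rw [add_mul, one_mul] at this
      linarith
    · have := hmaxZ (j - 1)
      rw [div_le_div_iff₀ (hpos _) (hpos _)] at this
      push_cast at this
      rw [sub_mul, one_mul] at this
      linarith
  have hsum : ∑ j ∈ Finset.range (2*m), h j * (h (j+1) + h (j-1) - 2 * h j * cos δ) / (2 * sin δ)
     = hwB (2*m) (cos δ) h h / (2 * sin δ) := by
    rw [← Finset.sum_div]; congr 1
    have hs := hw_shift (2*m) (fun j => h j * h (j-1)) (by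
      intro j; rw [hper, show j + ((2*m : ℕ):ℤ) - 1 = (j - 1) + (2*m : ℕ) by ring, hper]) 1
    have e : ∀ j : ℕ, h (1 + (j:ℤ)) * h (1 + j - 1) = h (j+1) * h j := by
      intro j; congr 2 <;> ring
    simp only [e] at hs
    unfold hwB
    calc _ = ∑ j ∈ Finset.range (2*m), (h j * h (j+1) - 2 * cos δ * (h j * h j)) + ∑ j ∈ Finset.range (2*m), h j * h (j-1) := by
          rw [← Finset.sum_add_distrib]; exact Finset.sum_congr rfl fun j _ => by ring
      _ = _ := by
          rw [← hs, ← Finset.sum_add_distrib]; exact Finset.sum_congr rfl fun j _ => by ring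
  rw [← hsum]
  refine ENNReal.toReal_le_of_le_ofReal (Finset.sum_nonneg fun j _ => hterm j) ?_
  calc volume K ≤ volume (⋃ j ∈ Finset.range (2*m), T j) := measure_mono hcov
    _ ≤ ∑ j ∈ Finset.range (2*m), volume (T j) := measure_biUnion_finset_le _ _
    _ ≤ ∑ j ∈ Finset.range (2*m), ENNReal.ofReal (h j * (h (j+1) + h (j-1) - 2 * h j * cos δ) / (2 * sin δ)) :=
        Finset.sum_le_sum fun j _ => hT1 j
    _ = _ := (ENNReal.ofReal_sum_of_nonneg fun (j : ℕ) _ => hterm j).symm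

noncomputable def hwu (t : ℝ) : EuclideanSpace ℝ (Fin 2) := !₂[cos t, sin t]

noncomputable def hwg (K : Set (EuclideanSpace ℝ (Fin 2))) (t : ℝ) : EuclideanSpace ℝ (Fin 2) :=
  (gauge K (hwu t))⁻¹ • hwu t

lemma hwu_norm (t : ℝ) : ‖hwu t‖ = 1 := by
  have : ‖hwu t‖ ^ 2 = 1 ^ 2 := by
    rw [hw_normsq]; simp [hwu]
  exact (sq_eq_sq₀ (norm_nonneg _) (by norm_num)).1 this

lemma hwu_ne (t : ℝ) : hwu t ≠ 0 := by
  intro h; have := hwu_norm t; rw [h, norm_zero] at this; norm_num at this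

lemma hwu_dist (s t : ℝ) : ‖hwu s - hwu t‖ ≤ 2 * |s - t| := by
  have hc : |cos s - cos t| ≤ |s - t| := abs_cos_sub_cos_le s t
  have hs : |sin s - sin t| ≤ |s - t| := abs_sin_sub_sin_le s t
  refine (pow_le_pow_iff_left₀ (norm_nonneg _) (by positivity) two_ne_zero).1 ?_
  rw [hw_normsq]
  simp only [hwu, PiLp.sub_apply]
  simp
  rw [← sq_abs (cos s - cos t), ← sq_abs (sin s - sin t)]
  have h3 := abs_nonneg (s-t)
  have h1 := pow_le_pow_left₀ (abs_nonneg _) hc 2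
  have h2 := pow_le_pow_left₀ (abs_nonneg _) hs 2
  nlinarith

lemma hwu_cont : Continuous hwu := by
  rw [Metric.continuous_iff]
  intro b ε hε
  refine ⟨ε/2, by positivity, fun a ha => ?_⟩
  rw [dist_eq_norm]; rw [Real.dist_eq] at ha
  have := hwu_dist a b
  linarith

lemma hw_polar (x : EuclideanSpace ℝ (Fin 2)) :
    ∃ t ∈ Set.Ico (0:ℝ) (2 * π), x = ‖x‖ • hwu t := by
  set z : ℂ := ⟨x 0, x 1⟩ with hz
  have hn : ‖z‖ = ‖x‖ := by
    apply (sq_eq_sq₀ (norm_nonneg _) (norm_nonneg _)).1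
    rw [hw_normsq, Complex.sq_norm, Complex.normSq_apply]; simp [hz]; ring
  have key : x = ‖x‖ • hwu z.arg := by
    have h1 := Complex.norm_mul_cos_arg z
    have h2 := Complex.norm_mul_sin_arg z
    rw [hn] at h1 h2
    ext i
    fin_cases i
    · simpa [hwu] using h1.symm
    · simpa [hwu] using h2.symm
  have hu : ∀ t, hwu (t + 2 * π) = hwu t := by intro t; simp [hwu]
  rcases lt_or_ge z.arg 0 with h | h
  · refine ⟨z.arg + 2 * π, ⟨?_, by linarith⟩, by rw [hu]; exact key⟩
    have := Complex.neg_pi_lt_arg z; linarith [pi_pos]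
  · exact ⟨z.arg, ⟨h, by linarith [Complex.arg_le_pi z, pi_pos]⟩, key⟩

lemma hw_gauge_pos {K : Set (EuclideanSpace ℝ (Fin 2))} (hK : IsCompact K) (h0 : (0 : EuclideanSpace ℝ (Fin 2)) ∈ interior K)
    {x : EuclideanSpace ℝ (Fin 2)} (hx : x ≠ 0) : 0 < gauge K x := by
  refine (gauge_pos ?_ ?_).2 hx
  · exact absorbent_nhds_zero (mem_interior_iff_mem_nhds.1 h0)
  · exact NormedSpace.isVonNBounded_of_isBounded _ hK.isBounded

lemma hwg_cont {K : Set (EuclideanSpace ℝ (Fin 2))} (hK : IsCompact K) (hc : Convex ℝ K) (h0 : (0 : EuclideanSpace ℝ (Fin 2)) ∈ interior K)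
    : Continuous (hwg K) := by
  unfold hwg
  have h1 : Continuous fun t => gauge K (hwu t) :=
    (continuous_gauge hc (mem_interior_iff_mem_nhds.1 h0)).comp hwu_cont
  exact (h1.inv₀ fun t => (hw_gauge_pos hK h0 (hwu_ne t)).ne').smul hwu_cont

lemma hwg_front {K : Set (EuclideanSpace ℝ (Fin 2))} (hK : IsCompact K) (hc : Convex ℝ K) (h0 : (0 : EuclideanSpace ℝ (Fin 2)) ∈ interior K)
    (t : ℝ) : hwg K t ∈ frontier K := by
  rw [← gauge_eq_one_iff_mem_frontier hc (mem_interior_iff_mem_nhds.1 h0)]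
  have := hw_gauge_pos hK h0 (hwu_ne t)
  unfold hwg
  rw [gauge_smul_of_nonneg (by positivity), smul_eq_mul, inv_mul_cancel₀ this.ne']

lemma hwg_ray {K : Set (EuclideanSpace ℝ (Fin 2))} (hK : IsCompact K) (h0 : (0 : EuclideanSpace ℝ (Fin 2)) ∈ interior K)
    {x : EuclideanSpace ℝ (Fin 2)} (hx : x ≠ 0) :
    ∃ t ∈ Set.Ico (0:ℝ) (2 * π), x = gauge K x • hwg K t := by
  obtain ⟨t, ht, e⟩ := hw_polar x
  refine ⟨t, ht, ?_⟩
  have := hw_gauge_pos hK h0 (hwu_ne t)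
  unfold hwg
  conv_rhs => rw [e]
  rw [gauge_smul_of_nonneg (norm_nonneg _), smul_smul, smul_eq_mul, mul_assoc, mul_inv_cancel₀ this.ne', mul_one]
  exact e

lemma hwg_inj {K : Set (EuclideanSpace ℝ (Fin 2))} (hK : IsCompact K) (h0 : (0 : EuclideanSpace ℝ (Fin 2)) ∈ interior K)
    : Set.InjOn (hwg K) (Set.Ico 0 (2 * π)) := by
  intro s hs t ht e
  have ps := hw_gauge_pos hK h0 (hwu_ne s)
  have pt := hw_gauge_pos hK h0 (hwu_ne t)
  unfold hwg at e
  have e1 := congrArg norm e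
  rw [norm_smul, norm_smul, hwu_norm, hwu_norm, mul_one, mul_one, norm_inv, norm_inv,
    Real.norm_of_nonneg ps.le, Real.norm_of_nonneg pt.le] at e1
  rw [e1] at e
  have e2 := smul_right_injective _ (inv_ne_zero pt.ne') e
  have c1 : cos s = cos t := by simpa [hwu] using congrArg (fun x => x 0) e2
  have c2 : sin s = sin t := by simpa [hwu] using congrArg (fun x => x 1) e2
  have c3 : cos (s - t) = 1 := by
    rw [cos_sub, c1, c2]; nlinarith [sin_sq_add_cos_sq t]
  have := (cos_eq_one_iff_of_lt_of_lt (by linarith [hs.1, ht.2]) (by linarith [hs.2, ht.1])).1 c3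
  linarith

lemma hw_perim_finite {K : Set (EuclideanSpace ℝ (Fin 2))} (hK : IsCompact K) (hc : Convex ℝ K) (h0 : (0 : EuclideanSpace ℝ (Fin 2)) ∈ interior K)
    : μH[1] (frontier K) < ⊤ := by
  obtain ⟨C, hC⟩ := hc.lipschitz_gauge (mem_interior_iff_mem_nhds.1 h0)
  obtain ⟨M, hM⟩ := hK.isBounded.exists_norm_le
  have hinv : ∀ t, (gauge K (hwu t))⁻¹ ≤ M := by
    intro t
    have p := hw_gauge_pos hK h0 (hwu_ne t)
    have h1 := hM _ (hK.isClosed.frontier_subset (hwg_front hK hc h0 t))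
    unfold hwg at h1
    rwa [norm_smul, hwu_norm, mul_one, norm_inv, Real.norm_of_nonneg p.le] at h1
  have hM0 : 0 ≤ M := (norm_nonneg _).trans (hM 0 (interior_subset h0))
  have hlip : LipschitzWith (Real.toNNReal (M * M * C * 2 + M * 2)) (hwg K) := by
    apply LipschitzWith.of_dist_le_mul
    intro s t
    rw [Real.coe_toNNReal _ (by positivity), dist_eq_norm, Real.dist_eq]
    have ps := hw_gauge_pos hK h0 (hwu_ne s)
    have pt := hw_gauge_pos hK h0 (hwu_ne t)
    have e : hwg K s - hwg K t = ((gauge K (hwu s))⁻¹ - (gauge K (hwu t))⁻¹) • hwu s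
        + (gauge K (hwu t))⁻¹ • (hwu s - hwu t) := by
      unfold hwg; module
    have e2 : (gauge K (hwu s))⁻¹ - (gauge K (hwu t))⁻¹ =
       (gauge K (hwu s))⁻¹ * (gauge K (hwu t))⁻¹ * (gauge K (hwu t) - gauge K (hwu s)) := by
      field_simp
    have h3 := hC.dist_le_mul (hwu t) (hwu s)
    rw [Real.dist_eq, dist_eq_norm, norm_sub_rev] at h3
    have h4 := hwu_dist s t
    rw [e]
    refine (norm_add_le _ _).trans ?_
    rw [norm_smul, norm_smul, hwu_norm, mul_one, e2, norm_mul, norm_mul, norm_inv, norm_inv,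
      Real.norm_of_nonneg ps.le, Real.norm_of_nonneg pt.le, Real.norm_eq_abs]
    calc _ ≤ M * M * (C * (2 * |s - t|)) + M * (2 * |s - t|) := by
            gcongr
            · exact hinv s
            · exact hinv t
            · exact h3.trans (by gcongr)
            · exact hinv t
      _ = _ := by ring
  have hsub : frontier K ⊆ hwg K '' Set.Icc 0 (2 * π) := by
    intro x hx
    have hg := (gauge_eq_one_iff_mem_frontier hc (mem_interior_iff_mem_nhds.1 h0)).2 hx
    have hx0 : x ≠ 0 := by rintro rfl; simp at hg
    obtain ⟨t, ht, e⟩ := hwg_ray hK h0 hx0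
    rw [hg, one_smul] at e
    exact ⟨t, ⟨ht.1, ht.2.le⟩, e.symm⟩
  refine (measure_mono hsub).trans_lt ?_
  refine (hlip.hausdorffMeasure_image_le zero_le_one _).trans_lt ?_
  rw [hausdorffMeasure_real, Real.volume_Icc]
  exact ENNReal.mul_lt_top (by simp) ENNReal.ofReal_lt_top

lemma hw_chord {K : Set (EuclideanSpace ℝ (Fin 2))} (hK : IsCompact K) (hc : Convex ℝ K) (h0 : (0 : EuclideanSpace ℝ (Fin 2)) ∈ interior K)
    (a b : ℝ) (hab : a ≤ b) :
    ENNReal.ofReal (dist (hwg K b) (hwg K a)) ≤ μH[1] (hwg K '' Set.Ico a b) := by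
  have hL : LipschitzWith 1 (fun x : EuclideanSpace ℝ (Fin 2) => dist x (hwg K a)) :=
    LipschitzWith.dist_left _
  have h1 := hL.hausdorffMeasure_image_le zero_le_one (hwg K '' Set.Ico a b)
  simp only [ENNReal.coe_one, ENNReal.one_rpow, one_mul] at h1
  refine le_trans ?_ h1
  rw [hausdorffMeasure_real]
  have hcont : ContinuousOn (fun t => dist (hwg K t) (hwg K a)) (Set.Icc a b) :=
    ((hwg_cont hK hc h0).dist continuous_const).continuousOn
  have h2 := intermediate_value_Ico hab hcont
  simp only [dist_self] at h2
  have h3 : Set.Ico 0 (dist (hwg K b) (hwg K a)) ⊆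
      (fun x => dist x (hwg K a)) '' (hwg K '' Set.Ico a b) := by
    rw [Set.image_image]; exact h2
  have := measure_mono (μ := volume) h3
  rwa [Real.volume_Ico, sub_zero] at this

lemma hw_chords {K : Set (EuclideanSpace ℝ (Fin 2))} (hK : IsCompact K) (hc : Convex ℝ K) (h0 : (0 : EuclideanSpace ℝ (Fin 2)) ∈ interior K)
    (N : ℕ) (hN : 0 < N) :
    ∑ i ∈ Finset.range N, dist (hwg K (2 * π * (i + 1 : ℕ) / N)) (hwg K (2 * π * (i:ℕ) / N))
      ≤ (μH[1] (frontier K)).toReal := by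
  have hNr : (0:ℝ) < N := by exact_mod_cast hN
  set τ : ℕ → ℝ := fun i => 2 * π * i / N with hτ
  have hmono : Monotone τ := by
    intro i j hij
    have : (i:ℝ) ≤ j := by exact_mod_cast hij
    simp only [hτ]
    have := pi_pos
    gcongr
  have hsubI : ∀ i < N, Set.Ico (τ i) (τ (i+1)) ⊆ Set.Ico 0 (2 * π) := by
    intro i hi
    apply Set.Ico_subset_Ico
    · have := pi_pos; simp only [hτ]; positivity
    · have := hmono (show i + 1 ≤ N by omega)
      refine this.trans (le_of_eq ?_)
      simp only [hτ]; field_simp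
  have hdisj : (Finset.range N : Set ℕ).PairwiseDisjoint (fun i => hwg K '' Set.Ico (τ i) (τ (i+1))) := by
    intro i hi j hj hij
    have hi' := Finset.mem_range.1 hi
    have hj' := Finset.mem_range.1 hj
    have hd : Disjoint (Set.Ico (τ i) (τ (i+1))) (Set.Ico (τ j) (τ (j+1))) :=
      hmono.pairwise_disjoint_on_Ico_succ hij
    refine Set.disjoint_left.2 ?_
    rintro _ ⟨s, hs, rfl⟩ ⟨t, ht, e⟩
    have := hwg_inj hK h0 (hsubI j hj' ht) (hsubI i hi' hs) e
    subst this
    exact Set.disjoint_left.1 hd hs ht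
  have hmeas : ∀ i ∈ Finset.range N, MeasurableSet (hwg K '' Set.Ico (τ i) (τ (i+1))) := by
    intro i hi
    exact measurableSet_Ico.image_of_continuousOn_injOn (hwg_cont hK hc h0).continuousOn
      ((hwg_inj hK h0).mono (hsubI i (Finset.mem_range.1 hi)))
  have h1 := measure_biUnion_finset (μ := μH[1]) hdisj hmeas
  have h2 : μH[1] (⋃ i ∈ Finset.range N, hwg K '' Set.Ico (τ i) (τ (i+1))) ≤ μH[1] (frontier K) := by
    apply measure_mono
    refine Set.iUnion₂_subset fun i _ => ?_
    rintro _ ⟨t, -, rfl⟩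
    exact hwg_front hK hc h0 t
  rw [← ENNReal.ofReal_le_iff_le_toReal (hw_perim_finite hK hc h0).ne]
  rw [ENNReal.ofReal_sum_of_nonneg fun i _ => dist_nonneg]
  refine le_trans ?_ h2
  rw [h1]
  exact Finset.sum_le_sum fun i _ => hw_chord hK hc h0 _ _ (hmono (Nat.le_succ i))


lemma hw_closed_path (a : ℕ → ℝ) (N : ℕ) (ha : a N = a 0) (i j : ℕ) (hi : i ≤ N) (hj : j ≤ N) :
    2 * (a i - a j) ≤ ∑ l ∈ Finset.range N, |a (l+1) - a l| := by
  have main : ∀ i j, i ≤ j → j ≤ N → 2 * |a i - a j| ≤ ∑ l ∈ Finset.range N, |a (l+1) - a l| := by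
    intro i j hij hj
    have key : ∀ i j, i ≤ j → |a i - a j| ≤ ∑ l ∈ Finset.Ico i j, |a (l+1) - a l| := by
      intro i j hij
      have := dist_le_Ico_sum_dist a hij
      simp only [Real.dist_eq] at this
      refine this.trans (le_of_eq (Finset.sum_congr rfl fun l _ => abs_sub_comm _ _))
    rw [Finset.range_eq_Ico, ← Finset.sum_Ico_consecutive _ (Nat.zero_le i) (hij.trans hj),
      ← Finset.sum_Ico_consecutive _ hij hj]
    have k1 := key 0 i (Nat.zero_le _)
    have k2 := key i j hij
    have k3 := key j N hj
    rw [ha] at k3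
    have : |a i - a j| ≤ |a 0 - a i| + |a j - a 0| := by
      have := abs_sub_le (a i) (a 0) (a j)
      rw [abs_sub_comm (a i) (a 0), abs_sub_comm (a 0) (a j)] at this
      exact this
    linarith
  have hle := le_abs_self (a i - a j)
  rcases le_total i j with h | h
  · linarith [main i j h hj]
  · have := main j i h hi
    rw [abs_sub_comm] at this; linarith

lemma hw_cos_sum (m : ℕ) (δ : ℝ) (hδ : 0 < δ) (hδ2 : δ < 2 * π) (hm : m * δ = π)
    (x : EuclideanSpace ℝ (Fin 2)) :
    ∑ j ∈ Finset.range m, |hwd (j * δ) x| ≤ ‖x‖ / sin (δ/2) := by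
  have hs : 0 < sin (δ/2) := sin_pos_of_pos_of_lt_pi (by linarith) (by linarith)
  rcases eq_or_ne x 0 with rfl | hx
  · simp [hwd_zero]
  obtain ⟨φ, -, e⟩ := hw_polar x
  have e1 : ∀ j : ℕ, |hwd (j * δ) x| = ‖x‖ * |cos (j * δ - φ)| := by
    intro j
    have : hwd (j * δ) x = ‖x‖ * cos (j * δ - φ) := by
      have a0 : x 0 = ‖x‖ * cos φ := by simpa [hwu] using congrArg (fun y => y 0) e
      have a1 : x 1 = ‖x‖ * sin φ := by simpa [hwu] using congrArg (fun y => y 1) e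
      unfold hwd
      rw [a0, a1, cos_sub]; ring
    rw [this, abs_mul, abs_of_nonneg (norm_nonneg x)]
  simp only [e1]
  rw [← Finset.mul_sum, div_eq_mul_one_div]
  refine mul_le_mul_of_nonneg_left ?_ (norm_nonneg _)
  rw [le_div_iff₀ hs]
  set a : ℕ → ℝ := fun j => j * δ - φ - δ/2 with ha
  have hIntg : ∀ u v : ℝ, IntervalIntegrable (fun y => |cos y|) volume u v := fun u v =>
    Continuous.intervalIntegrable (by fun_prop) _ _
  have h1 : ∀ j : ℕ, 2 * (|cos (j * δ - φ)| * sin (δ/2)) ≤ ∫ y in (a j)..(a (j+1)), |cos y| := by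
    intro j
    have hle : a j ≤ a (j+1) := by simp only [ha]; push_cast; linarith
    have := intervalIntegral.abs_integral_le_integral_abs (f := cos) (μ := volume) hle
    refine le_trans (le_of_eq ?_) this
    rw [integral_cos]
    have e2 : a (j+1) = (j * δ - φ) + δ/2 := by simp only [ha]; push_cast; ring
    have e3 : a j = (j * δ - φ) - δ/2 := rfl
    rw [e2, e3, sin_add (j * δ - φ) (δ/2), sin_sub (j * δ - φ) (δ/2)]
    rw [show sin (j * δ - φ) * cos (δ / 2) + cos (j * δ - φ) * sin (δ / 2) - (sin (j * δ - φ) * cos (δ / 2) - cos (j * δ - φ) * sin (δ / 2)) = 2 * (cos (j * δ - φ) * sin (δ/2)) by ring,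
      abs_mul, abs_mul, abs_of_pos hs, abs_of_pos (show (0:ℝ) < 2 by norm_num)]
  have h2 := intervalIntegral.sum_integral_adjacent_intervals (f := fun y => |cos y|) (μ := volume)
    (a := a) (n := m) (fun k _ => hIntg _ _)
  have h3 : a m = a 0 + π := by simp only [ha]; push_cast; linarith
  have hp : Function.Periodic (fun y => |cos y|) π := by
    intro y; simp only [cos_add_pi, abs_neg]
  have h4 : ∫ y in (a 0)..(a 0 + π), |cos y| = 2 := by
    rw [hp.intervalIntegral_add_eq (a 0) (-(π/2))]
    have : ∫ y in (-(π/2))..(-(π/2) + π), |cos y| = ∫ y in (-(π/2))..(-(π/2) + π), cos y := by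
      apply intervalIntegral.integral_congr
      intro y hy
      rw [Set.uIcc_of_le (by linarith [pi_pos])] at hy
      simp only
      exact abs_of_nonneg (cos_nonneg_of_mem_Icc ⟨hy.1, by linarith [hy.2]⟩)
    rw [this, integral_cos, show -(π/2) + π = π/2 by ring, sin_neg, sin_pi_div_two]; norm_num
  rw [h3, h4] at h2
  have h5 := Finset.sum_le_sum (fun j (_ : j ∈ Finset.range m) => h1 j)
  rw [h2, ← Finset.mul_sum, ← Finset.sum_mul] at h5
  linarith

lemma hwd_sub_vec (t : ℝ) (x y : EuclideanSpace ℝ (Fin 2)) : hwd t (x - y) = hwd t x - hwd t y := by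
  simp [hwd]; ring

lemma hw_perim {K : Set (EuclideanSpace ℝ (Fin 2))} (hK : IsCompact K) (hc : Convex ℝ K)
    (h0 : (0 : EuclideanSpace ℝ (Fin 2)) ∈ interior K) (m : ℕ) (δ : ℝ) (hm2 : 2 ≤ m)
    (hm : m * δ = π) :
    ∑ j ∈ Finset.range (2*m), hwH K (j * δ) ≤ (μH[1] (frontier K)).toReal / (2 * sin (δ/2)) := by
  have hm2' : (2:ℝ) ≤ m := by exact_mod_cast hm2
  have hδ : 0 < δ := by
    by_contra h; push Not at h
    have := pi_pos
    nlinarith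
  have hδ2 : δ < π := by nlinarith
  have hs : 0 < sin (δ/2) := sin_pos_of_pos_of_lt_pi (by linarith) (by linarith)
  have hne : K.Nonempty := ⟨0, interior_subset h0⟩
  -- every support number nearly attained on the curve
  have hatt : ∀ t : ℝ, ∃ s ∈ Set.Ico (0:ℝ) (2*π), hwH K t ≤ hwd t (hwg K s) := by
    intro t
    obtain ⟨x, hx, e⟩ := hwH_attain hK hne t
    have hp := hwH_pos hK h0 t
    have hx0 : x ≠ 0 := by rintro rfl; rw [hwd_zero] at e; linarith
    obtain ⟨s, hs, e2⟩ := hwg_ray hK h0 hx0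
    refine ⟨s, hs, ?_⟩
    have hg1 : gauge K x ≤ 1 := gauge_le_one_of_mem hx
    have hg0 := hw_gauge_pos hK h0 hx0
    have e3 : hwd t x = gauge K x * hwd t (hwg K s) := by
      conv_lhs => rw [e2]
      simp [hwd]; ring
    rw [← e]
    have : 0 < hwd t (hwg K s) := by
      by_contra hcon; push Not at hcon
      nlinarith
    nlinarith
  apply le_of_forall_pos_le_add
  intro ε hε
  set ε' := ε / (2 * m) with hε'
  have hε'0 : 0 < ε' := by positivity
  have hu : UniformContinuousOn (hwg K) (Set.Icc 0 (2*π)) :=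
    isCompact_Icc.uniformContinuousOn_of_continuous (hwg_cont hK hc h0).continuousOn
  obtain ⟨η, hη, hηc⟩ := Metric.uniformContinuousOn_iff.1 hu ε' hε'0
  obtain ⟨N, hN⟩ := exists_nat_gt (2 * π / η)
  have hNr : (0:ℝ) < N := lt_trans (by positivity) hN
  have hN0 : 0 < N := by exact_mod_cast hNr
  set τ : ℕ → ℝ := fun i => 2 * π * i / N with hτ
  have hpt : ∀ t : ℝ, ∃ i ≤ N, hwH K t ≤ hwd t (hwg K (τ i)) + ε' := by
    intro t
    obtain ⟨s, hs, h1⟩ := hatt t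
    have hq : 0 ≤ s * N / (2 * π) := by have := hs.1; positivity
    set i := ⌊s * N / (2 * π)⌋₊ with hi
    have f1 : (i:ℝ) ≤ s * N / (2 * π) := Nat.floor_le hq
    have f2 : s * N / (2 * π) < i + 1 := Nat.lt_floor_add_one _
    rw [le_div_iff₀ (by positivity)] at f1
    rw [div_lt_iff₀ (by positivity)] at f2
    have g1 : τ i ≤ s := by
      simp only [hτ]; rw [div_le_iff₀ hNr]; linarith
    have g2 : s - τ i < η := by
      have : s - τ i ≤ 2 * π / N := by
        simp only [hτ]; rw [sub_le_iff_le_add, ← add_div, le_div_iff₀ hNr]; linarith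
      refine this.trans_lt ?_
      rw [div_lt_iff₀ hNr]
      rw [div_lt_iff₀ hη] at hN; linarith
    have g0 : 0 ≤ τ i := by simp only [hτ]; positivity
    have hiN : i ≤ N := by
      have h3 := hs.2
      have : (i:ℝ) < N := by
        by_contra hcon; push Not at hcon
        have : (N:ℝ) * (2*π) ≤ i * (2*π) := by gcongr
        nlinarith
      exact_mod_cast this.le
    refine ⟨i, hiN, ?_⟩
    have hd := hηc s ⟨hs.1, hs.2.le⟩ (τ i) ⟨g0, by linarith [hs.2]⟩ (by
      rw [Real.dist_eq, abs_of_nonneg (by linarith)]; exact g2)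
    have hab := (le_abs_self _).trans (hwd_abs_le t (hwg K s - hwg K (τ i)))
    rw [hwd_sub_vec] at hab
    rw [dist_eq_norm] at hd
    linarith
  have hclose : hwg K (τ N) = hwg K (τ 0) := by
    have e1 : τ N = 2 * π := by simp only [hτ]; field_simp
    have e2 : τ 0 = 0 := by simp [hτ]
    rw [e1, e2]; simp [hwg, hwu]
  have hw : ∀ j : ℕ, hwH K (j * δ) + hwH K ((j + m : ℕ) * δ) ≤
      1/2 * ∑ l ∈ Finset.range N, |hwd (j * δ) (hwg K (τ (l+1)) - hwg K (τ l))| + 2 * ε' := by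
    intro j
    obtain ⟨i, hi, h1⟩ := hpt (j * δ)
    obtain ⟨i', hi', h2⟩ := hpt ((j + m : ℕ) * δ)
    have e : ∀ x, hwd ((j + m : ℕ) * δ) x = - hwd (j * δ) x := by
      intro x
      push_cast
      rw [add_mul, hm]
      unfold hwd; rw [cos_add_pi, sin_add_pi]; ring
    rw [e] at h2
    have := hw_closed_path (fun l => hwd (j * δ) (hwg K (τ l))) N (by simp only [hclose]) i i' hi hi'
    simp only [hwd_sub_vec]
    linarith
  have hsplit : ∑ j ∈ Finset.range (2*m), hwH K (j * δ)
      = ∑ j ∈ Finset.range m, (hwH K (j * δ) + hwH K ((j + m : ℕ) * δ)) := by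
    rw [two_mul, Finset.sum_range_add, Finset.sum_add_distrib]
    congr 1
    exact Finset.sum_congr rfl fun j _ => by rw [add_comm]
  rw [hsplit]
  refine (Finset.sum_le_sum fun j _ => hw j).trans ?_
  rw [Finset.sum_add_distrib, ← Finset.mul_sum, Finset.sum_comm]
  have hch := hw_chords hK hc h0 N hN0
  have h6 : ∑ l ∈ Finset.range N, ∑ j ∈ Finset.range m, |hwd (j * δ) (hwg K (τ (l+1)) - hwg K (τ l))|
      ≤ (μH[1] (frontier K)).toReal / sin (δ/2) := by
    calc _ ≤ ∑ l ∈ Finset.range N, ‖hwg K (τ (l+1)) - hwg K (τ l)‖ / sin (δ/2) :=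
          Finset.sum_le_sum fun l _ => hw_cos_sum m δ hδ (by linarith) hm _
      _ = (∑ l ∈ Finset.range N, dist (hwg K (τ (l+1))) (hwg K (τ l))) / sin (δ/2) := by
          rw [Finset.sum_div]; simp only [dist_eq_norm]
      _ ≤ _ := by gcongr
  have h7 : ∑ _j ∈ Finset.range m, 2 * ε' = ε := by
    rw [Finset.sum_const, Finset.card_range, nsmul_eq_mul, hε']; field_simp
  rw [h7]
  have h8 : (μH[1] (frontier K)).toReal / (2 * sin (δ/2)) = 1/2 * ((μH[1] (frontier K)).toReal / sin (δ/2)) := by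
    field_simp
  rw [h8]
  linarith

/-- discrete containment -/
def hwC (K L : Set (EuclideanSpace ℝ (Fin 2))) (δ : ℝ) : Prop :=
  ∃ (i : ℤ) (a b : ℝ), ∀ j : ℤ,
    hwH L ((j - i : ℤ) * δ) ≤ hwH K (j * δ) + (a * cos (j * δ) + b * sin (j * δ))

lemma hw_disc {K L : Set (EuclideanSpace ℝ (Fin 2))} (hK : IsCompact K) (hc : Convex ℝ K)
    (h0 : (0 : EuclideanSpace ℝ (Fin 2)) ∈ interior K) (hL : IsCompact L) (lc : Convex ℝ L)
    (l0 : (0 : EuclideanSpace ℝ (Fin 2)) ∈ interior L) (p : ℕ) (hp : 0 < p) (δ : ℝ)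
    (hm : (2 * p : ℕ) * δ = π) (c1 : ¬ hwC K L δ) (c2 : ¬ hwC L K δ) :
    2 * (2 * p : ℕ) * sin δ * (euclArea K + euclArea L) ≤ euclPerim K * euclPerim L := by
  have hp1 : (2:ℝ) ≤ (2 * p : ℕ) := by exact_mod_cast (by omega : 2 ≤ 2 * p)
  have hδ : 0 < δ := by
    by_contra h; push Not at h
    have := pi_pos
    nlinarith
  have hδ2 : δ < π := by nlinarith
  have hs : 0 < sin δ := sin_pos_of_pos_of_lt_pi hδ hδ2
  have hs2 : 0 < sin (δ/2) := sin_pos_of_pos_of_lt_pi (by linarith) (by linarith)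
  set h : ℤ → ℝ := fun j => hwH K (j * δ) with hh
  set k : ℤ → ℝ := fun j => hwH L (j * δ) with hk
  have hper : ∀ j, h (j + (2*(2*p) : ℕ)) = h j := by
    intro j; simp only [hh]; rw [hw_per (2*p) δ hm, hwH_per]
  have kper : ∀ j, k (j + (2*(2*p) : ℕ)) = k j := by
    intro j; simp only [hk]; rw [hw_per (2*p) δ hm, hwH_per]
  have aK := hw_area hK h0 (2*p) δ (by omega) hm
  have aL := hw_area hL l0 (2*p) δ (by omega) hm
  have pK := hw_perim hK hc h0 (2*p) δ (by omega) hm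
  have pL := hw_perim hL lc l0 (2*p) δ (by omega) hm
  have AKpos : 0 < (volume K).toReal := by
    apply ENNReal.toReal_pos _ hK.measure_lt_top.ne
    exact (Measure.measure_pos_of_mem_nhds volume (mem_interior_iff_mem_nhds.1 h0)).ne'
  have ALpos : 0 < (volume L).toReal := by
    apply ENNReal.toReal_pos _ hL.measure_lt_top.ne
    exact (Measure.measure_pos_of_mem_nhds volume (mem_interior_iff_mem_nhds.1 l0)).ne'
  rw [le_div_iff₀ (by positivity)] at aK aL
  have Bk : ∀ i : ℕ, hwB (2*(2*p)) (cos δ) (fun j => k (j - i)) (fun j => k (j - i))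
      = hwB (2*(2*p)) (cos δ) k k := by
    intro i
    have := hw_shift (2*(2*p)) (fun j => k j * k (j+1) + k (j+1) * k j - 2 * cos δ * (k j * k j))
      (by intro j; simp only [kper, add_right_comm j _ 1]) (-i)
    unfold hwB
    rw [← this]
    refine Finset.sum_congr rfl fun j _ => ?_
    have e1 : (j:ℤ) - i = -i + j := by ring
    have e2 : (j:ℤ) + 1 - i = -i + j + 1 := by ring
    beta_reduce
    rw [e1, e2]
  have hbon : ∀ i : ℕ, hwB (2*(2*p)) (cos δ) h h + hwB (2*(2*p)) (cos δ) k k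
      ≤ 2 * hwB (2*(2*p)) (cos δ) h (fun j => k (j - i)) := by
    intro i
    rw [← Bk i]
    refine hw_bonn δ p hp hδ hm h (fun j => k (j - i)) hper ?_ (fun j => (hwH_pos hK h0 _).le)
      (fun j => (hwH_pos hL l0 _).le) (lt_of_lt_of_le (by positivity) aK) ?_ ?_ ?_
    · intro j
      show k _ = k _
      rw [← kper (j - i)]; congr 1; ring
    · rw [Bk]; exact lt_of_lt_of_le (by positivity) aL
    · rintro ⟨a, b, hab⟩
      exact c1 ⟨i, a, b, fun j => hab j⟩
    · rintro ⟨a, b, hab⟩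
      refine c2 ⟨-i, a * cos (i * δ) + b * sin (i * δ), - a * sin (i * δ) + b * cos (i * δ), fun j => ?_⟩
      have := hab (j + i)
      simp only [hh, hk, add_sub_cancel_right] at this
      rw [sub_neg_eq_add]
      refine this.trans (le_of_eq ?_)
      push_cast
      rw [add_mul, cos_add, sin_add]; ring
  have hsum := Finset.sum_le_sum (fun i (_ : i ∈ Finset.range (2*(2*p))) => hbon i)
  rw [← Finset.mul_sum, hw_avg δ (2*p) h k hper kper, Finset.sum_const, Finset.card_range,
    nsmul_eq_mul] at hsum
  have hcos : 1 - cos δ = 2 * sin (δ/2) ^ 2 := by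
    have := cos_two_mul (δ/2)
    rw [show 2 * (δ/2) = δ by ring] at this
    nlinarith [sin_sq_add_cos_sq (δ/2)]
  rw [hcos] at hsum
  have hnn : ∀ M : Set (EuclideanSpace ℝ (Fin 2)), 0 ≤ (μH[1] (frontier M)).toReal := fun M => ENNReal.toReal_nonneg
  have hk0 : 0 ≤ ∑ j ∈ Finset.range (2*(2*p)), k j :=
    Finset.sum_nonneg fun j _ => (hwH_pos hL l0 _).le
  have hprod : (∑ j ∈ Finset.range (2*(2*p)), h j) * (∑ j ∈ Finset.range (2*(2*p)), k j)
     ≤ (μH[1] (frontier K)).toReal / (2 * sin (δ/2)) * ((μH[1] (frontier L)).toReal / (2 * sin (δ/2))) := by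
    refine mul_le_mul ?_ ?_ hk0 (div_nonneg (hnn K) (by positivity))
    · simpa [hh] using pK
    · simpa [hk] using pL
  have e : (μH[1] (frontier K)).toReal / (2 * sin (δ/2)) * ((μH[1] (frontier L)).toReal / (2 * sin (δ/2)))
     = euclPerim K * euclPerim L / (4 * sin (δ/2)^2) := by
    unfold euclPerim; field_simp; ring
  rw [e, le_div_iff₀ (by positivity)] at hprod
  have hA : euclArea K * (2 * sin δ) + euclArea L * (2 * sin δ) ≤
      hwB (2*(2*p)) (cos δ) h h + hwB (2*(2*p)) (cos δ) k k := add_le_add aK aL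
  have hA2 := mul_le_mul_of_nonneg_left hA (show (0:ℝ) ≤ ((2*(2*p) : ℕ):ℝ) by positivity)
  push_cast at *
  nlinarith

lemma hw_mem {K : Set (EuclideanSpace ℝ (Fin 2))} (hK : IsCompact K) (hc : Convex ℝ K)
    (hn : K.Nonempty) (y : EuclideanSpace ℝ (Fin 2)) (hy : ∀ t, hwd t y ≤ hwH K t) : y ∈ K := by
  by_contra hcon
  obtain ⟨f, u, h1, h2⟩ := geometric_hahn_banach_closed_point hc hK.isClosed hcon
  set w : EuclideanSpace ℝ (Fin 2) := !₂[f (EuclideanSpace.single 0 1), f (EuclideanSpace.single 1 1)] with hw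
  obtain ⟨t, -, e⟩ := hw_polar w
  have hf : ∀ x, f x = ‖w‖ * hwd t x := by
    intro x
    have hx : x = x 0 • EuclideanSpace.single 0 1 + x 1 • EuclideanSpace.single 1 1 := by
      ext i; fin_cases i <;> simp
    have a0 : f (EuclideanSpace.single 0 1) = ‖w‖ * cos t := by
      have := congrArg (fun z => z 0) e
      simpa [hwu, hw] using this
    have a1 : f (EuclideanSpace.single 1 1) = ‖w‖ * sin t := by
      have := congrArg (fun z => z 1) e
      simpa [hwu, hw] using this
    conv_lhs => rw [hx]
    rw [map_add, map_smul, map_smul, a0, a1, smul_eq_mul, smul_eq_mul]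
    unfold hwd; ring
  obtain ⟨x, hx, ex⟩ := hwH_attain hK hn t
  have h3 := h1 x hx
  rw [hf, ex] at h3
  rw [hf] at h2
  have := mul_le_mul_of_nonneg_left (hy t) (norm_nonneg w)
  linarith

lemma hwH_lip {K : Set (EuclideanSpace ℝ (Fin 2))} (hK : IsCompact K) (hn : K.Nonempty) {M : ℝ}
    (hM : ∀ x ∈ K, ‖x‖ ≤ M) (s t : ℝ) : hwH K s ≤ hwH K t + 2 * M * |s - t| := by
  obtain ⟨x, hx, ex⟩ := hwH_attain hK hn s
  have h1 := (le_abs_self _).trans (hwd_sub_le s t x)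
  have h2 := hwd_le hK t hx
  have h3 : 2 * ‖x‖ * |s - t| ≤ 2 * M * |s - t| := by gcongr; exact hM x hx
  linarith

lemma hw_limit {K L : Set (EuclideanSpace ℝ (Fin 2))} (hK : IsCompact K) (hc : Convex ℝ K)
    (h0 : (0 : EuclideanSpace ℝ (Fin 2)) ∈ interior K) (hL : IsCompact L)
    (l0 : (0 : EuclideanSpace ℝ (Fin 2)) ∈ interior L)
    (hf : ∃ᶠ p : ℕ in Filter.atTop, 0 < p ∧ hwC K L (π / (2 * p : ℕ))) :
    ∃ (θ : ℝ) (v : EuclideanSpace ℝ (Fin 2)), (fun q => v + rot θ q) '' L ⊆ K := by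
  obtain ⟨φ, hφ, hφC⟩ := Filter.extraction_of_frequently_atTop hf
  have hne : K.Nonempty := ⟨0, interior_subset h0⟩
  obtain ⟨M, hM⟩ := hK.isBounded.exists_norm_le
  set δ : ℕ → ℝ := fun n => π / (2 * φ n : ℕ) with hδ
  have hφpos : ∀ n, (0:ℝ) < φ n := fun n => by exact_mod_cast (hφC n).1
  have hδpos : ∀ n, 0 < δ n := fun n => by
    have := hφpos n; have := pi_pos; simp only [hδ]; push_cast; positivity
  have hδlim : Filter.Tendsto δ Filter.atTop (nhds 0) := by
    have h1 : Filter.Tendsto (fun n : ℕ => ((2 * φ n : ℕ) : ℝ)) Filter.atTop Filter.atTop := by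
      refine tendsto_natCast_atTop_atTop.comp ?_
      refine Filter.tendsto_atTop_mono (fun n => ?_) hφ.tendsto_atTop
      omega
    exact h1.const_div_atTop π
  choose i a b hab using fun n => (hφC n).2
  have hab : ∀ n (j : ℤ), hwH L ((j - i n : ℤ) * δ n) ≤ hwH K (j * δ n) + (a n * cos (j * δ n) + b n * sin (j * δ n)) := hab
  have hHM : ∀ t, hwH K t ≤ M := by
    intro t
    obtain ⟨x, hx, e⟩ := hwH_attain hK hne t
    rw [← e]; exact (le_abs_self _).trans ((hwd_abs_le t x).trans (hM x hx))
  have hbox : ∀ n, (cos (i n * δ n), sin (i n * δ n), a n, b n) ∈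
      Set.Icc (-1:ℝ) 1 ×ˢ (Set.Icc (-1:ℝ) 1 ×ˢ (Set.Icc (-M) M ×ˢ Set.Icc (-M) M)) := by
    intro n
    have q : ∀ j : ℤ, 0 ≤ M + (a n * cos (j * δ n) + b n * sin (j * δ n)) := fun j => by
      have h1 := hab n j
      have h2 := (hwH_pos hL l0 ((j - i n : ℤ) * δ n))
      have h3 := hHM (j * δ n)
      linarith
    have hpd : (φ n : ℝ) * δ n = π / 2 := by
      have := hφpos n
      simp only [hδ]; push_cast; field_simp
    have t1 := q 0
    have t2 := q (2 * φ n)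
    have t3 := q (φ n)
    have t4 := q (- φ n)
    have e2 : ((2 * φ n : ℤ) : ℝ) * δ n = π := by push_cast; linarith
    have e4 : ((- φ n : ℤ) : ℝ) * δ n = -(π/2) := by push_cast; linarith
    rw [e2] at t2
    rw [e4] at t4
    rw [Int.cast_natCast, hpd] at t3
    simp at t1 t2 t3 t4
    exact ⟨⟨neg_one_le_cos _, cos_le_one _⟩, ⟨neg_one_le_sin _, sin_le_one _⟩,
      ⟨by simp only; linarith, by simp only; linarith⟩, by simp only; linarith, by simp only; linarith⟩
  obtain ⟨⟨c, s, α, β⟩, -, ψ, hψ, hlim⟩ := (isCompact_Icc.prod (isCompact_Icc.prod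
    (isCompact_Icc.prod isCompact_Icc))).tendsto_subseq hbox
  have lc : Filter.Tendsto (fun n => cos (i (ψ n) * δ (ψ n))) Filter.atTop (nhds c) :=
    (continuous_fst.tendsto _).comp hlim
  have ls : Filter.Tendsto (fun n => sin (i (ψ n) * δ (ψ n))) Filter.atTop (nhds s) :=
    ((continuous_fst.comp continuous_snd).tendsto _).comp hlim
  have la : Filter.Tendsto (fun n => a (ψ n)) Filter.atTop (nhds α) :=
    ((continuous_fst.comp (continuous_snd.comp continuous_snd)).tendsto _).comp hlim
  have lb : Filter.Tendsto (fun n => b (ψ n)) Filter.atTop (nhds β) :=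
    ((continuous_snd.comp (continuous_snd.comp continuous_snd)).tendsto _).comp hlim
  have hcs : c ^ 2 + s ^ 2 = 1 := by
    have h1 := (lc.pow 2).add (ls.pow 2)
    have h2 : (fun n => cos (i (ψ n) * δ (ψ n)) ^ 2 + sin (i (ψ n) * δ (ψ n)) ^ 2) = fun _ => 1 := by
      funext n; exact cos_sq_add_sin_sq _
    rw [h2] at h1
    exact tendsto_nhds_unique h1 tendsto_const_nhds
  obtain ⟨θ, hθc, hθs⟩ : ∃ θ, c = cos θ ∧ s = sin θ := by
    obtain ⟨θ, -, e⟩ := hw_polar !₂[c, s]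
    have hn : ‖(!₂[c, s] : EuclideanSpace ℝ (Fin 2))‖ = 1 := by
      apply (sq_eq_sq₀ (norm_nonneg _) zero_le_one).1
      rw [hw_normsq]; simpa using hcs
    rw [hn, one_smul] at e
    exact ⟨θ, by simpa [hwu] using congrArg (fun z => z 0) e, by simpa [hwu] using congrArg (fun z => z 1) e⟩
  refine ⟨θ, !₂[-α, -β], ?_⟩
  rintro _ ⟨x, hx, rfl⟩
  refine hw_mem hK hc hne _ fun t => ?_
  set j : ℕ → ℤ := fun n => ⌊t / δ (ψ n)⌋ with hj
  have hδlim' : Filter.Tendsto (fun n => δ (ψ n)) Filter.atTop (nhds 0) :=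
    hδlim.comp hψ.tendsto_atTop
  have hjd : ∀ n, |(j n : ℝ) * δ (ψ n) - t| ≤ δ (ψ n) := by
    intro n
    have h1 := Int.floor_le (t / δ (ψ n))
    have h2 := Int.lt_floor_add_one (t / δ (ψ n))
    rw [le_div_iff₀ (hδpos _)] at h1
    rw [div_lt_iff₀ (hδpos _)] at h2
    rw [abs_le]; constructor <;> simp only [hj] <;> nlinarith
  have hjlim : Filter.Tendsto (fun n => (j n : ℝ) * δ (ψ n)) Filter.atTop (nhds t) := by
    rw [tendsto_iff_dist_tendsto_zero]
    exact squeeze_zero (fun n => dist_nonneg) (fun n => hjd n) hδlim'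
  have hineq : ∀ n, (cos (i (ψ n) * δ (ψ n)) * x 0 - sin (i (ψ n) * δ (ψ n)) * x 1 - a (ψ n)) * cos (j n * δ (ψ n))
      + (sin (i (ψ n) * δ (ψ n)) * x 0 + cos (i (ψ n) * δ (ψ n)) * x 1 - b (ψ n)) * sin (j n * δ (ψ n))
      ≤ hwH K t + 2 * M * δ (ψ n) := by
    intro n
    have h1 := hab (ψ n) (j n)
    have h2 := hwd_le hL ((j n - i (ψ n) : ℤ) * δ (ψ n)) hx
    have h3 := hwH_lip hK hne hM (j n * δ (ψ n)) t
    have hM0 : 0 ≤ M := (norm_nonneg _).trans (hM 0 (interior_subset h0))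
    have h4 : 2 * M * |(j n : ℝ) * δ (ψ n) - t| ≤ 2 * M * δ (ψ n) := by
      have := hjd n; gcongr
    unfold hwd at h2
    push_cast at h2 h1
    rw [sub_mul] at h1 h2
    rw [cos_sub, sin_sub] at h2
    linarith
  have lL : Filter.Tendsto (fun n => (cos (i (ψ n) * δ (ψ n)) * x 0 - sin (i (ψ n) * δ (ψ n)) * x 1 - a (ψ n)) * cos (j n * δ (ψ n))
      + (sin (i (ψ n) * δ (ψ n)) * x 0 + cos (i (ψ n) * δ (ψ n)) * x 1 - b (ψ n)) * sin (j n * δ (ψ n))) Filter.atTop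
      (nhds ((c * x 0 - s * x 1 - α) * cos t + (s * x 0 + c * x 1 - β) * sin t)) := by
    have k1 := (continuous_cos.tendsto t).comp hjlim
    have k2 := (continuous_sin.tendsto t).comp hjlim
    exact ((((lc.mul_const _).sub (ls.mul_const _)).sub la).mul k1).add
      ((((ls.mul_const _).add (lc.mul_const _)).sub lb).mul k2)
  have lR : Filter.Tendsto (fun n => hwH K t + 2 * M * δ (ψ n)) Filter.atTop (nhds (hwH K t + 2 * M * 0)) :=
    tendsto_const_nhds.add (hδlim'.const_mul _)
  have := le_of_tendsto_of_tendsto' lL lR hineq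
  rw [mul_zero, add_zero] at this
  refine le_trans (le_of_eq ?_) this
  rw [hθc, hθs]
  simp [hwd, rot]
  ring

section
open scoped Pointwise

lemma hw_strict {K L : Set (EuclideanSpace ℝ (Fin 2))} (hK : IsCompact K) (hc : Convex ℝ K)
    (h0 : (0 : EuclideanSpace ℝ (Fin 2)) ∈ interior K) (hL : IsCompact L) (lc : Convex ℝ L)
    (l0 : (0 : EuclideanSpace ℝ (Fin 2)) ∈ interior L)
    (h : euclPerim K * euclPerim L < 2 * π * (euclArea K + euclArea L)) :
    (∃ (θ : ℝ) (v : EuclideanSpace ℝ (Fin 2)), (fun p => v + rot θ p) '' K ⊆ L) ∨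
    (∃ (θ : ℝ) (v : EuclideanSpace ℝ (Fin 2)), (fun p => v + rot θ p) '' L ⊆ K) := by
  have hδlim : Filter.Tendsto (fun p : ℕ => π / (2 * p : ℕ)) Filter.atTop (nhds 0) := by
    have h1 : Filter.Tendsto (fun n : ℕ => ((2 * n : ℕ) : ℝ)) Filter.atTop Filter.atTop := by
      refine tendsto_natCast_atTop_atTop.comp ?_
      refine Filter.tendsto_atTop_mono (fun n => ?_) Filter.tendsto_id
      simp only [id]; omega
    exact h1.const_div_atTop π
  have hl : Filter.Tendsto (fun p : ℕ => 2 * π * sinc (π / (2 * p : ℕ)) * (euclArea K + euclArea L))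
      Filter.atTop (nhds (2 * π * 1 * (euclArea K + euclArea L))) := by
    have := (continuous_sinc.tendsto 0).comp hδlim
    rw [sinc_zero] at this
    exact (this.const_mul _).mul_const _
  rw [mul_one] at hl
  have hev := (hl.eventually (lt_mem_nhds h)).and (Filter.eventually_gt_atTop 0)
  have hor : ∀ᶠ p : ℕ in Filter.atTop, (0 < p ∧ hwC L K (π / (2 * p : ℕ))) ∨
      (0 < p ∧ hwC K L (π / (2 * p : ℕ))) := by
    filter_upwards [hev] with p hp
    obtain ⟨hp, hp0⟩ := hp
    by_contra hcon
    push Not at hcon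
    have hpp : (0:ℝ) < (2 * p : ℕ) := by exact_mod_cast (by omega : 0 < 2 * p)
    have := hw_disc hK hc h0 hL lc l0 p hp0 (π / (2 * p : ℕ)) (by field_simp) (hcon.2 hp0) (hcon.1 hp0)
    have e : 2 * π * sinc (π / (2 * p : ℕ)) = 2 * (2 * p : ℕ) * sin (π / (2 * p : ℕ)) := by
      rw [sinc_of_ne_zero (by have := pi_pos; positivity)]
      have := pi_pos
      field_simp
    rw [e] at hp
    linarith
  rcases Filter.frequently_or_distrib.1 hor.frequently with hf | hf
  · exact Or.inl (hw_limit hL lc l0 hK h0 hf)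
  · exact Or.inr (hw_limit hK hc h0 hL l0 hf)

lemma hw_area_smul (K : Set (EuclideanSpace ℝ (Fin 2))) {t : ℝ} (ht : 0 < t) :
    euclArea (t • K) = t ^ 2 * euclArea K := by
  unfold euclArea
  rw [Measure.addHaar_smul]
  simp
  exact Or.inl (sq_nonneg t)

lemma hw_frontier_smul (K : Set (EuclideanSpace ℝ (Fin 2))) {t : ℝ} (ht : 0 < t) :
    frontier (t • K) = t • frontier K :=
  ((Homeomorph.smulOfNeZero t ht.ne').image_frontier K).symm

lemma hw_perim_smul (K : Set (EuclideanSpace ℝ (Fin 2))) {t : ℝ} (ht : 0 < t) :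
    euclPerim (t • K) = t * euclPerim K := by
  unfold euclPerim
  rw [hw_frontier_smul K ht, Measure.hausdorffMeasure_smul₀ zero_le_one ht.ne']
  simp [abs_of_pos ht]

lemma hw_scale_limit {K L : Set (EuclideanSpace ℝ (Fin 2))} (h0 : (0 : EuclideanSpace ℝ (Fin 2)) ∈ K)
    (hL : IsCompact L) (t : ℕ → ℝ) (ht : Filter.Tendsto t Filter.atTop (nhds 1))
    (h : ∀ n, ∃ (θ : ℝ) (v : EuclideanSpace ℝ (Fin 2)), (fun p => v + rot θ p) '' (t n • K) ⊆ L) :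
    ∃ (θ : ℝ) (v : EuclideanSpace ℝ (Fin 2)), (fun p => v + rot θ p) '' K ⊆ L := by
  choose θ v hv using h
  have hvx : ∀ n, ∀ x ∈ K, v n + rot (θ n) (t n • x) ∈ L := fun n x hx =>
    hv n ⟨_, Set.smul_mem_smul_set hx, rfl⟩
  have hbox : ∀ n, (cos (θ n), sin (θ n), v n) ∈
      Set.Icc (-1:ℝ) 1 ×ˢ (Set.Icc (-1:ℝ) 1 ×ˢ L) := by
    intro n
    refine ⟨⟨neg_one_le_cos _, cos_le_one _⟩, ⟨neg_one_le_sin _, sin_le_one _⟩, ?_⟩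
    have := hvx n 0 h0
    have e : rot (θ n) (t n • 0) = 0 := by
      ext i; fin_cases i <;> simp [rot]
    rwa [e, add_zero] at this
  obtain ⟨⟨c, s, w⟩, -, ψ, hψ, hlim⟩ := (isCompact_Icc.prod (isCompact_Icc.prod
    hL)).tendsto_subseq hbox
  have lc : Filter.Tendsto (fun n => cos (θ (ψ n))) Filter.atTop (nhds c) :=
    (continuous_fst.tendsto _).comp hlim
  have ls : Filter.Tendsto (fun n => sin (θ (ψ n))) Filter.atTop (nhds s) :=
    ((continuous_fst.comp continuous_snd).tendsto _).comp hlim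
  have lv : Filter.Tendsto (fun n => v (ψ n)) Filter.atTop (nhds w) :=
    ((continuous_snd.comp continuous_snd).tendsto _).comp hlim
  have hcs : c ^ 2 + s ^ 2 = 1 := by
    have h1 := (lc.pow 2).add (ls.pow 2)
    have h2 : (fun n => cos (θ (ψ n)) ^ 2 + sin (θ (ψ n)) ^ 2) = fun _ => 1 := by
      funext n; exact cos_sq_add_sin_sq _
    rw [h2] at h1
    exact tendsto_nhds_unique h1 tendsto_const_nhds
  obtain ⟨τ, hτc, hτs⟩ : ∃ θ, c = cos θ ∧ s = sin θ := by
    obtain ⟨θ, -, e⟩ := hw_polar !₂[c, s]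
    have hn : ‖(!₂[c, s] : EuclideanSpace ℝ (Fin 2))‖ = 1 := by
      apply (sq_eq_sq₀ (norm_nonneg _) zero_le_one).1
      rw [hw_normsq]; simpa using hcs
    rw [hn, one_smul] at e
    exact ⟨θ, by simpa [hwu] using congrArg (fun z => z 0) e, by simpa [hwu] using congrArg (fun z => z 1) e⟩
  refine ⟨τ, w, ?_⟩
  rintro _ ⟨x, hx, rfl⟩
  have hrot : ∀ (a r : ℝ), rot a (r • x) =
      (r * cos a) • x + (r * sin a) • !₂[- x 1, x 0] := by
    intro a r
    ext i; fin_cases i <;> simp [rot] <;> ring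
  have lt : Filter.Tendsto (fun n => t (ψ n)) Filter.atTop (nhds 1) := ht.comp hψ.tendsto_atTop
  have hl : Filter.Tendsto (fun n => v (ψ n) + rot (θ (ψ n)) (t (ψ n) • x)) Filter.atTop
      (nhds (w + rot τ x)) := by
    have e : rot τ x = (1 * c) • x + (1 * s) • !₂[- x 1, x 0] := by
      rw [hτc, hτs, ← hrot, one_smul]
    rw [e]
    simp only [hrot]
    exact lv.add (((lt.mul lc).smul_const _).add ((lt.mul ls).smul_const _))
  exact hL.isClosed.mem_of_tendsto hl (Filter.Eventually.of_forall fun n => hvx _ x hx)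

lemma hw_nonstrict {K L : Set (EuclideanSpace ℝ (Fin 2))} (hK : IsCompact K) (hc : Convex ℝ K)
    (h0 : (0 : EuclideanSpace ℝ (Fin 2)) ∈ interior K) (hL : IsCompact L) (lc : Convex ℝ L)
    (l0 : (0 : EuclideanSpace ℝ (Fin 2)) ∈ interior L) (hA : euclArea K ≤ euclArea L)
    (h : euclPerim K * euclPerim L ≤ 2 * π * (euclArea K + euclArea L)) :
    (∃ (θ : ℝ) (v : EuclideanSpace ℝ (Fin 2)), (fun p => v + rot θ p) '' K ⊆ L) ∨
    (∃ (θ : ℝ) (v : EuclideanSpace ℝ (Fin 2)), (fun p => v + rot θ p) '' L ⊆ K) := by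
  by_contra hcon
  rw [not_or] at hcon
  obtain ⟨n1, n2⟩ := hcon
  apply n1
  have ALpos : 0 < euclArea K := by
    apply ENNReal.toReal_pos _ hK.measure_lt_top.ne
    exact (Measure.measure_pos_of_mem_nhds volume (mem_interior_iff_mem_nhds.1 h0)).ne'
  refine hw_scale_limit (interior_subset h0) hL (fun n : ℕ => 1 - 1 / 2 * (1 / ((n:ℝ) + 1))) ?_ fun n => ?_
  · have := (tendsto_one_div_add_atTop_nhds_zero_nat (𝕜 := ℝ)).const_mul (1/2)
    simpa using this.const_sub 1
  · beta_reduce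
    have q1 : (0:ℝ) < 1 / ((n:ℝ) + 1) := by positivity
    have q2 : 1 / ((n:ℝ) + 1) ≤ 1 := by
      rw [div_le_one (by positivity)]; linarith [(Nat.cast_nonneg n : (0:ℝ) ≤ n)]
    generalize ht : 1 - 1 / 2 * (1 / ((n:ℝ) + 1)) = t
    have t0 : 0 < t := by linarith
    have t1 : t < 1 := by linarith
    have hsub : t • K ⊆ K := by
      rintro _ ⟨x, hx, rfl⟩
      exact hc.smul_mem_of_zero_mem (interior_subset h0) hx ⟨t0.le, t1.le⟩
    have hi : (0 : EuclideanSpace ℝ (Fin 2)) ∈ interior (t • K) := by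
      rw [interior_smul₀ t0.ne']
      exact ⟨0, h0, smul_zero _⟩
    have hst : euclPerim (t • K) * euclPerim L < 2 * π * (euclArea (t • K) + euclArea L) := by
      rw [hw_area_smul K t0, hw_perim_smul K t0]
      have h1 : t * (euclPerim K * euclPerim L) ≤ t * (2 * π * (euclArea K + euclArea L)) := by
        gcongr
      have h2 : t * (euclArea K + euclArea L) < t ^ 2 * euclArea K + euclArea L := by
        have h3 : t * euclArea K < euclArea L := by nlinarith
        have h4 := mul_pos (sub_pos.2 t1) (sub_pos.2 h3)
        nlinarith
      have h3 := mul_lt_mul_of_pos_left h2 (show 0 < 2 * π by have := pi_pos; positivity)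
      linarith
    rcases hw_strict (hK.smul t) (hc.smul t) hi hL lc l0 hst with h | ⟨θ, v, h⟩
    · exact h
    · exact absurd ⟨θ, v, h.trans hsub⟩ n2

lemma hw_area_trans (K : Set (EuclideanSpace ℝ (Fin 2))) (c : EuclideanSpace ℝ (Fin 2)) :
    euclArea ((fun x => c + x) '' K) = euclArea K := by
  unfold euclArea
  rw [Set.image_add_left, measure_preimage_add]

lemma hw_perim_trans (K : Set (EuclideanSpace ℝ (Fin 2))) (c : EuclideanSpace ℝ (Fin 2)) :
    euclPerim ((fun x => c + x) '' K) = euclPerim K := by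
  unfold euclPerim
  have e : frontier ((fun x => c + x) '' K) = (IsometryEquiv.addLeft c) '' frontier K :=
    ((Homeomorph.addLeft c).image_frontier K).symm
  rw [e, IsometryEquiv.hausdorffMeasure_image]

lemma rot_add (θ : ℝ) (x y : EuclideanSpace ℝ (Fin 2)) : rot θ (x + y) = rot θ x + rot θ y := by
  ext i; fin_cases i <;> simp [rot] <;> ring

lemma hw_trans_back {K L : Set (EuclideanSpace ℝ (Fin 2))} (c d : EuclideanSpace ℝ (Fin 2))
    (h : ∃ (θ : ℝ) (v : EuclideanSpace ℝ (Fin 2)),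
      (fun p => v + rot θ p) '' ((fun x => c + x) '' K) ⊆ (fun x => d + x) '' L) :
    ∃ (θ : ℝ) (v : EuclideanSpace ℝ (Fin 2)), (fun p => v + rot θ p) '' K ⊆ L := by
  obtain ⟨θ, v, h⟩ := h
  refine ⟨θ, -d + v + rot θ c, ?_⟩
  rintro _ ⟨x, hx, rfl⟩
  obtain ⟨y, hy, e⟩ := h ⟨_, ⟨x, hx, rfl⟩, rfl⟩
  simp only [rot_add] at e
  have : -d + v + rot θ c + rot θ x = y := by
    rw [add_assoc, add_assoc, ← e]; abel
  simpa only [this] using hy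

lemma hw_trans_int {K : Set (EuclideanSpace ℝ (Fin 2))} {c : EuclideanSpace ℝ (Fin 2)}
    (hc : c ∈ interior K) : (0 : EuclideanSpace ℝ (Fin 2)) ∈ interior ((fun x => -c + x) '' K) := by
  have e : (fun x => -c + x) '' interior K = interior ((fun x => -c + x) '' K) :=
    (Homeomorph.addLeft (-c)).image_interior K
  rw [← e]
  exact ⟨c, hc, by simp⟩

end

/-- Hadwiger's containment theorem in the Euclidean plane: if
`P_K·P_L ≤ 2π(A_K + A_L)` then a rigid motion (rotation followed by a translation)
takes `K` into `L` or `L` into `K`. -/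
theorem hadwiger_containment_euclidean (K L : Set (EuclideanSpace ℝ (Fin 2)))
    (hKcomp : IsCompact K) (hKconv : Convex ℝ K) (hKint : (interior K).Nonempty)
    (hLcomp : IsCompact L) (hLconv : Convex ℝ L) (hLint : (interior L).Nonempty)
    (h : euclPerim K * euclPerim L ≤ 2 * π * (euclArea K + euclArea L)) :
    ∃ (θ : ℝ) (v : EuclideanSpace ℝ (Fin 2)),
      ((fun p => v + rot θ p) '' K ⊆ L) ∨ ((fun p => v + rot θ p) '' L ⊆ K) := by
  obtain ⟨c, hc⟩ := hKint
  obtain ⟨d, hd⟩ := hLint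
  set K' := (fun x => -c + x) '' K with hK'
  set L' := (fun x => -d + x) '' L with hL'
  have h' : euclPerim K' * euclPerim L' ≤ 2 * π * (euclArea K' + euclArea L') := by
    rw [hK', hL', hw_perim_trans, hw_perim_trans, hw_area_trans, hw_area_trans]
    exact h
  have kc : IsCompact K' := hKcomp.image (by fun_prop)
  have lc : IsCompact L' := hLcomp.image (by fun_prop)
  have kv : Convex ℝ K' := hKconv.translate (-c)
  have lv : Convex ℝ L' := hLconv.translate (-d)
  have ki := hw_trans_int hc
  have li := hw_trans_int hd
  have main : (∃ (θ : ℝ) (v : EuclideanSpace ℝ (Fin 2)), (fun p => v + rot θ p) '' K' ⊆ L') ∨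
      (∃ (θ : ℝ) (v : EuclideanSpace ℝ (Fin 2)), (fun p => v + rot θ p) '' L' ⊆ K') := by
    rcases le_total (euclArea K') (euclArea L') with hA | hA
    · exact hw_nonstrict kc kv ki lc lv li hA h'
    · exact (hw_nonstrict lc lv li kc kv ki hA (by rw [mul_comm, add_comm]; exact h')).symm
  rcases main with m | m
  · obtain ⟨θ, v, hv⟩ := hw_trans_back _ _ m
    exact ⟨θ, v, Or.inl hv⟩
  · obtain ⟨θ, v, hv⟩ := hw_trans_back _ _ m
    exact ⟨θ, v, Or.inr hv⟩
end

section
/- (Monotonicity of perimeter, Euclidean case.) Let K and L be compact convex sets in ℝ² with nonempty interiors such that K ⊆ L. Then P_K ≤ P_L. -/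
open MeasureTheory Metric Real

abbrev PlaneE := EuclideanSpace ℝ (Fin 2)

lemma perim_exists_normal (K L : Set PlaneE)
    (hKc : IsClosed K) (hKconv : Convex ℝ K) (hKint : (interior K).Nonempty)
    (hL : Bornology.IsBounded L) (hKL : K ⊆ L) (x : PlaneE) (hx : x ∈ frontier K) :
    ∃ v : PlaneE, x + v ∈ frontier L ∧ ∀ y ∈ K, inner ℝ v (y - x) ≤ 0 := by
  have hxK : x ∈ K := hKc.frontier_subset hx
  obtain ⟨f, hf⟩ := geometric_hahn_banach_open_point hKconv.interior isOpen_interior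
    (x := x) (fun h => hx.2 h)
  have hfK : ∀ y ∈ K, f y ≤ f x := by
    intro y hy
    have h1 : y ∈ closure (interior K) := by
      rw [hKconv.closure_interior_eq_closure_of_nonempty_interior hKint]
      exact subset_closure hy
    have h2 : closure (interior K) ⊆ {y | f y ≤ f x} :=
      closure_minimal (fun z hz => (hf z hz).le) (isClosed_le f.continuous continuous_const)
    exact h2 h1
  set u : PlaneE := (InnerProductSpace.toDual ℝ PlaneE).symm f with hu
  have hfu : ∀ y, inner ℝ u y = f y := fun y => InnerProductSpace.toDual_symm_apply
  have hu0 : u ≠ 0 := by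
    intro h0
    obtain ⟨z, hz⟩ := hKint
    have := hf z hz
    rw [← hfu, ← hfu, h0] at this
    simp at this
  obtain ⟨R, hR⟩ := hL.subset_closedBall (x : PlaneE)
  have hun : 0 < ‖u‖ := norm_pos_iff.2 hu0
  let S : Set PlaneE := (fun t : ℝ => x + t • u) '' Set.Ici 0
  have hS : IsPreconnected S :=
    isPreconnected_Ici.image _ (by fun_prop)
  have hx0 : x ∈ S := ⟨0, by simp, by simp⟩
  have hout : (S ∩ Lᶜ).Nonempty := by
    refine ⟨x + ((|R| + 1) / ‖u‖) • u, ⟨_, ?_, rfl⟩, fun h => ?_⟩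
    · simp only [Set.mem_Ici]; positivity
    · have := hR h
      rw [mem_closedBall, dist_eq_norm, add_sub_cancel_left, norm_smul, Real.norm_eq_abs,
        abs_of_nonneg (by positivity), div_mul_cancel₀ _ hun.ne'] at this
      linarith [le_abs_self R]
  obtain ⟨_, ⟨t, ht, rfl⟩, hfr⟩ : (S ∩ frontier L).Nonempty := by
    by_contra hne
    have hdis : S ⊆ interior L ∪ (closure L)ᶜ := by
      intro z hz
      by_contra hzn
      simp only [Set.mem_union, Set.mem_compl_iff, not_or, not_not] at hzn
      exact hne ⟨z, hz, hzn.2, hzn.1⟩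
    obtain ⟨w, hwS, hwL⟩ := hout
    have hxi : x ∈ interior L := by
      rcases hdis hx0 with h | h
      · exact h
      · exact absurd (subset_closure (hKL hxK)) h
    have hwc : w ∈ (closure L)ᶜ := by
      rcases hdis hwS with h | h
      · exact absurd (interior_subset h) hwL
      · exact h
    obtain ⟨z, -, hz1, hz2⟩ := hS _ _ isOpen_interior isClosed_closure.isOpen_compl hdis
      ⟨x, hx0, hxi⟩ ⟨w, hwS, hwc⟩
    exact hz2 (subset_closure (interior_subset hz1))
  refine ⟨t • u, hfr, fun y hy => ?_⟩
  rw [real_inner_smul_left, hfu, map_sub]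
  exact mul_nonpos_of_nonneg_of_nonpos ht (sub_nonpos.2 (hfK y hy))

lemma perim_measure_le (K L : Set PlaneE)
    (hKc : IsClosed K) (hKconv : Convex ℝ K) (hKint : (interior K).Nonempty)
    (hL : Bornology.IsBounded L) (hKL : K ⊆ L) :
    μH[1] (frontier K) ≤ μH[1] (frontier L) := by
  choose v hv1 hv2 using perim_exists_normal K L hKc hKconv hKint hL hKL
  let g : frontier K → PlaneE := fun x => x.1 + v x.1 x.2
  have hg : AntilipschitzWith 1 g := by
    refine AntilipschitzWith.of_le_mul_dist fun a b => ?_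
    obtain ⟨a, ha⟩ := a
    obtain ⟨b, hb⟩ := b
    have h1 := hv2 a ha b (hKc.frontier_subset hb)
    have h2 := hv2 b hb a (hKc.frontier_subset ha)
    simp only [g, NNReal.coe_one, one_mul, Subtype.dist_eq, dist_eq_norm]
    generalize v a ha = p at *
    generalize v b hb = q at *
    have e : a + p - (b + q) = (a - b) + (p - q) := by abel
    have h3 : 0 ≤ inner ℝ (a - b) (p - q) := by
      rw [inner_sub_right, real_inner_comm, real_inner_comm q]
      have : b - a = -(a - b) := by abel
      rw [this, inner_neg_right] at h1
      linarith
    rw [e]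
    refine le_of_sq_le_sq ?_ (norm_nonneg _)
    rw [norm_add_sq_real]
    nlinarith [sq_nonneg ‖p - q‖]
  have h := hg.le_hausdorffMeasure_image (d := 1) zero_le_one Set.univ
  have hi := (isometry_subtype_coe (s := frontier K)).hausdorffMeasure_image (d := 1)
    (Or.inl zero_le_one) Set.univ
  rw [Set.image_univ, Subtype.range_coe] at hi
  rw [hi]
  refine h.trans ?_
  simp only [ENNReal.coe_one, ENNReal.one_rpow, one_mul]
  refine measure_mono ?_
  rintro _ ⟨x, -, rfl⟩
  exact hv1 x.1 x.2

lemma perim_sphere_lt_top (R : ℝ) (hR : 0 ≤ R) :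
    μH[1] (sphere (0 : PlaneE) R) < ⊤ := by
  have e := Complex.orthonormalBasisOneI.repr
  have h1 : sphere (0 : PlaneE) R ⊆ e '' (circleMap 0 R '' Set.Ioc 0 (2 * π)) := by
    rw [image_circleMap_Ioc, abs_of_nonneg hR]
    intro z hz
    refine ⟨e.symm z, ?_, by simp⟩
    simpa using hz
  refine (measure_mono h1).trans_lt ?_
  rw [e.isometry.hausdorffMeasure_image (Or.inl zero_le_one)]
  refine ((lipschitzWith_circleMap 0 R).hausdorffMeasure_image_le zero_le_one _).trans_lt ?_
  rw [hausdorffMeasure_real, Real.volume_Ioc]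
  exact ENNReal.mul_lt_top (by simp) ENNReal.ofReal_lt_top

/-- Monotonicity of perimeter for compact convex sets in the Euclidean plane. -/
theorem perimeter_monotone_euclidean (K L : Set (EuclideanSpace ℝ (Fin 2)))
    (hKcomp : IsCompact K) (hKconv : Convex ℝ K) (hKint : (interior K).Nonempty)
    (hLcomp : IsCompact L) (hLconv : Convex ℝ L) (hLint : (interior L).Nonempty)
    (hKL : K ⊆ L) :
    euclPerim K ≤ euclPerim L := by
  unfold euclPerim
  refine ENNReal.toReal_mono ?_
    (perim_measure_le K L hKcomp.isClosed hKconv hKint hLcomp.isBounded hKL)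
  obtain ⟨R, hR⟩ := hLcomp.isBounded.subset_closedBall 0
  have h := perim_measure_le L (closedBall 0 (max R 1)) hLcomp.isClosed hLconv hLint
    isBounded_closedBall (hR.trans (closedBall_subset_closedBall (le_max_left _ _)))
  rw [frontier_closedBall _ (by positivity)] at h
  exact (h.trans_lt (perim_sphere_lt_top _ (by positivity))).ne
end
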